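/- For every α > 0, every ν > 0 and every Δ ∈ ℕ, there exist ξ, η > 0 and n₀ ∈ ℕ such that the following holds for all n ≥ n₀. Let G be a (2n+1)-vertex graph such that d_G(v) = (α ± ξ)n for all vertices v ∈ V(G) except at most ξn vertices, and with bi-independence number ᾶ(G) ≤ ηn. Then for any n-vertex tree T with Δ(T) ≤ Δ, the collection consisting of ⌊(1−ν)αn⌋ copies of T packs into G. -/

import Mathlib

open SimpleGraph

namespace ApproxDecomp

/-- The degree of a vertex, as the cardinality of its neighbour set. -/
noncomputable def deg {V : Type*} (G : SimpleGraph V) (v : V) : ℕ :=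
  (G.neighborSet v).ncard

/-- An `(s,t)`-bipartite hole: two disjoint vertex sets of sizes `s`, `t`
with no edges between them. -/
def HasBipartiteHole {V : Type*} (G : SimpleGraph V) (s t : ℕ) : Prop :=
  ∃ S T : Finset V, Disjoint S T ∧ S.card = s ∧ T.card = t ∧
    ∀ a ∈ S, ∀ b ∈ T, ¬ G.Adj a b

/-- The bi-independence number: the largest `r` such that `G` has an
`(s,t)`-bipartite hole for every `s + t = r`. -/
noncomputable def biIndep {V : Type*} (G : SimpleGraph V) : ℕ :=
  sSup {r : ℕ | ∀ s t : ℕ, s + t = r → HasBipartiteHole G s t}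

/-- A collection of graphs `T i` packs into `G`: there are embeddings whose
edge images are pairwise disjoint. -/
def PacksInto {V : Type*} {τ : ℕ} {m : Fin τ → ℕ}
    (T : ∀ i, SimpleGraph (Fin (m i))) (G : SimpleGraph V) : Prop :=
  ∃ φ : ∀ i, Fin (m i) → V,
    (∀ i, Function.Injective (φ i)) ∧
    (∀ i a b, (T i).Adj a b → G.Adj (φ i a) (φ i b)) ∧
    (∀ i j, i ≠ j → ∀ e ∈ (T i).edgeSet, ∀ f ∈ (T j).edgeSet,
      Sym2.map (φ i) e ≠ Sym2.map (φ j) f)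

section PartA1

/-- A tree given by a parent array on `0, …, n-1`, with at most `Δ` children per vertex. -/
structure ParArr (n Δ : ℕ) (par : ℕ → ℕ) : Prop where
  lt : ∀ v, v ≠ 0 → par v < v
  ch : ∀ u, ((Finset.range n).filter (fun v => v ≠ 0 ∧ par v = u)).card ≤ Δ

theorem exists_parArr {n Δ : ℕ} (T : SimpleGraph (Fin n)) (hT : T.IsTree)
    (hd : ∀ v, deg T v ≤ Δ) :
    ∃ (par : ℕ → ℕ) (e : Fin n → ℕ), ParArr n Δ par ∧ Function.Injective e ∧
      (∀ a, e a < n) ∧ ∀ a b, T.Adj a b →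
        (e a ≠ 0 ∧ par (e a) = e b) ∨ (e b ≠ 0 ∧ par (e b) = e a) := by
  classical
  have hconn := hT.connected
  have : Nonempty (Fin n) := hconn.nonempty
  have hn : 0 < n := Fin.pos_iff_nonempty.mpr inferInstance
  let r : Fin n := ⟨0, hn⟩
  let dp : Fin n → ℕ := fun v => T.dist r v
  have hpr : ∀ v, v ≠ r → ∃ u, T.Adj v u ∧ dp u < dp v := by
    intro v hv
    obtain ⟨p, hp⟩ := hconn.exists_walk_length_eq_dist v r
    cases p with
    | nil => exact absurd rfl hv
    | cons h q =>
      rename_i u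
      refine ⟨u, h, ?_⟩
      have h1 : T.dist u r ≤ q.length := SimpleGraph.dist_le q
      have h2 : q.length + 1 = T.dist v r := by simpa using hp
      show T.dist r u < T.dist r v
      rw [SimpleGraph.dist_comm, SimpleGraph.dist_comm (u := r) (v := v)]
      omega
  choose! pr hpr1 hpr2 using hpr
  let σ := Tuple.sort dp
  have hmono : Monotone (dp ∘ σ) := Tuple.monotone_sort dp
  have hσlt : ∀ a b, dp a < dp b → σ.symm a < σ.symm b := by
    intro a b hab
    by_contra hcon
    have := hmono (not_lt.mp hcon)
    simp at this
    omega
  have hσ0 : σ ⟨0, hn⟩ = r := by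
    have h1 : dp (σ ⟨0, hn⟩) ≤ dp r := by
      have := hmono (show (⟨0, hn⟩ : Fin n) ≤ σ.symm r from Nat.zero_le _)
      simpa using this
    have h2 : dp r = 0 := by simp [dp]
    have h3 : T.dist r (σ ⟨0, hn⟩) = 0 := by
      have h4 : T.dist r (σ ⟨0, hn⟩) ≤ dp r := h1
      omega
    exact ((hconn.dist_eq_zero_iff).mp h3).symm
  have hedge : ∀ a b, T.Adj a b → (a ≠ r ∧ pr a = b) ∨ (b ≠ r ∧ pr b = a) := by
    let S : Finset (Sym2 (Fin n)) := (Finset.univ.erase r).image (fun v => s(v, pr v))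
    have hS : S ⊆ T.edgeFinset := by
      intro x hx
      simp only [S, Finset.mem_image, Finset.mem_erase, Finset.mem_univ, and_true] at hx
      obtain ⟨v, hv, rfl⟩ := hx
      simpa using hpr1 v hv
    have hc : S.card = n - 1 := by
      rw [Finset.card_image_of_injOn]
      · simp
      · intro v hv w hw hvw
        simp at hv hw
        simp only [Sym2.eq_iff] at hvw
        rcases hvw with h | ⟨h1, h2⟩
        · exact h.1
        · have a1 := hpr2 v hv
          have a2 := hpr2 w hw
          rw [← h1] at a2; rw [h2] at a1; omega
    have hce : T.edgeFinset.card + 1 = n := by simpa using hT.card_edgeFinset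
    have hEq : S = T.edgeFinset := Finset.eq_of_subset_of_card_le hS (by omega)
    intro a b hab
    have : s(a, b) ∈ S := by rw [hEq]; simpa using hab
    simp only [S, Finset.mem_image, Finset.mem_erase, Finset.mem_univ, and_true, Sym2.eq_iff] at this
    obtain ⟨v, hv, h | h⟩ := this
    · left; rw [← h.1]; exact ⟨hv, h.2⟩
    · right; rw [← h.1]; exact ⟨hv, h.2⟩
  refine ⟨fun k => if h : k < n ∧ k ≠ 0 then (σ.symm (pr (σ ⟨k, h.1⟩))).val else 0,
    fun a => (σ.symm a).val, ⟨?_, ?_⟩, ?_, ?_, ?_⟩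
  · intro v hv
    by_cases h : v < n ∧ v ≠ 0
    · simp only [h, dif_pos, and_self, ne_eq, not_false_eq_true]
      have hne : σ ⟨v, h.1⟩ ≠ r := by
        rw [← hσ0]; intro hh
        have := σ.injective hh
        simp at this; exact hv this
      have := Fin.lt_def.mp (hσlt _ _ (hpr2 _ hne))
      simpa using this
    · simp only [h, dif_neg, not_false_eq_true]; omega
  · intro u
    by_cases hu : u < n
    · refine le_trans ?_ (hd (σ ⟨u, hu⟩))
      unfold deg
      rw [Set.ncard_eq_toFinset_card']
      let g : ℕ → Fin n := fun k => if h : k < n then σ ⟨k, h⟩ else r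
      apply Finset.card_le_card_of_injOn g
      · intro v hv
        simp only [Finset.coe_filter, Finset.mem_range, Set.mem_ofPred_eq] at hv
        obtain ⟨hvn, hv0, hp⟩ := hv
        simp only [hvn, hv0, ne_eq, not_false_eq_true, and_self, dif_pos] at hp
        have hne : σ ⟨v, hvn⟩ ≠ r := by
          rw [← hσ0]; intro hh
          have := σ.injective hh
          simp at this; exact hv0 this
        have h1 := hpr1 _ hne
        have h2 : pr (σ ⟨v, hvn⟩) = σ ⟨u, hu⟩ := by
          rw [← Equiv.symm_apply_eq]; exact Fin.ext hp
        simp only [g, hvn, dif_pos, Set.coe_toFinset, SimpleGraph.mem_neighborSet]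
        rw [← h2]; exact h1.symm
      · intro v hv w hw hvw
        simp only [Finset.coe_filter, Finset.mem_range, Set.mem_ofPred_eq] at hv hw
        simp only [g, hv.1, hw.1, dif_pos] at hvw
        simpa using hvw
    · rw [Finset.card_eq_zero.mpr]
      · exact Nat.zero_le _
      · rw [Finset.filter_eq_empty_iff]
        intro v hv hh
        obtain ⟨hv0, hp⟩ := hh
        simp only [Finset.mem_range.mp hv, hv0, ne_eq, not_false_eq_true, and_self, dif_pos] at hp
        have := (σ.symm (pr (σ ⟨v, Finset.mem_range.mp hv⟩))).isLt
        omega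
  · intro a b h
    exact σ.symm.injective (Fin.ext h)
  · intro a; exact (σ.symm a).isLt
  · intro a b hab
    have key : ∀ a b, a ≠ r → pr a = b → ((σ.symm a).val ≠ 0 ∧ 
       (if h : (σ.symm a).val < n ∧ (σ.symm a).val ≠ 0 then (σ.symm (pr (σ ⟨(σ.symm a).val, h.1⟩))).val else 0) = (σ.symm b).val) := by
      intro a b ha hb
      have h0 : (σ.symm a).val ≠ 0 := by
        intro h
        apply ha
        rw [← hσ0, ← Equiv.symm_apply_eq]; exact Fin.ext h
      refine ⟨h0, ?_⟩
      rw [dif_pos ⟨(σ.symm a).isLt, h0⟩]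
      simp [hb]
    rcases hedge a b hab with ⟨h1, h2⟩ | ⟨h1, h2⟩
    · exact Or.inl (key a b h1 h2)
    · exact Or.inr (key b a h1 h2)

theorem packs_of_arr {n Δ τ : ℕ} {V : Type*} (G : SimpleGraph V) (T : SimpleGraph (Fin n))
    (hT : T.IsTree) (hd : ∀ v, deg T v ≤ Δ)
    (H : ∀ par : ℕ → ℕ, ParArr n Δ par → ∃ φ : Fin τ → ℕ → V,
      (∀ i, Set.InjOn (φ i) {v | v < n}) ∧
      (∀ i, ∀ v, v < n → v ≠ 0 → G.Adj (φ i v) (φ i (par v))) ∧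
      (∀ i j, i ≠ j → ∀ v w, v < n → v ≠ 0 → w < n → w ≠ 0 →
        s(φ i v, φ i (par v)) ≠ s(φ j w, φ j (par w)))) :
    PacksInto (fun _ : Fin τ => T) G := by
  obtain ⟨par, e, hp, he, hlt, hadj⟩ := exists_parArr T hT hd
  obtain ⟨φ, h1, h2, h3⟩ := H par hp
  have key : ∀ a b, T.Adj a b → ∃ v, v < n ∧ v ≠ 0 ∧ ∀ i, s(φ i (e a), φ i (e b)) = s(φ i v, φ i (par v)) := by
    intro a b hab
    rcases hadj a b hab with ⟨x, y⟩ | ⟨x, y⟩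
    · exact ⟨e a, hlt a, x, fun i => by rw [y]⟩
    · exact ⟨e b, hlt b, x, fun i => by rw [y, Sym2.eq_swap]⟩
  refine ⟨fun i a => φ i (e a), ?_, ?_, ?_⟩
  · intro i a b hab
    exact he (h1 i (hlt a) (hlt b) hab)
  · intro i a b hab
    obtain ⟨v, hv, hv0, hs⟩ := key a b hab
    have := h2 i v hv hv0
    rw [← SimpleGraph.mem_edgeSet, hs i, SimpleGraph.mem_edgeSet]
    exact this
  · intro i j hij x hx y hy
    induction x using Sym2.ind with
    | _ a b =>
    induction y using Sym2.ind with
    | _ c d =>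
    obtain ⟨v, hv, hv0, hs⟩ := key a b hx
    obtain ⟨w, hw, hw0, hs'⟩ := key c d hy
    simp only [Sym2.map_mk]
    rw [hs i, hs' j]
    exact h3 i j hij v w hv hv0 hw hw0

/-- recursion along a parent array -/
theorem exists_rec {X : Type*} (par : ℕ → ℕ) (hp : ∀ v, v ≠ 0 → par v < v) (x0 : X)
    (F : ℕ → X → X) : ∃ f : ℕ → X, f 0 = x0 ∧ ∀ v, v ≠ 0 → f v = F v (f (par v)) := by
  classical
  let f : ℕ → X := fun v => Nat.strongRec (motive := fun _ => X)
    (fun v ih => if h : v = 0 then x0 else F v (ih (par v) (hp v h))) v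
  have hf : ∀ v, f v = if h : v = 0 then x0 else F v (f (par v)) := by
    intro v
    simp only [f]
    rw [Nat.strongRec]
  refine ⟨f, by rw [hf]; simp, fun v hv => by rw [hf]; simp [hv]⟩

end PartA1

section PartA2

open scoped Classical

theorem exists_childIndex {n Δ : ℕ} {par : ℕ → ℕ} (hP : ParArr n Δ par) :
    ∃ ch : ℕ → ℕ, (∀ v, v < n → v ≠ 0 → ch v < Δ) ∧
      ∀ v w, v ≠ 0 → w ≠ 0 → par v = par w → ch v = ch w → v = w := by
  classical
  let S : ℕ → Finset ℕ := fun v => (Finset.range v).filter (fun w => w ≠ 0 ∧ par w = par v)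
  refine ⟨fun v => (S v).card, ?_, ?_⟩
  · intro v hv hv0
    refine lt_of_lt_of_le ?_ (hP.ch (par v))
    apply Finset.card_lt_card
    rw [Finset.ssubset_iff_of_subset]
    · exact ⟨v, by simp [hv, hv0], by simp [S]⟩
    · intro w hw
      simp only [S, Finset.mem_filter, Finset.mem_range] at hw ⊢
      exact ⟨by omega, hw.2⟩
  · have key : ∀ v w, v < w → v ≠ 0 → w ≠ 0 → par v = par w → (S v).card < (S w).card := by
      intro v w hvw hv hw hp
      apply Finset.card_lt_card
      rw [Finset.ssubset_iff_of_subset]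
      · exact ⟨v, by simp [S, hvw, hv, hp], by simp [S]⟩
      · intro u hu
        simp only [S, Finset.mem_filter, Finset.mem_range] at hu ⊢
        exact ⟨by omega, hu.2.1, hu.2.2.trans hp⟩
    intro v w hv hw hp hc
    rcases lt_trichotomy v w with h | h | h
    · have := key v w h hv hw hp; simp only at hc; omega
    · exact h
    · have := key w v h hw hv hp.symm; simp only at hc; omega

theorem geom_aux (D L K : ℕ) (hK : K ≤ L + 1) :
    ∑ k ∈ Finset.range K, D ^ k * (D + 1) ^ (L - k) + D ^ K * (D + 1) ^ (L + 1 - K)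
      = (D + 1) ^ (L + 1) := by
  induction K with
  | zero => simp
  | succ K ih =>
    have h := ih (by omega)
    rw [Finset.sum_range_succ, ← h]
    have e1 : L + 1 - (K + 1) = L - K := by omega
    have e2 : L + 1 - K = (L - K) + 1 := by omega
    rw [e1, e2]
    ring

theorem sum_shift_mod (L d : ℕ) (f : ℕ → ℕ) :
    ∑ r ∈ Finset.range L, f ((d + r) % L) = ∑ k ∈ Finset.range L, f k := by
  have hinj : Set.InjOn (fun r => (d + r) % L) (Finset.range L : Set ℕ) := by
    intro a ha b hb hab
    simp at ha hb
    have h : d + a ≡ d + b [MOD L] := hab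
    have h2 := Nat.ModEq.add_left_cancel' d h
    rw [Nat.ModEq, Nat.mod_eq_of_lt ha, Nat.mod_eq_of_lt hb] at h2
    exact h2
  have himg : (Finset.range L).image (fun r => (d + r) % L) = Finset.range L := by
    apply Finset.eq_of_subset_of_card_le
    · intro x hx
      simp only [Finset.mem_image, Finset.mem_range] at hx ⊢
      obtain ⟨r, hr, rfl⟩ := hx
      exact Nat.mod_lt _ (by omega)
    · rw [Finset.card_image_of_injOn hinj]
  conv_rhs => rw [← himg]
  rw [Finset.sum_image hinj]

/-- The connector-set lemma. -/
theorem exists_connectors {n Δ L : ℕ} {par : ℕ → ℕ} (hP : ParArr n Δ par) (hΔ : 1 ≤ Δ)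
    (hL : 3 ≤ L) (ch : ℕ → ℕ) (hch : ∀ v, v < n → v ≠ 0 → ch v < Δ)
    (hch2 : ∀ v w, v ≠ 0 → w ≠ 0 → par v = par w → ch v = ch w → v = w) :
    ∃ (rl : ℕ → ℕ) (C : ℕ → Prop) (j : ℕ → ℕ),
      L * ((Finset.range n).filter (fun v => C v)).card ≤ n * (Δ + 1) ∧
      (∀ v, rl v < L) ∧ (∀ v, v ≠ 0 → rl v = (rl (par v) + 1) % L) ∧
      (∀ v, rl v ≤ 1 → C v) ∧ (∀ v, v ≠ 0 → 2 ≤ rl v → (C v ↔ (C (par v) ∧ ch v ≠ j (rl v)))) := by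
  classical
  obtain ⟨dp, dp0, hdp⟩ := exists_rec par hP.lt 0 (fun _ d => d + 1)
  have hrec : ∀ (rj : ℕ × (Fin L → Fin Δ)), ∃ f : ℕ → Prop,
      f 0 = ((dp 0 + rj.1) % L ≤ 1) ∧ ∀ v, v ≠ 0 → f v =
        ((dp v + rj.1) % L ≤ 1 ∨ (f (par v) ∧
          ch v ≠ (rj.2 ⟨(dp v + rj.1) % L, Nat.mod_lt _ (by omega)⟩).val)) := fun rj =>
    exists_rec par hP.lt ((dp 0 + rj.1) % L ≤ 1) (fun v p => ((dp v + rj.1) % L ≤ 1 ∨ (p ∧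
          ch v ≠ (rj.2 ⟨(dp v + rj.1) % L, Nat.mod_lt _ (by omega)⟩).val)))
  choose f hf0 hf using hrec
  -- counting
  have hanc : ∀ k, 1 ≤ k → k < L → ∀ v, v < n → ∃ c : Fin L → Fin Δ, ∀ r j, (dp v + r) % L = k → f (r, j) v →
      ∀ i : Fin L, 2 ≤ i.val → i.val ≤ k → j i ≠ c i := by
    intro k hk1
    induction k, hk1 using Nat.le_induction with
    | base => intro _ v _; exact ⟨fun _ => ⟨0, hΔ⟩, fun r j _ _ i h1 h2 => by omega⟩
    | succ k hk ih =>
      intro hkL v hv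
      by_cases hv0 : v = 0
      · subst hv0
        refine ⟨fun _ => ⟨0, hΔ⟩, fun r j h1 h2 i _ _ => ?_⟩
        rw [hf0] at h2
        simp only at h2
        omega
      · obtain ⟨c, hc⟩ := ih (by omega) (par v) (lt_trans (hP.lt v hv0) hv)
        refine ⟨Function.update c ⟨k + 1, hkL⟩ ⟨ch v, hch v hv hv0⟩, fun r j h1 h2 i hi1 hi2 => ?_⟩
        rw [hf _ v hv0] at h2
        simp only at h2
        rcases h2 with h2 | ⟨h2, h3⟩
        · omega
        · by_cases hik : i = ⟨k + 1, hkL⟩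
          · rw [hik, Function.update_self]
            intro h
            apply h3
            have : (⟨(dp v + r) % L, Nat.mod_lt _ (by omega)⟩ : Fin L) = ⟨k + 1, hkL⟩ := Fin.ext h1
            rw [this, h]
          · rw [Function.update_of_ne hik]
            have hne : i.val ≠ k + 1 := fun h => hik (Fin.ext h)
            refine hc r j ?_ h2 i hi1 (by omega)
            rw [hdp v hv0] at h1
            have : (dp (par v) + 1 + r) % L = ((dp (par v) + r) % L + 1) % L := by
              rw [Nat.mod_add_mod]; congr 1; ring
            rw [this] at h1
            have hlt : (dp (par v) + r) % L < L := Nat.mod_lt _ (by omega)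
            by_cases hlast : (dp (par v) + r) % L + 1 = L
            · rw [hlast, Nat.mod_self] at h1; omega
            · rw [Nat.mod_eq_of_lt (by omega)] at h1; omega
  let g : ℕ → ℕ := fun k => if k = 0 then Δ ^ L else (Δ - 1) ^ (k - 1) * Δ ^ (L - (k - 1))
  have hcnt : ∀ v, v < n → ∀ r, (Finset.univ.filter (fun j => f (r, j) v)).card ≤ g ((dp v + r) % L) := by
    intro v hv r
    simp only [g]
    split_ifs with h0
    · refine (Finset.card_le_univ _).trans ?_
      simp
    · have hlt : (dp v + r) % L < L := Nat.mod_lt _ (by omega)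
      obtain ⟨c, hc⟩ := hanc _ (Nat.one_le_iff_ne_zero.mpr h0) hlt v hv
      set k := (dp v + r) % L with hk
      let t : Fin L → Finset (Fin Δ) := fun i => if 2 ≤ i.val ∧ i.val ≤ k then Finset.univ.erase (c i) else Finset.univ
      have hsub : (Finset.univ.filter (fun j => f (r, j) v)) ⊆ Fintype.piFinset t := by
        intro j hj
        simp only [Finset.mem_filter, Finset.mem_univ, true_and] at hj
        rw [Fintype.mem_piFinset]
        intro i
        simp only [t]
        split_ifs with h
        · simpa using hc r j hk.symm hj i h.1 h.2
        · simp
      refine (Finset.card_le_card hsub).trans ?_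
      rw [Fintype.card_piFinset]
      have h1 : ∀ i, (t i).card = if 2 ≤ i.val ∧ i.val ≤ k then Δ - 1 else Δ := by
        intro i; simp only [t]; split_ifs <;> simp
      simp_rw [h1]
      rw [Fin.prod_univ_eq_prod_range (fun i => if 2 ≤ i ∧ i ≤ k then Δ - 1 else Δ) L,
        Finset.prod_ite, Finset.prod_const, Finset.prod_const]
      have h2 : ((Finset.range L).filter (fun i => 2 ≤ i ∧ i ≤ k)).card = k - 1 := by
        have : (Finset.range L).filter (fun i => 2 ≤ i ∧ i ≤ k) = Finset.Icc 2 k := by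
          ext i; simp; omega
        rw [this]; simp
      have h3 := Finset.card_filter_add_card_filter_not (s := Finset.range L) (fun i => 2 ≤ i ∧ i ≤ k)
      rw [h2, Finset.card_range] at h3
      rw [h2]
      have h4 : ((Finset.range L).filter (fun i => ¬ (2 ≤ i ∧ i ≤ k))).card = L - (k - 1) := by omega
      rw [h4]
  have hg : ∑ k ∈ Finset.range L, g k ≤ Δ ^ L * (Δ + 1) := by
    obtain ⟨L', rfl⟩ : ∃ L', L = L' + 1 := ⟨L - 1, by omega⟩
    rw [Finset.sum_range_succ']
    obtain ⟨D, rfl⟩ : ∃ D, Δ = D + 1 := ⟨Δ - 1, by omega⟩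
    have := geom_aux D (L' + 1) L' (by omega)
    simp only [g, Nat.add_eq_zero_iff, one_ne_zero, and_false, if_false, if_true, Nat.add_sub_cancel]
    have e : (D + 1) ^ (L' + 1) * (D + 1 + 1) = (D + 1) ^ (L' + 1 + 1) + (D + 1) ^ (L' + 1) := by ring
    rw [e]
    omega
  have hsum : ∑ rj ∈ Finset.range L ×ˢ (Finset.univ : Finset (Fin L → Fin Δ)),
      L * ((Finset.range n).filter (fun v => f rj v)).card ≤
      ∑ rj ∈ Finset.range L ×ˢ (Finset.univ : Finset (Fin L → Fin Δ)), n * (Δ + 1) := by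
    rw [Finset.sum_const, ← Finset.mul_sum, Finset.card_product, Finset.card_range, Finset.card_univ]
    simp only [Fintype.card_fun, Fintype.card_fin, smul_eq_mul]
    rw [mul_assoc]
    apply Nat.mul_le_mul_left
    have : ∑ rj ∈ Finset.range L ×ˢ (Finset.univ : Finset (Fin L → Fin Δ)), ((Finset.range n).filter (fun v => f rj v)).card
        = ∑ v ∈ Finset.range n, ∑ r ∈ Finset.range L, (Finset.univ.filter (fun j => f (r, j) v)).card := by
      simp only [Finset.card_filter]
      rw [Finset.sum_comm]
      refine Finset.sum_congr rfl fun v _ => ?_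
      rw [Finset.sum_product]
    rw [this]
    calc _ ≤ ∑ v ∈ Finset.range n, Δ ^ L * (Δ + 1) := by
          refine Finset.sum_le_sum fun v hv => ?_
          refine (Finset.sum_le_sum fun r _ => hcnt v (Finset.mem_range.mp hv) r).trans ?_
          rw [sum_shift_mod]; exact hg
      _ = _ := by rw [Finset.sum_const, Finset.card_range, smul_eq_mul]; ring
  have hne : (Finset.range L ×ˢ (Finset.univ : Finset (Fin L → Fin Δ))).Nonempty := by
    refine ⟨(0, fun _ => ⟨0, hΔ⟩), ?_⟩
    simp; omega
  obtain ⟨⟨r, j⟩, -, hrj⟩ := Finset.exists_le_of_sum_le hne hsum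
  refine ⟨fun v => (dp v + r) % L, f (r, j), fun k => if h : k < L then (j ⟨k, h⟩).val else 0, hrj, ?_, ?_, ?_, ?_⟩
  · intro v; exact Nat.mod_lt _ (by omega)
  · intro v hv
    simp only [hdp v hv]
    rw [Nat.mod_add_mod]; congr 1; ring
  · intro v hv
    by_cases h0 : v = 0
    · subst h0; rw [hf0]; exact hv
    · rw [hf _ v h0]; exact Or.inl hv
  · intro v h0 hv
    have hlt : (dp v + r) % L < L := Nat.mod_lt _ (by omega)
    rw [hf _ v h0]
    simp only [hlt, dif_pos]
    constructor
    · rintro (h | h)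
      · simp only at hv; omega
      · exact h
    · exact Or.inr

/-- pieces with addresses -/
theorem exists_pieces {n Δ L : ℕ} {par : ℕ → ℕ} (hP : ParArr n Δ par) (hΔ : 1 ≤ Δ) (hL : 3 ≤ L) :
    ∃ (C : ℕ → Prop) (pt addr : ℕ → ℕ),
      L * ((Finset.range n).filter (fun v => C v)).card ≤ n * (Δ + 1) ∧
      (∀ x, C x → ∀ y z, ¬ C y → ¬ C z →
        ((y ≠ 0 ∧ par y = x) ∨ (x ≠ 0 ∧ par x = y)) →
        ((z ≠ 0 ∧ par z = x) ∨ (x ≠ 0 ∧ par x = z)) → y = z) ∧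
      (∀ v, ¬ C v → ¬ C (pt v) ∧ pt v ≤ v) ∧
      (∀ v, (v = 0 ∨ C (par v)) → pt v = v ∧ addr v = 0) ∧
      (∀ v, v < n → v ≠ 0 → ¬ C (par v) → pt v = pt (par v) ∧ addr v ≠ 0 ∧ (addr v - 1) / Δ = addr (par v)) ∧
      (∀ v, v < n → ¬ C v → addr v < (Δ + 1) ^ L) ∧
      (∀ v w, v < n → w < n → ¬ C v → ¬ C w → pt v = pt w → addr v = addr w → v = w) := by
  classical
  obtain ⟨ch, hch, hch2⟩ := exists_childIndex hP
  obtain ⟨rl, C, j, h1, h2, h3, h4, h5⟩ := exists_connectors hP hΔ hL ch hch hch2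
  obtain ⟨X, hX0, hX⟩ := exists_rec par hP.lt ((0 : ℕ), (0 : ℕ))
    (fun v p => if C (par v) then (v, 0) else (p.1, Δ * p.2 + 1 + ch v))
  have hCC : ∀ v, v ≠ 0 → ¬ C v → ¬ C (par v) → rl v = rl (par v) + 1 := by
    intro v hv hc hcp
    have a := h3 v hv
    have b := h2 (par v)
    have c : ¬ rl v ≤ 1 := fun h => hc (h4 v h)
    by_cases hh : rl (par v) + 1 = L
    · rw [hh, Nat.mod_self] at a; omega
    · rw [Nat.mod_eq_of_lt (by omega)] at a; exact a
  have hroot : ∀ v, (v = 0 ∨ C (par v)) → (X v).1 = v ∧ (X v).2 = 0 := by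
    intro v hv
    by_cases h0 : v = 0
    · subst h0; simp [hX0]
    · rw [hX v h0]; simp [hv.resolve_left h0]
  have hnon : ∀ v, v < n → v ≠ 0 → ¬ C (par v) → (X v).1 = (X (par v)).1 ∧ (X v).2 ≠ 0 ∧ ((X v).2 - 1) / Δ = (X (par v)).2 := by
    intro v hv h0 hc
    rw [hX v h0]; simp only [hc, if_false]
    refine ⟨trivial, by omega, ?_⟩
    have : Δ * (X (par v)).2 + 1 + ch v - 1 = ch v + Δ * (X (par v)).2 := by omega
    rw [this, Nat.add_mul_div_left _ _ (by omega), Nat.div_eq_of_lt (hch v hv h0)]; simp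
  refine ⟨C, fun v => (X v).1, fun v => (X v).2, h1, ?_, ?_, hroot, hnon, ?_, ?_⟩
  · intro x hx
    -- type of bulk neighbours
    have hA : ∀ y, ¬ C y → y ≠ 0 → par y = x → (rl x ≠ 0 ∧ rl x + 1 < L ∧ ch y = j (rl x + 1)) := by
      intro y hy h0 hp
      have a := h3 y h0
      have c : 2 ≤ rl y := by by_contra h; exact hy (h4 y (by omega))
      have b := (h5 y h0 c).not.mp hy
      rw [hp] at a b
      have b2 : ch y = j (rl y) := by
        by_contra h; exact b ⟨hx, h⟩
      have d := h2 x
      by_cases hh : rl x + 1 = L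
      · rw [hh, Nat.mod_self] at a; omega
      · rw [Nat.mod_eq_of_lt (by omega)] at a
        refine ⟨by omega, by omega, by rw [b2, a]⟩
    have hB : x ≠ 0 → ¬ C (par x) → rl x = 0 := by
      intro h0 hc
      by_contra hne
      have a := h3 x h0
      have b := h2 (par x)
      by_cases hh : rl (par x) + 1 = L
      · rw [hh, Nat.mod_self] at a; omega
      · rw [Nat.mod_eq_of_lt (by omega)] at a
        have c : ¬ rl (par x) ≤ 1 := fun h => hc (h4 _ h)
        exact hc ((h5 x h0 (by omega)).mp hx).1
    intro y z hy hz hy2 hz2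
    rcases hy2 with ⟨a1, a2⟩ | ⟨a1, a2⟩ <;> rcases hz2 with ⟨b1, b2⟩ | ⟨b1, b2⟩
    · apply hch2 y z a1 b1 (by rw [a2, b2])
      rw [(hA y hy a1 a2).2.2, (hA z hz b1 b2).2.2]
    · exact absurd (hB b1 (by rw [b2]; exact hz)) (hA y hy a1 a2).1
    · exact absurd (hB a1 (by rw [a2]; exact hy)) (hA z hz b1 b2).1
    · rw [← a2, ← b2]
  · intro v
    induction v using Nat.strong_induction_on with
    | _ v ih =>
      intro hc
      simp only
      by_cases h : v = 0 ∨ C (par v)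
      · rw [(hroot v h).1]; exact ⟨hc, le_rfl⟩
      · push Not at h
        have hlt := hP.lt v h.1
        obtain ⟨i1, i2⟩ := ih (par v) hlt h.2
        rw [hX v h.1]; simp only [h.2, if_false]
        exact ⟨i1, i2.trans hlt.le⟩
  · have key : ∀ v, v < n → ¬ C v → (X v).2 + 1 ≤ (Δ + 1) ^ (rl v) := by
      intro v
      induction v using Nat.strong_induction_on with
      | _ v ih =>
        intro hv hc
        by_cases h : v = 0 ∨ C (par v)
        · rw [(hroot v h).2]; exact Nat.one_le_pow _ _ (by omega)
        · push Not at h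
          have hlt := hP.lt v h.1
          have i1 := ih (par v) hlt (by omega) h.2
          rw [hCC v h.1 hc h.2, pow_succ]
          rw [hX v h.1]; simp only [h.2, if_false]
          have := hch v hv h.1
          nlinarith
    intro v hv hc
    have := key v hv hc
    have h6 : (Δ + 1) ^ (rl v) ≤ (Δ + 1) ^ L := Nat.pow_le_pow_right (by omega) (h2 v).le
    simp only; omega
  · intro v
    induction v using Nat.strong_induction_on with
    | _ v ih =>
      intro w hv hw hc hd hpt had
      simp only at hpt had
      by_cases h : v = 0 ∨ C (par v) <;> by_cases h' : w = 0 ∨ C (par w)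
      · rw [(hroot v h).1, (hroot w h').1] at hpt; exact hpt
      · push Not at h'
        have := (hnon w hw h'.1 h'.2).2.1
        rw [(hroot v h).2] at had; omega
      · push Not at h
        have := (hnon v hv h.1 h.2).2.1
        rw [(hroot w h').2] at had; omega
      · push Not at h h'
        have a := hnon v hv h.1 h.2
        have b := hnon w hw h'.1 h'.2
        have hp : par v = par w := by
          apply ih (par v) (hP.lt v h.1) (par w) ((hP.lt v h.1).trans hv) ((hP.lt w h'.1).trans hw) h.2 h'.2
          · simp only; rw [← a.1, ← b.1, hpt]
          · simp only; rw [← a.2.2, ← b.2.2, had]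
        apply hch2 v w h.1 h'.1 hp
        rw [hX v h.1, hX w h'.1] at had
        simp only [h.2, h'.2, if_false, hp] at had
        omega

end PartA2

section PartA3

open scoped Classical

theorem exists_subtreeWeight {n : ℕ} {par : ℕ → ℕ} (hp : ∀ v, v ≠ 0 → par v < v) (s : ℕ) :
    ∃ w : ℕ → ℕ, ∀ v, w v = 1 + ∑ u ∈ (Finset.range n).filter (fun u => u ≠ 0 ∧ par u = v),
      (if w u < s then w u else 0) := by
  have key : ∀ k, k ≤ n → ∃ w : ℕ → ℕ, ∀ v, n - k ≤ v → w v = 1 + ∑ u ∈ (Finset.range n).filter (fun u => u ≠ 0 ∧ par u = v),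
      (if w u < s then w u else 0) := by
    intro k
    induction k with
    | zero =>
      intro _
      refine ⟨fun _ => 1, fun v hv => ?_⟩
      have h0 : (Finset.range n).filter (fun u => u ≠ 0 ∧ par u = v) = ∅ := by
       rw [Finset.filter_eq_empty_iff]
       intro u hu hh
       have := hp u hh.1
       have := Finset.mem_range.mp hu
       omega
      rw [h0]; simp
    | succ k ih =>
      intro hk
      obtain ⟨w, hw⟩ := ih (by omega)
      set m := n - (k + 1) with hm
      refine ⟨Function.update w m (1 + ∑ u ∈ (Finset.range n).filter (fun u => u ≠ 0 ∧ par u = m),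
        (if w u < s then w u else 0)), fun v hv => ?_⟩
      have hs : ∑ u ∈ (Finset.range n).filter (fun u => u ≠ 0 ∧ par u = v), 
          (if (Function.update w m (1 + ∑ u ∈ (Finset.range n).filter (fun u => u ≠ 0 ∧ par u = m),
        (if w u < s then w u else 0))) u < s then (Function.update w m (1 + ∑ u ∈ (Finset.range n).filter (fun u => u ≠ 0 ∧ par u = m),
        (if w u < s then w u else 0))) u else 0) = ∑ u ∈ (Finset.range n).filter (fun u => u ≠ 0 ∧ par u = v), (if w u < s then w u else 0) := by
        refine Finset.sum_congr rfl fun u hu => ?_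
        simp only [Finset.mem_filter, Finset.mem_range] at hu
        have := hp u hu.2.1
        rw [Function.update_of_ne (by omega)]
      rw [hs]
      by_cases hvm : v = m
      · subst hvm; rw [Function.update_self]
      · rw [Function.update_of_ne hvm]
        exact hw v (by omega)
  obtain ⟨w, hw⟩ := key n le_rfl
  exact ⟨w, fun v => hw v (by omega)⟩

theorem exists_cuts {n Δ : ℕ} {par : ℕ → ℕ} (hP : ParArr n Δ par) (s : ℕ) (hs : 1 ≤ s) (hn : 0 < n) :
    ∃ (F : Finset ℕ) (comp : ℕ → ℕ), F ⊆ Finset.range n ∧ 0 ∉ F ∧ F.card * s ≤ n ∧ comp 0 = 0 ∧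
      (∀ v ∈ F, comp v = v) ∧ (∀ v, v < n → v ≠ 0 → v ∉ F → comp v = comp (par v)) ∧
      (∀ v, v < n → comp v ∈ insert 0 F) ∧
      ∀ r, ((Finset.range n).filter (fun v => comp v = r)).card ≤ (Δ + 1) * s := by
  obtain ⟨w, hw⟩ := exists_subtreeWeight (n := n) hP.lt s
  let F : Finset ℕ := (Finset.range n).filter (fun v => v ≠ 0 ∧ s ≤ w v)
  obtain ⟨comp, hc0, hc⟩ := exists_rec par hP.lt 0 (fun v p => if v ∈ F then v else p)
  have hF : ∀ v, v ∈ F ↔ v < n ∧ v ≠ 0 ∧ s ≤ w v := by intro v; simp [F]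
  have h0 : 0 ∉ F := by simp [F]
  have hcF : ∀ v ∈ F, comp v = v := by
    intro v hv
    have hv0 : v ≠ 0 := by rintro rfl; exact h0 hv
    rw [hc v hv0, if_pos hv]
  have hcN : ∀ v, v ≠ 0 → v ∉ F → comp v = comp (par v) := by
    intro v hv0 hv; rw [hc v hv0, if_neg hv]
  have hmem : ∀ v, comp v ∈ insert 0 F := by
    intro v
    induction v using Nat.strong_induction_on with
    | _ v ih =>
      by_cases hv0 : v = 0
      · subst hv0; simp [hc0]
      · by_cases hv : v ∈ F
        · rw [hcF v hv]; simp [hv]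
        · rw [hcN v hv0 hv]; exact ih _ (hP.lt v hv0)
  have hfix : ∀ r ∈ insert 0 F, comp r = r := by
    intro r hr
    rcases Finset.mem_insert.mp hr with rfl | h
    · exact hc0
    · exact hcF r h
  have hcard : ∀ r ∈ insert 0 F, ((Finset.range n).filter (fun v => comp v = r)).card = w r := by
    intro r hr
    have hrn : r < n := by
      rcases Finset.mem_insert.mp hr with rfl | h
      · exact hn
      · exact ((hF r).mp h).1
    set K := (Finset.range n).filter (fun v => comp v = r) with hK
    have hrK : r ∈ K := by simp [K, hrn, hfix r hr]
    have h1 : ∑ v ∈ K, w v = K.card + ∑ v ∈ K.erase r, w v := by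
      calc ∑ v ∈ K, w v = ∑ v ∈ K, (1 + ∑ u ∈ (Finset.range n).filter (fun u => u ≠ 0 ∧ par u = v),
              (if w u < s then w u else 0)) := Finset.sum_congr rfl fun v _ => hw v
        _ = K.card + ∑ v ∈ K, ∑ u ∈ (Finset.range n).filter (fun u => u ≠ 0 ∧ par u = v),
              (if w u < s then w u else 0) := by rw [Finset.sum_add_distrib]; simp
        _ = K.card + ∑ v ∈ K.erase r, w v := by
            congr 1
            rw [← Finset.sum_biUnion]
            · rw [← Finset.sum_filter]
              apply Finset.sum_congr _ (fun _ _ => rfl)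
              ext u
              simp only [Finset.mem_filter, Finset.mem_biUnion, Finset.mem_erase, K, Finset.mem_range]
              constructor
              · rintro ⟨⟨v, ⟨hv, hvr⟩, hu, hu0, hpu⟩, hlt⟩
                have huF : u ∉ F := by rw [hF]; push Not; intro _ _; exact hlt
                refine ⟨?_, hu, ?_⟩
                · rintro rfl
                  rcases Finset.mem_insert.mp hr with h | h
                  · exact hu0 h
                  · exact huF h
                · rw [hcN u hu0 huF, hpu, hvr]
              · rintro ⟨hur, hu, hcu⟩
                have huF : u ∉ F := fun h => hur (by rw [← hcF u h, hcu])
                have hu0 : u ≠ 0 := by rintro rfl; exact hur (by rw [← hc0, hcu])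
                have hlt := hP.lt u hu0
                refine ⟨⟨par u, ⟨by omega, by rw [← hcN u hu0 huF, hcu]⟩, hu, hu0, rfl⟩, ?_⟩
                by_contra h
                exact huF ((hF u).mpr ⟨hu, hu0, by omega⟩)
            · intro a _ b _ hab
              rw [Function.onFun, Finset.disjoint_left]
              intro u hu hu'
              simp only [Finset.mem_filter] at hu hu'
              exact hab (hu.2.2.symm.trans hu'.2.2)
    have h2 := Finset.add_sum_erase K w hrK
    omega
  have hwle : ∀ r, w r ≤ (Δ + 1) * s := by
    intro r
    rw [hw r]
    have : ∑ u ∈ (Finset.range n).filter (fun u => u ≠ 0 ∧ par u = r), (if w u < s then w u else 0) ≤ Δ * s := by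
      calc _ ≤ ∑ u ∈ (Finset.range n).filter (fun u => u ≠ 0 ∧ par u = r), s := by
            refine Finset.sum_le_sum fun u _ => ?_
            split_ifs <;> omega
        _ ≤ Δ * s := by
            rw [Finset.sum_const, smul_eq_mul]
            exact Nat.mul_le_mul_right _ (hP.ch r)
    nlinarith
  refine ⟨F, comp, Finset.filter_subset _ _, h0, ?_, hc0, hcF, fun v _ => hcN v, fun v _ => hmem v, ?_⟩
  · calc F.card * s = ∑ r ∈ F, s := by simp
      _ ≤ ∑ r ∈ F, ((Finset.range n).filter (fun v => comp v = r)).card := by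
          refine Finset.sum_le_sum fun r hr => ?_
          rw [hcard r (Finset.mem_insert_of_mem hr)]
          exact ((hF r).mp hr).2.2
      _ = (F.biUnion (fun r => (Finset.range n).filter (fun v => comp v = r))).card := by
          rw [Finset.card_biUnion]
          intro a _ b _ hab
          rw [Function.onFun, Finset.disjoint_left]
          intro u hu hu'
          simp only [Finset.mem_filter] at hu hu'
          exact hab (hu.2.symm.trans hu'.2)
      _ ≤ n := by
          refine (Finset.card_le_card (Finset.biUnion_subset.mpr fun r _ => Finset.filter_subset _ _)).trans ?_
          simp
  · intro r
    by_cases hr : r ∈ insert 0 F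
    · rw [hcard r hr]; exact hwle r
    · rw [Finset.card_eq_zero.mpr]
      · exact Nat.zero_le _
      · rw [Finset.filter_eq_empty_iff]
        rintro v _ rfl
        exact hr (hmem v)

end PartA3

section PartC1

open scoped Classical

theorem exists_shrink {V Z : Type*} {n Δ : ℕ} {par : ℕ → ℕ} (hP : ParArr n Δ par)
    (C : Finset ℕ) (hC : C ⊆ Finset.range n) (A : ℕ → Finset V) (zn : ℕ → Z) (need : Z → ℕ)
    (R : V → V → Prop)
    (hext : ∀ x ∈ C, x ≠ 0 → par x ∈ C → ∀ B ⊆ A x, (A x).card ≤ 2 * B.card →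
      2 * Δ * ((A (par x)).filter (fun v => (B.filter (fun u => R v u)).card < need (zn x))).card
        ≤ (A (par x)).card) :
    ∃ A' : ℕ → Finset V, ∀ x ∈ C, A' x ⊆ A x ∧ (A x).card ≤ 2 * (A' x).card ∧
      ∀ y ∈ C, y ≠ 0 → par y = x → ∀ v ∈ A' x, need (zn y) ≤ ((A' y).filter (fun u => R v u)).card := by
  have key : ∀ k, k ≤ n → ∃ A' : ℕ → Finset V, ∀ x ∈ C, n - k ≤ x → A' x ⊆ A x ∧ (A x).card ≤ 2 * (A' x).card ∧
      ∀ y ∈ C, y ≠ 0 → par y = x → ∀ v ∈ A' x, need (zn y) ≤ ((A' y).filter (fun u => R v u)).card := by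
    intro k
    induction k with
    | zero =>
      intro _
      refine ⟨A, fun x hx hxn => ?_⟩
      have := Finset.mem_range.mp (hC hx)
      omega
    | succ k ih =>
      intro hk
      obtain ⟨A', hA'⟩ := ih (by omega)
      set m := n - (k + 1) with hm
      let ch := C.filter (fun y => y ≠ 0 ∧ par y = m)
      let bad : ℕ → Finset V := fun y => (A m).filter (fun v => ((A' y).filter (fun u => R v u)).card < need (zn y))
      let N := (A m) \ ch.biUnion bad
      have hchlt : ∀ y, y ≠ 0 → ∀ x, m ≤ x → par y = x → m < y := by
        intro y hy0 x hx hp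
        have := hP.lt y hy0
        omega
      refine ⟨Function.update A' m N, fun x hx hxm => ?_⟩
      by_cases hxe : x = m
      · subst hxe
        rw [Function.update_self]
        refine ⟨Finset.sdiff_subset, ?_, ?_⟩
        · have hchc : ch.card ≤ Δ := by
            refine (Finset.card_le_card ?_).trans (hP.ch m)
            intro y hy
            simp only [ch, Finset.mem_filter] at hy ⊢
            exact ⟨hC hy.1, hy.2⟩
          have hbad : ∀ y ∈ ch, 2 * Δ * (bad y).card ≤ (A m).card := by
            intro y hy
            simp only [ch, Finset.mem_filter] at hy
            obtain ⟨hyC, hy0, hyp⟩ := hy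
            have h1 := hchlt y hy0 m le_rfl hyp
            obtain ⟨a1, a2, _⟩ := hA' y hyC (by omega)
            have := hext y hyC hy0 (by rw [hyp]; exact hx) (A' y) a1 a2
            rw [hyp] at this
            exact this
          have h1 : 2 * (ch.biUnion bad).card ≤ (A m).card := by
            by_cases hD : Δ = 0
            · have : ch = ∅ := Finset.card_eq_zero.mp (by omega)
              rw [this]; simp
            · have h2 : Δ * (2 * (ch.biUnion bad).card) ≤ Δ * (A m).card := by
                calc Δ * (2 * (ch.biUnion bad).card) ≤ Δ * (2 * ∑ y ∈ ch, (bad y).card) := by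
                      gcongr; exact Finset.card_biUnion_le
                  _ = ∑ y ∈ ch, 2 * Δ * (bad y).card := by rw [← Finset.mul_sum]; ring
                  _ ≤ ∑ y ∈ ch, (A m).card := Finset.sum_le_sum hbad
                  _ = ch.card * (A m).card := by simp
                  _ ≤ _ := Nat.mul_le_mul_right _ hchc
              exact Nat.le_of_mul_le_mul_left h2 (by omega)
          have h3 := Finset.le_card_sdiff (ch.biUnion bad) (A m)
          simp only [N]
          omega
        · intro y hyC hy0 hyp v hv
          have h1 := hchlt y hy0 m le_rfl hyp
          rw [Function.update_of_ne (by omega)]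
          simp only [N, Finset.mem_sdiff, Finset.mem_biUnion, not_exists, not_and] at hv
          have := hv.2 y (by simp [ch, hyC, hy0, hyp])
          simp only [bad, Finset.mem_filter, not_and, not_lt] at this
          exact this hv.1
      · rw [Function.update_of_ne hxe]
        obtain ⟨a1, a2, a3⟩ := hA' x hx (by omega)
        refine ⟨a1, a2, fun y hyC hy0 hyp v hv => ?_⟩
        have h1 := hchlt y hy0 x hxm hyp
        rw [Function.update_of_ne (by omega)]
        exact a3 y hyC hy0 hyp v hv
  obtain ⟨A', h⟩ := key n le_rfl
  exact ⟨A', fun x hx => h x hx (by omega)⟩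

/-- Extension lemma: embed the forest induced on `C`, with candidate sets `A x`. -/
theorem exists_extension {V Z : Type*} [Nonempty V] {n Δ : ℕ} {par : ℕ → ℕ} (hP : ParArr n Δ par)
    (C : Finset ℕ) (hC : C ⊆ Finset.range n) (A : ℕ → Finset V) (zn : ℕ → Z) (need : Z → ℕ)
    (R : V → V → Prop)
    (hdisj : ∀ x ∈ C, ∀ y ∈ C, zn x ≠ zn y → Disjoint (A x) (A y))
    (hneed : ∀ z, (C.filter (fun x => zn x = z)).card ≤ need z)
    (hbig : ∀ x ∈ C, 2 * need (zn x) ≤ (A x).card)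
    (hext : ∀ x ∈ C, x ≠ 0 → par x ∈ C → ∀ B ⊆ A x, (A x).card ≤ 2 * B.card →
      2 * Δ * ((A (par x)).filter (fun v => (B.filter (fun u => R v u)).card < need (zn x))).card
        ≤ (A (par x)).card) :
    ∃ ψ : ℕ → V, Set.InjOn ψ (C : Set ℕ) ∧ (∀ x ∈ C, ψ x ∈ A x) ∧
      ∀ x ∈ C, x ≠ 0 → par x ∈ C → R (ψ (par x)) (ψ x) := by
  obtain ⟨A', hA'⟩ := exists_shrink hP C hC A zn need R hext
  have hV : Nonempty V := inferInstance
  have key : ∀ k, ∃ ψ : ℕ → V, (∀ x ∈ C, ∀ y ∈ C, x < k → y < k → ψ x = ψ y → x = y) ∧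
      (∀ x ∈ C, x < k → ψ x ∈ A' x) ∧
      ∀ x ∈ C, x < k → x ≠ 0 → par x ∈ C → R (ψ (par x)) (ψ x) := by
    intro k
    induction k with
    | zero => exact ⟨fun _ => Classical.choice hV, by simp⟩
    | succ k ih =>
      obtain ⟨ψ, i1, i2, i3⟩ := ih
      by_cases hk : k ∈ C
      · obtain ⟨a1, a2, a3⟩ := hA' k hk
        -- available set
        have hS : ∃ S : Finset V, S ⊆ A' k ∧ need (zn k) ≤ S.card ∧
            (k ≠ 0 → par k ∈ C → ∀ u ∈ S, R (ψ (par k)) u) := by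
          by_cases hp : k ≠ 0 ∧ par k ∈ C
          · refine ⟨(A' k).filter (fun u => R (ψ (par k)) u), Finset.filter_subset _ _, ?_, ?_⟩
            · exact (hA' (par k) hp.2).2.2 k hk hp.1 rfl _ (i2 _ hp.2 (hP.lt k hp.1))
            · intro _ _ u hu; exact (Finset.mem_filter.mp hu).2
          · refine ⟨A' k, subset_rfl, ?_, fun h1 h2 => absurd ⟨h1, h2⟩ hp⟩
            have := hbig k hk
            omega
        obtain ⟨S, s1, s2, s3⟩ := hS
        let U := ((C.filter (fun x => zn x = zn k)).erase k).image ψ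
        have hU : U.card < S.card := by
          have h1 : U.card ≤ ((C.filter (fun x => zn x = zn k)).erase k).card := Finset.card_image_le
          have h2 : k ∈ C.filter (fun x => zn x = zn k) := by simp [hk]
          have h3 := Finset.card_erase_of_mem h2
          have h4 := Finset.card_pos.mpr ⟨k, h2⟩
          have h5 := hneed (zn k)
          omega
        obtain ⟨u, hu, huU⟩ := Finset.exists_mem_notMem_of_card_lt_card hU
        have hfresh : ∀ x ∈ C, x < k → ψ x ≠ u := by
          intro x hx hxk he
          by_cases hz : zn x = zn k
          · apply huU
            simp only [U, Finset.mem_image, Finset.mem_erase, Finset.mem_filter]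
            exact ⟨x, ⟨by omega, hx, hz⟩, he⟩
          · have := Finset.disjoint_left.mp (hdisj x hx k hk hz) ((hA' x hx).1 (i2 x hx hxk))
            rw [he] at this
            exact this (a1 (s1 hu))
        refine ⟨Function.update ψ k u, ?_, ?_, ?_⟩
        · intro x hx y hy hxk hyk hxy
          by_cases hx' : x = k <;> by_cases hy' : y = k
          · omega
          · subst hx'
            rw [Function.update_self, Function.update_of_ne hy'] at hxy
            exact absurd hxy.symm (hfresh y hy (by omega))
          · subst hy'
            rw [Function.update_self, Function.update_of_ne hx'] at hxy
            exact absurd hxy (hfresh x hx (by omega))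
          · rw [Function.update_of_ne hx', Function.update_of_ne hy'] at hxy
            exact i1 x hx y hy (by omega) (by omega) hxy
        · intro x hx hxk
          by_cases hx' : x = k
          · subst hx'; rw [Function.update_self]; exact s1 hu
          · rw [Function.update_of_ne hx']; exact i2 x hx (by omega)
        · intro x hx hxk hx0 hpx
          have := hP.lt x hx0
          rw [Function.update_of_ne (show par x ≠ k by omega)]
          by_cases hx' : x = k
          · subst hx'; rw [Function.update_self]; exact s3 hx0 hpx u hu
          · rw [Function.update_of_ne hx']; exact i3 x hx (by omega) hx0 hpx
      · have hne : ∀ x ∈ C, x < k + 1 → x < k := by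
          intro x hx h
          have : x ≠ k := by rintro rfl; exact hk hx
          omega
        exact ⟨ψ, fun x hx y hy h1 h2 => i1 x hx y hy (hne x hx h1) (hne y hy h2),
          fun x hx h => i2 x hx (hne x hx h), fun x hx h => i3 x hx (hne x hx h)⟩
  obtain ⟨ψ, i1, i2, i3⟩ := key n
  have hlt : ∀ x ∈ C, x < n := fun x hx => Finset.mem_range.mp (hC hx)
  exact ⟨ψ, fun x hx y hy h => i1 x hx y hy (hlt x hx) (hlt y hy) h,
    fun x hx => (hA' x hx).1 (i2 x hx (hlt x hx)), fun x hx => i3 x hx (hlt x hx)⟩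

end PartC1

section PartB1

open scoped Classical

theorem exists_perm_support {ι : Type*} [Fintype ι] (D : ℕ) (M : ι → ι → ℕ)
    (hr : ∀ i, ∑ j, M i j = D + 1) (hc : ∀ j, ∑ i, M i j = D + 1) :
    ∃ σ : Equiv.Perm ι, ∀ i, 0 < M i (σ i) := by
  let t : ι → Finset ι := fun i => Finset.univ.filter (fun j => 0 < M i j)
  have hall : ∀ s : Finset ι, s.card ≤ (s.biUnion t).card := by
    intro s
    have h1 : (D + 1) * s.card ≤ (D + 1) * (s.biUnion t).card := by
      calc (D + 1) * s.card = ∑ i ∈ s, ∑ j, M i j := by simp [hr, mul_comm]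
        _ = ∑ i ∈ s, ∑ j ∈ s.biUnion t, M i j := by
            refine Finset.sum_congr rfl fun i hi => ?_
            symm
            apply Finset.sum_subset (Finset.subset_univ _)
            intro j _ hj
            by_contra h
            exact hj (Finset.mem_biUnion.mpr ⟨i, hi, by simp [t]; omega⟩)
        _ = ∑ j ∈ s.biUnion t, ∑ i ∈ s, M i j := Finset.sum_comm
        _ ≤ ∑ j ∈ s.biUnion t, ∑ i, M i j :=
            Finset.sum_le_sum fun j _ => Finset.sum_le_sum_of_subset (Finset.subset_univ _)
        _ = _ := by simp [hc, mul_comm]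
    exact Nat.le_of_mul_le_mul_left h1 (by omega)
  obtain ⟨f, hf, hf2⟩ := (Finset.all_card_le_biUnion_card_iff_exists_injective t).mp hall
  refine ⟨Equiv.ofBijective f (Finite.injective_iff_bijective.mp hf), fun i => ?_⟩
  have := hf2 i
  simpa [t] using this

theorem exists_perm_decomp {ι : Type*} [Fintype ι] (D : ℕ) : ∀ (M : ι → ι → ℕ)
    (_ : ∀ i, ∑ j, M i j = D) (_ : ∀ j, ∑ i, M i j = D),
    ∃ σ : Fin D → Equiv.Perm ι, ∀ i j, (Finset.univ.filter (fun k => σ k i = j)).card = M i j := by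
  induction D with
  | zero =>
    intro M hr hc
    refine ⟨fun k => k.elim0, fun i j => ?_⟩
    have := (Finset.sum_eq_zero_iff.mp (hr i)) j (Finset.mem_univ _)
    simp [this]
  | succ D ih =>
    intro M hr hc
    obtain ⟨σ, hσ⟩ := exists_perm_support D M hr hc
    have hone : ∀ i j, (if σ i = j then 1 else 0) ≤ M i j := by
      intro i j
      split_ifs with h
      · rw [← h]; exact hσ i
      · exact Nat.zero_le _
    obtain ⟨τ, hτ⟩ : ∃ τ : Fin D → Equiv.Perm ι, ∀ i j,
        (Finset.univ.filter (fun k => τ k i = j)).card = M i j - if σ i = j then 1 else 0 := by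
      refine ih (fun i j => M i j - if σ i = j then 1 else 0) ?_ ?_
      · intro i
        have h1 : ∑ j, ((M i j - if σ i = j then 1 else 0) + if σ i = j then 1 else 0) = D + 1 := by
          rw [← hr i]
          exact Finset.sum_congr rfl fun j _ => Nat.sub_add_cancel (hone i j)
        rw [Finset.sum_add_distrib] at h1
        simpa using h1
      · intro j
        have h1 : ∑ i, ((M i j - if σ i = j then 1 else 0) + if σ i = j then 1 else 0) = D + 1 := by
          rw [← hc j]
          exact Finset.sum_congr rfl fun i _ => Nat.sub_add_cancel (hone i j)
        rw [Finset.sum_add_distrib] at h1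
        have h2 : ∑ i, (if σ i = j then 1 else 0) = 1 := by
          simp_rw [show ∀ i, (σ i = j) = (i = σ.symm j) from fun i => by
            rw [Equiv.eq_symm_apply]]
          simp
        omega
    · refine ⟨Fin.cons σ τ, fun i j => ?_⟩
      have h1 := hτ i j
      have h2 := hone i j
      rw [Finset.card_filter, Fin.sum_univ_succ]
      simp only [Fin.cons_zero, Fin.cons_succ]
      rw [Finset.card_filter] at h1
      rw [h1]; omega

theorem exists_koenig {a D : ℕ} (E : Fin a → Fin a → Prop)
    (hr : ∀ x, (Finset.univ.filter (fun y => E x y)).card ≤ D)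
    (hc : ∀ y, (Finset.univ.filter (fun x => E x y)).card ≤ D) :
    ∃ σ : Fin D → Equiv.Perm (Fin a ⊕ Fin a), ∀ x y,
      (Finset.univ.filter (fun k => σ k (Sum.inl x) = Sum.inl y)).card = if E x y then 1 else 0 := by
  let M : Fin a ⊕ Fin a → Fin a ⊕ Fin a → ℕ := fun i j => match i, j with
    | .inl x, .inl y => if E x y then 1 else 0
    | .inl x, .inr y => if x = y then D - (Finset.univ.filter (fun z => E x z)).card else 0
    | .inr x, .inl y => if x = y then D - (Finset.univ.filter (fun z => E z y)).card else 0
    | .inr x, .inr y => if E y x then 1 else 0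
  have hM : (∀ i, ∑ j, M i j = D) ∧ (∀ j, ∑ i, M i j = D) := by
   refine ⟨?_, ?_⟩
   · rintro (x | x)
     · have := hr x
       rw [Fintype.sum_sum_type]
       simp only [M, Finset.sum_ite_eq, Finset.mem_univ, if_true]
       rw [← Finset.card_filter]; omega
     · have := hc x
       rw [Fintype.sum_sum_type]
       simp only [M, Finset.sum_ite_eq, Finset.mem_univ, if_true]
       rw [← Finset.card_filter]; omega
   · rintro (x | x)
     · have := hc x
       rw [Fintype.sum_sum_type]
       simp only [M, Finset.sum_ite_eq', Finset.mem_univ, if_true]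
       rw [← Finset.card_filter]; omega
     · have := hr x
       rw [Fintype.sum_sum_type]
       simp only [M, Finset.sum_ite_eq', Finset.mem_univ, if_true]
       rw [← Finset.card_filter]; omega
  obtain ⟨σ, hσ⟩ := exists_perm_decomp D M hM.1 hM.2
  refine ⟨σ, fun x y => ?_⟩
  have := hσ (.inl x) (.inl y)
  simp only [M] at this
  convert this

theorem exists_matchings {a D R fa : ℕ} (E : Fin a → Fin a → Prop)
    (hr : ∀ x, (Finset.univ.filter (fun y => E x y)).card ≤ D)
    (hc : ∀ y, (Finset.univ.filter (fun x => E x y)).card ≤ D)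
    (hRD : R ≤ D) (hcount : D * a < (Finset.univ.filter (fun p : Fin a × Fin a => E p.1 p.2)).card
      + (D - R + 1) * (fa + 1)) :
    ∃ (π : Fin R → Equiv.Perm (Fin a)) (real : Fin R → Fin a → Prop),
      (∀ k x, real k x → E x (π k x)) ∧
      (∀ k k' x, real k x → real k' x → π k x = π k' x → k = k') ∧
      ∀ k, (Finset.univ.filter (fun x => ¬ real k x)).card ≤ fa := by
  obtain ⟨σ, hσ⟩ := exists_koenig E hr hc
  let real0 : Fin D → Fin a → Prop := fun k x => ∃ y, σ k (Sum.inl x) = Sum.inl y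
  have hpi : ∀ k, ∃ π : Equiv.Perm (Fin a), ∀ x, real0 k x → σ k (Sum.inl x) = Sum.inl (π x) := by
    intro k
    choose! f hf using fun x (h : real0 k x) => h
    let q : Fin a → Prop := fun y => ∃ x, real0 k x ∧ f x = y
    let g : {x // real0 k x} → {y // q y} := fun x => ⟨f x, x, x.2, rfl⟩
    have hg : Function.Bijective g := by
      constructor
      · intro x y hxy
        have h1 : f x = f y := congrArg Subtype.val hxy
        have h2 : σ k (Sum.inl x.1) = σ k (Sum.inl y.1) := by rw [hf x x.2, hf y y.2, h1]
        exact Subtype.ext (Sum.inl_injective ((σ k).injective h2))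
      · rintro ⟨y, x, hx, rfl⟩
        exact ⟨⟨x, hx⟩, rfl⟩
    refine ⟨(Equiv.ofBijective g hg).extendSubtype, fun x hx => ?_⟩
    rw [Equiv.extendSubtype_apply_of_mem _ _ hx, hf x hx]
    rfl
  choose π hπ using hpi
  let good : Finset (Fin D) := Finset.univ.filter
    (fun k => (Finset.univ.filter (fun x => ¬ real0 k x)).card ≤ fa)
  have hE : ∀ k x, real0 k x → E x (π k x) := by
    intro k x hx
    by_contra h
    have h1 := hσ x (π k x)
    rw [if_neg h, Finset.card_eq_zero, Finset.filter_eq_empty_iff] at h1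
    exact h1 (Finset.mem_univ k) (hπ k x hx)
  have huniq : ∀ k k' x, real0 k x → real0 k' x → π k x = π k' x → k = k' := by
    intro k k' x h1 h2 h3
    have h4 := hσ x (π k x)
    rw [if_pos (hE k x h1)] at h4
    obtain ⟨c, hc⟩ := Finset.card_eq_one.mp h4
    have a1 : k ∈ ({c} : Finset (Fin D)) := by rw [← hc]; simp [hπ k x h1]
    have a2 : k' ∈ ({c} : Finset (Fin D)) := by rw [← hc]; simp [hπ k' x h2, h3]
    rw [Finset.mem_singleton] at a1 a2
    rw [a1, a2]
  have hcardE : (Finset.univ.filter (fun p : Fin a × Fin a => E p.1 p.2)).card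
      ≤ ∑ k, (Finset.univ.filter (fun x => real0 k x)).card := by
    have h1 : (Finset.univ.filter (fun p : Fin a × Fin a => E p.1 p.2)).card = 
        ∑ x : Fin a, ∑ y : Fin a, ∑ k, if σ k (Sum.inl x) = Sum.inl y then 1 else 0 := by
      rw [Finset.card_filter, Fintype.sum_prod_type]
      refine Finset.sum_congr rfl fun x _ => Finset.sum_congr rfl fun y _ => ?_
      rw [← Finset.card_filter, hσ]
    rw [h1]
    have h2 : ∀ k, (Finset.univ.filter (fun x => real0 k x)).card = ∑ x, if real0 k x then 1 else 0 := 
      fun k => Finset.card_filter _ _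
    simp_rw [h2]
    rw [Finset.sum_comm (s := (Finset.univ : Finset (Fin D)))]
    refine Finset.sum_le_sum fun x _ => ?_
    rw [Finset.sum_comm]
    refine Finset.sum_le_sum fun k _ => ?_
    rw [← Finset.card_filter]
    split_ifs with h
    · rw [Finset.card_le_one]
      intro y hy z hz
      simp at hy hz
      rw [hy] at hz
      exact Sum.inl_injective hz
    · rw [Nat.le_zero, Finset.card_eq_zero, Finset.filter_eq_empty_iff]
      intro y _ hy
      exact h ⟨y, hy⟩
  have hgood : R ≤ good.card := by
    by_contra hlt
    have h0 : good.card + (goodᶜ).card = D := by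
      rw [Finset.card_add_card_compl]; simp
    have h1 : ∑ k, ((Finset.univ.filter (fun x => real0 k x)).card + if k ∈ good then 0 else (fa + 1)) ≤ ∑ k : Fin D, a := by
      refine Finset.sum_le_sum fun k _ => ?_
      have h2 := Finset.card_filter_add_card_filter_not (s := (Finset.univ : Finset (Fin a))) (fun x => real0 k x)
      simp only [Finset.card_univ, Fintype.card_fin] at h2
      split_ifs with h
      · omega
      · simp only [good, Finset.mem_filter, Finset.mem_univ, true_and, not_le] at h
        omega
    rw [Finset.sum_add_distrib] at h1
    have h3 : ∑ k, (if k ∈ good then 0 else (fa + 1)) = (goodᶜ).card * (fa + 1) := by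
      rw [Finset.sum_ite]; simp [Finset.filter_not, Finset.compl_eq_univ_sdiff]
    rw [h3] at h1
    simp only [Finset.sum_const, Finset.card_univ, Fintype.card_fin, smul_eq_mul] at h1
    have h4 : (D - R + 1) * (fa + 1) ≤ (goodᶜ).card * (fa + 1) := Nat.mul_le_mul_right _ (by omega)
    omega
  obtain ⟨t, ht, htc⟩ := Finset.exists_subset_card_eq hgood
  let e := t.equivFinOfCardEq htc
  refine ⟨fun k => π (e.symm k), fun k => real0 (e.symm k), fun k x => hE _ x, ?_, ?_⟩
  · intro k k' x h1 h2 h3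
    have := huniq _ _ x h1 h2 h3
    exact e.symm.injective (Subtype.ext this)
  · intro k
    have := ht (e.symm k).2
    simp only [good, Finset.mem_filter, Finset.mem_univ, true_and] at this
    simpa using this

end PartB1

section PartC2a

open scoped Classical

theorem exists_rank {D E : Type*} (s : Finset D) (key : D → E) :
    ∃ k : D → ℕ, (∀ d ∈ s, k d < (s.filter (fun d' => key d' = key d)).card) ∧
      ∀ d ∈ s, ∀ d' ∈ s, key d = key d' → k d = k d' → d = d' := by
  have h : ∀ e : E, ∃ f : D → ℕ, (∀ d ∈ s.filter (fun d' => key d' = e), f d < (s.filter (fun d' => key d' = e)).card) ∧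
      Set.InjOn f (s.filter (fun d' => key d' = e) : Finset D) := by
    intro e
    set t := s.filter (fun d' => key d' = e)
    refine ⟨fun d => if h : d ∈ t then (t.equivFin ⟨d, h⟩).val else 0, ?_, ?_⟩
    · intro d hd
      simp only [hd, dif_pos]
      exact (t.equivFin ⟨d, hd⟩).isLt
    · intro d hd d' hd' hh
      have hd2 : d ∈ t := hd
      have hd3 : d' ∈ t := hd'
      simp only [hd2, hd3, dif_pos] at hh
      have := t.equivFin.injective (Fin.ext hh)
      simpa using this
  choose f hf1 hf2 using h
  refine ⟨fun d => f (key d) d, ?_, ?_⟩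
  · intro d hd
    exact hf1 (key d) d (by simp [hd])
  · intro d hd d' hd' hk hh
    simp only at hh
    rw [← hk] at hh
    exact hf2 (key d) (by simp [hd]) (by simp [hd', hk]) hh

theorem card_shift1 {K Q : Type*} [Fintype K] [Fintype Q] (c : K) (u : Q) :
    (Finset.univ.filter (fun s : K → Q => s c = u)).card = Fintype.card Q ^ (Fintype.card K - 1) := by
  have : (Finset.univ.filter (fun s : K → Q => s c = u)) =
      Fintype.piFinset (fun k => if k = c then {u} else (Finset.univ : Finset Q)) := by
    ext s
    simp only [Finset.mem_filter, Finset.mem_univ, true_and, Fintype.mem_piFinset]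
    constructor
    · intro h k
      split_ifs with hk
      · subst hk; simpa using h
      · simp
    · intro h
      simpa using h c
  rw [this, Fintype.card_piFinset, ← Finset.mul_prod_erase _ _ (Finset.mem_univ c)]
  simp only [if_true, Finset.card_singleton, one_mul]
  rw [Finset.prod_congr rfl (g := fun _ => Fintype.card Q)]
  · simp
  · intro k hk
    rw [if_neg (Finset.ne_of_mem_erase hk)]; rfl

theorem card_shift2 {K Q : Type*} [Fintype K] [Fintype Q] (c c' : K) (hc : c ≠ c') (u w : Q) :
    (Finset.univ.filter (fun s : K → Q => s c = u ∧ s c' = w)).card = Fintype.card Q ^ (Fintype.card K - 2) := by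
  have : (Finset.univ.filter (fun s : K → Q => s c = u ∧ s c' = w)) =
      Fintype.piFinset (fun k => if k = c then {u} else if k = c' then {w} else (Finset.univ : Finset Q)) := by
    ext s
    simp only [Finset.mem_filter, Finset.mem_univ, true_and, Fintype.mem_piFinset]
    constructor
    · intro h k
      split_ifs with hk hk'
      · subst hk; simpa using h.1
      · subst hk'; simpa using h.2
      · simp
    · intro h
      exact ⟨by simpa using h c, by simpa [hc.symm] using h c'⟩
  rw [this, Fintype.card_piFinset, ← Finset.mul_prod_erase _ _ (Finset.mem_univ c),
    ← Finset.mul_prod_erase _ _ (show c' ∈ Finset.univ.erase c by simp [hc.symm])]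
  simp only [if_true, Finset.card_singleton, one_mul, hc.symm, if_false]
  rw [Finset.prod_congr rfl (g := fun _ => Fintype.card Q)]
  · rw [Finset.prod_const, Finset.card_erase_of_mem (by simp [hc.symm]), Finset.card_erase_of_mem (by simp)]
    rfl
  · intro k hk
    rw [if_neg (by simp at hk; exact hk.2), if_neg (Finset.ne_of_mem_erase hk)]; rfl

/-- the host structure -/
structure Host {V : Type} [Fintype V] (G : SimpleGraph V) (K Q S : Type) [Fintype Q] [Fintype S]
    (R : K → K → ℕ) (fa κ t β g g' : ℕ) where
  ed : K → K → Prop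
  mn : K → Q → S → V
  zone : K → Bool → Finset V
  col : K → K → Q → Q → ℕ → Equiv.Perm S
  real : K → K → Q → Q → ℕ → S → Prop
  ed_symm : ∀ c c', ed c c' → ed c' c
  ed_ne : ∀ c c', ed c c' → c ≠ c'
  R_symm : ∀ c c', R c c' = R c' c
  mn_inj : ∀ c x z c' x' z', mn c x z = mn c' x' z' → c = c' ∧ x = x' ∧ z = z'
  zone_disj : ∀ c b c' b', (c, b) ≠ (c', b') → Disjoint (zone c b) (zone c' b')
  mn_zone : ∀ c x z c' b, mn c x z ∉ zone c' b
  zone_card : ∀ c b, κ ≤ (zone c b).card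
  col_symm : ∀ c c', ed c c' → ∀ x y k z, col c' c y x k (col c c' x y k z) = z
  real_symm : ∀ c c', ed c c' → ∀ x y k z, real c c' x y k z → real c' c y x k (col c c' x y k z)
  real_adj : ∀ c c', ed c c' → ∀ x y k z, k < R c c' → real c c' x y k z →
    G.Adj (mn c x z) (mn c' y (col c c' x y k z))
  real_uniq : ∀ c c', ed c c' → ∀ x y k k' z, k < R c c' → k' < R c c' → real c c' x y k z →
    real c c' x y k' z → col c c' x y k z = col c c' x y k' z → k = k'
  real_card : ∀ c c', ed c c' → ∀ x y k, k < R c c' →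
    (Finset.univ.filter (fun z => ¬ real c c' x y k z)).card ≤ fa
  typ : ∀ c c', ed c c' → ∀ b, (Finset.univ.filter (fun p : Q × S =>
    ((zone c' b).filter (fun u => G.Adj (mn c p.1 p.2) u)).card < κ)).card ≤ t
  h2 : ∀ c c', ed c c' → ∀ b b', ∀ B ⊆ zone c' b', β ≤ B.card →
    ((zone c b).filter (fun v => (B.filter (fun u => G.Adj v u)).card < g)).card ≤ t
  h4 : ∀ c, ∀ B ⊆ zone c true, β ≤ B.card →
    (Finset.univ.filter (fun v => (B.filter (fun u => G.Adj v u)).card < g')).card ≤ t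

/-- the cluster of a tree vertex with pair `p` and side `b`. -/
def clOf {K : Type} (σ : K → K) (p : K) (b : Bool) : K := if b then p else σ p

/-- a plan for distributing the tree along `σ`. -/
structure Plan (n : ℕ) (par : ℕ → ℕ) {K : Type} (ed : K → K → Prop) (σ : K → K) (Q S : Type)
    (B capA capF capC capJ : ℕ) where
  P : ℕ → Prop
  J : ℕ → Prop
  pr : ℕ → K
  sd : ℕ → Bool
  pos : ℕ → Q
  zr : ℕ → S
  pid : ℕ → ℕ
  pa : K × Q → K × Q
  inj : Function.Injective σ
  good : ∀ v, v < n → ed (pr v) (σ (pr v))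
  edge : ∀ v, v < n → v ≠ 0 → (pr v = pr (par v) ∧ sd v ≠ sd (par v)) ∨ (J v ∧ J (par v))
  JP : ∀ v, J v → ¬ P v
  piece : ∀ v, v < n → v ≠ 0 → P v → P (par v) → pid v = pid (par v) ∧ zr v = zr (par v)
  pid_pr : ∀ v w, v < n → w < n → P v → P w → pid v = pid w → pr v = pr w
  pid_card : ∀ p, ((Finset.range n).filter (fun v => P v ∧ pid v = p)).card ≤ B
  slot : ∀ v w, v < n → w < n → P v → P w → clOf σ (pr v) (sd v) = clOf σ (pr w) (sd w) →
    pos v = pos w → zr v = zr w → v = w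
  homog : ∀ v w, v < n → w < n → P v → P w → clOf σ (pr v) (sd v) = clOf σ (pr w) (sd w) →
    pos v = pos w → (pr v = pr w ∧ sd v = sd w ∧ ((v = 0 ∨ ¬ P (par v)) ↔ (w = 0 ∨ ¬ P (par w))))
  pa_spec : ∀ v, v < n → v ≠ 0 → P v → P (par v) →
    pa (clOf σ (pr v) (sd v), pos v) = (clOf σ (pr (par v)) (sd (par v)), pos (par v))
  one_nbr : ∀ x y z, x < n → y < n → z < n → ¬ P x → P y → P z →
    ((y ≠ 0 ∧ par y = x) ∨ (x ≠ 0 ∧ par x = y)) →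
    ((z ≠ 0 ∧ par z = x) ∨ (x ≠ 0 ∧ par x = z)) → y = z
  capA_le : ∀ c, (((Finset.range n).filter (fun v => P v ∧ v ≠ 0 ∧ P (par v) ∧ pr v = c)).image
    (fun v => (clOf σ (pr v) (sd v), pos v))).card ≤ capA
  capF_le : ∀ c, (((Finset.range n).filter (fun v => P v ∧ pr v = c ∧ ∃ x, x < n ∧ ¬ P x ∧
    ((v ≠ 0 ∧ par v = x) ∨ (x ≠ 0 ∧ par x = v)))).image
    (fun v => (clOf σ (pr v) (sd v), pos v))).card ≤ capF
  capC_le : ∀ c, ((Finset.range n).filter (fun v => ¬ P v ∧ pr v = c)).card ≤ capC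
  capJ_le : ((Finset.range n).filter (fun v => J v)).card ≤ capJ

end PartC2a

section PartC2b

open scoped Classical

theorem sum_idx {Sg X : Type} [Fintype Sg] [Fintype X] (N : Sg → ℕ) (F : Sg → X → ℕ) :
    ∑ i : (Σ g : Sg, X × Fin (N g)), F i.1 i.2.1 = ∑ g, N g * ∑ s, F g s := by
  rw [Fintype.sum_sigma]
  refine Finset.sum_congr rfl fun g _ => ?_
  rw [Fintype.sum_prod_type]
  simp [Finset.mul_sum]

/-- number of orientations in which `{c,c'}` is a pair of `σ`. -/
noncomputable def cnt {K : Type} (σ : K → K) (c c' : K) : ℕ :=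
  (if σ c = c' then 1 else 0) + (if σ c' = c then 1 else 0)

/-- shift of atoms -/
def shf {K Q : Type} [AddCommGroup Q] (s : K → Q) (A : K × Q) : K × Q := (A.1, A.2 + s A.1)

namespace Plan
variable {n : ℕ} {par : ℕ → ℕ} {K : Type} {ed : K → K → Prop} {σ : K → K} {Q S : Type}
  {B capA capF capC capJ : ℕ} (pl : Plan n par ed σ Q S B capA capF capC capJ)

def cl (v : ℕ) : K := clOf σ (pl.pr v) (pl.sd v)
def atom (v : ℕ) : K × Q := (pl.cl v, pl.pos v)
/-- partner cluster -/
def pcl (v : ℕ) : K := clOf σ (pl.pr v) (!pl.sd v)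

theorem pair_cases (v : ℕ) : (pl.cl v = pl.pr v ∧ pl.pcl v = σ (pl.pr v)) ∨
    (pl.cl v = σ (pl.pr v) ∧ pl.pcl v = pl.pr v) := by
  unfold cl pcl clOf
  cases pl.sd v <;> simp

theorem pair_pr {v : ℕ} {c c' : K} (h1 : pl.cl v = c) (h2 : pl.pcl v = c') :
    (pl.pr v = c ∧ σ c = c') ∨ (pl.pr v = c' ∧ σ c' = c) := by
  rcases pl.pair_cases v with ⟨a, b⟩ | ⟨a, b⟩
  · left; rw [a] at h1; rw [b] at h2; subst h1; exact ⟨rfl, h2⟩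
  · right; rw [a] at h1; rw [b] at h2; subst h2; exact ⟨rfl, h1⟩

theorem cl_par {v : ℕ} (h : pl.pr v = pl.pr (par v) ∧ pl.sd v ≠ pl.sd (par v)) :
    pl.cl (par v) = pl.pcl v ∧ pl.pcl (par v) = pl.cl v := by
  obtain ⟨h1, h2⟩ := h
  unfold cl pcl
  rw [h1]
  revert h2
  cases pl.sd v <;> cases pl.sd (par v) <;> simp

theorem edge_P {v : ℕ} (hv : v < n) (h0 : v ≠ 0) (hP : pl.P v ∨ pl.P (par v)) :
    pl.pr v = pl.pr (par v) ∧ pl.sd v ≠ pl.sd (par v) := by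
  rcases pl.edge v hv h0 with h | ⟨h1, h2⟩
  · exact h
  · rcases hP with h | h
    · exact absurd h (pl.JP v h1)
    · exact absurd h (pl.JP _ h2)

theorem ed_cl {v : ℕ} (hs : ∀ c c', ed c c' → ed c' c) (hv : v < n) : ed (pl.cl v) (pl.pcl v) := by
  have := pl.good v hv
  rcases pl.pair_cases v with ⟨a, b⟩ | ⟨a, b⟩
  · rw [a, b]; exact this
  · rw [a, b]; exact hs _ _ this

/-- nonroot placed vertex -/
def NR (v : ℕ) : Prop := v < n ∧ pl.P v ∧ v ≠ 0 ∧ pl.P (par v)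

noncomputable def NA : Finset (K × Q) :=
  ((Finset.range n).filter (fun v => pl.P v ∧ v ≠ 0 ∧ pl.P (par v))).image pl.atom

theorem mem_NA {A : K × Q} : A ∈ pl.NA ↔ ∃ v, pl.NR v ∧ pl.atom v = A := by
  unfold NA NR
  simp only [Finset.mem_image, Finset.mem_filter, Finset.mem_range]

theorem pa_atom {v : ℕ} (h : pl.NR v) : pl.pa (pl.atom v) = pl.atom (par v) :=
  pl.pa_spec v h.1 h.2.2.1 h.2.1 h.2.2.2

theorem NA_card (c c' : K) :
    (pl.NA.filter (fun A => s(A.1, (pl.pa A).1) = s(c, c'))).card ≤ capA * cnt σ c c' := by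
  have hsub : pl.NA.filter (fun A => s(A.1, (pl.pa A).1) = s(c, c')) ⊆
      (if σ c = c' then (((Finset.range n).filter (fun v => pl.P v ∧ v ≠ 0 ∧ pl.P (par v) ∧ pl.pr v = c)).image
        (fun v => (clOf σ (pl.pr v) (pl.sd v), pl.pos v))) else ∅) ∪
      (if σ c' = c then (((Finset.range n).filter (fun v => pl.P v ∧ v ≠ 0 ∧ pl.P (par v) ∧ pl.pr v = c')).image
        (fun v => (clOf σ (pl.pr v) (pl.sd v), pl.pos v))) else ∅) := by
    intro A hA
    rw [Finset.mem_filter, pl.mem_NA] at hA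
    obtain ⟨⟨v, hv, rfl⟩, h2⟩ := hA
    rw [pl.pa_atom hv] at h2
    have h3 := pl.cl_par (pl.edge_P hv.1 hv.2.2.1 (Or.inl hv.2.1))
    have h4 : s(pl.cl v, pl.pcl v) = s(c, c') := by rw [← h3.1]; exact h2
    have h5 : (pl.pr v = c ∧ σ c = c') ∨ (pl.pr v = c' ∧ σ c' = c) := by
      rw [Sym2.eq_iff] at h4
      rcases h4 with ⟨a, b⟩ | ⟨a, b⟩
      · exact pl.pair_pr a b
      · exact (pl.pair_pr a b).symm
    rw [Finset.mem_union]
    rcases h5 with ⟨a, b⟩ | ⟨a, b⟩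
    · left; rw [if_pos b, Finset.mem_image]
      exact ⟨v, by simp only [Finset.mem_filter, Finset.mem_range]; exact ⟨hv.1, hv.2.1, hv.2.2.1, hv.2.2.2, a⟩, rfl⟩
    · right; rw [if_pos b, Finset.mem_image]
      exact ⟨v, by simp only [Finset.mem_filter, Finset.mem_range]; exact ⟨hv.1, hv.2.1, hv.2.2.1, hv.2.2.2, a⟩, rfl⟩
  refine (Finset.card_le_card hsub).trans ((Finset.card_union_le _ _).trans ?_)
  have h1 := pl.capA_le c
  have h2 := pl.capA_le c'
  unfold cnt
  split_ifs <;> (try simp only [Finset.card_empty]) <;> omega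

end Plan

theorem card_shf {K Q : Type} [Fintype K] [Fintype Q] [AddCommGroup Q] (A A' X Y : K × Q)
    (h : X.1 ≠ Y.1) :
    (Finset.univ.filter (fun s : K → Q => s(shf s A, shf s A') = s(X, Y))).card ≤
      if s(A.1, A'.1) = s(X.1, Y.1) then Fintype.card Q ^ (Fintype.card K - 2) else 0 := by
  split_ifs with hs
  · rw [Sym2.eq_iff] at hs
    rcases hs with ⟨h1, h2⟩ | ⟨h1, h2⟩
    · rw [← card_shift2 X.1 Y.1 h (X.2 - A.2) (Y.2 - A'.2)]
      apply Finset.card_le_card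
      intro s hs
      simp only [Finset.mem_filter, Finset.mem_univ, true_and, Sym2.eq_iff] at hs ⊢
      rcases hs with ⟨a, b⟩ | ⟨a, b⟩
      · rw [← a, ← b]; simp [shf]
      · exfalso; apply h
        have := congrArg Prod.fst a
        simp only [shf] at this
        rw [← this, h1]
    · rw [← card_shift2 X.1 Y.1 h (X.2 - A'.2) (Y.2 - A.2)]
      apply Finset.card_le_card
      intro s hs
      simp only [Finset.mem_filter, Finset.mem_univ, true_and, Sym2.eq_iff] at hs ⊢
      rcases hs with ⟨a, b⟩ | ⟨a, b⟩
      · exfalso; apply h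
        have := congrArg Prod.fst a
        simp only [shf] at this
        rw [← this, h1]
      · rw [← a, ← b]; simp [shf]
  · rw [Nat.le_zero, Finset.card_eq_zero, Finset.filter_eq_empty_iff]
    intro s _ hh
    apply hs
    have := congrArg (Sym2.map Prod.fst) hh
    simpa [shf] using this

section main
variable {V : Type} [Fintype V] {G : SimpleGraph V} {K Q S : Type} [Fintype K] [Fintype Q] [Fintype S]
  [AddCommGroup Q] {R : K → K → ℕ} {fa κ t β g g' : ℕ} (H : Host G K Q S R fa κ t β g g')
  {n : ℕ} {par : ℕ → ℕ} {Sg : Type} [Fintype Sg] (sig : Sg → K → K) (N : Sg → ℕ)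
  {B capA capF capC capJ : ℕ}
  (pl : ∀ j, Plan n par H.ed (sig j) Q S B capA capF capC capJ)

/-- index type for the copies -/
abbrev Idx {Sg : Type} (K Q : Type) (N : Sg → ℕ) := Σ j : Sg, (K → Q) × Fin (N j)

theorem demand_count (X Y : K × Q) (h : X.1 ≠ Y.1) :
    ((Finset.univ.filter (fun d : Idx K Q N × (K × Q) => d.2 ∈ (pl d.1.1).NA)).filter
      (fun d => s(shf d.1.2.1 d.2, shf d.1.2.1 ((pl d.1.1).pa d.2)) = s(X, Y))).card ≤
    capA * Fintype.card Q ^ (Fintype.card K - 2) * ∑ j, N j * cnt (sig j) X.1 Y.1 := by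
  have h1 : ((Finset.univ.filter (fun d : Idx K Q N × (K × Q) => d.2 ∈ (pl d.1.1).NA)).filter
      (fun d => s(shf d.1.2.1 d.2, shf d.1.2.1 ((pl d.1.1).pa d.2)) = s(X, Y))).card =
      ∑ i : Idx K Q N, ((pl i.1).NA.filter (fun A => s(shf i.2.1 A, shf i.2.1 ((pl i.1).pa A)) = s(X, Y))).card := by
    rw [Finset.filter_filter, Finset.card_filter, Fintype.sum_prod_type]
    refine Finset.sum_congr rfl fun i _ => ?_
    rw [← Finset.card_filter]
    congr 1
    ext A; simp
  rw [h1, sum_idx N (fun j s => ((pl j).NA.filter (fun A => s(shf s A, shf s ((pl j).pa A)) = s(X, Y))).card), Finset.mul_sum]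
  refine Finset.sum_le_sum fun j _ => ?_
  have h2 : ∑ s, ((pl j).NA.filter (fun A => s(shf s A, shf s ((pl j).pa A)) = s(X, Y))).card ≤
      Fintype.card Q ^ (Fintype.card K - 2) * (capA * cnt (sig j) X.1 Y.1) := by
    simp_rw [Finset.card_filter]
    rw [Finset.sum_comm]
    calc _ ≤ ∑ A ∈ (pl j).NA, if s(A.1, ((pl j).pa A).1) = s(X.1, Y.1) then Fintype.card Q ^ (Fintype.card K - 2) else 0 := by
          refine Finset.sum_le_sum fun A _ => ?_
          rw [← Finset.card_filter]
          exact card_shf A _ X Y h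
      _ = Fintype.card Q ^ (Fintype.card K - 2) * ((pl j).NA.filter (fun A => s(A.1, ((pl j).pa A).1) = s(X.1, Y.1))).card := by
          rw [← Finset.sum_filter, Finset.sum_const, smul_eq_mul, mul_comm]
      _ ≤ _ := Nat.mul_le_mul_left _ ((pl j).NA_card _ _)
  calc _ ≤ N j * (Fintype.card Q ^ (Fintype.card K - 2) * (capA * cnt (sig j) X.1 Y.1)) := Nat.mul_le_mul_left _ h2
    _ = _ := by ring

theorem exists_colours
    (hR : ∀ c c', H.ed c c' → capA * Fintype.card Q ^ (Fintype.card K - 2) * ∑ j, N j * cnt (sig j) c c' ≤ R c c') :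
    ∃ kc : Idx K Q N → K × Q → ℕ,
      (∀ i v, (pl i.1).NR v → kc i ((pl i.1).atom v) < R ((pl i.1).cl (par v)) ((pl i.1).cl v)) ∧
      (∀ i j v w, (pl i.1).NR v → (pl j.1).NR w → i ≠ j →
        s(shf i.2.1 ((pl i.1).atom v), shf i.2.1 ((pl i.1).atom (par v))) =
        s(shf j.2.1 ((pl j.1).atom w), shf j.2.1 ((pl j.1).atom (par w))) →
        kc i ((pl i.1).atom v) ≠ kc j ((pl j.1).atom w)) := by
  obtain ⟨k, hk1, hk2⟩ := exists_rank
    (Finset.univ.filter (fun d : Idx K Q N × (K × Q) => d.2 ∈ (pl d.1.1).NA))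
    (fun d => s(shf d.1.2.1 d.2, shf d.1.2.1 ((pl d.1.1).pa d.2)))
  refine ⟨fun i A => k (i, A), ?_, ?_⟩
  · intro i v hv
    have hm : (pl i.1).atom v ∈ (pl i.1).NA := (pl i.1).mem_NA.mpr ⟨v, hv, rfl⟩
    refine lt_of_lt_of_le (hk1 (i, (pl i.1).atom v) (by simp [hm])) ?_
    have h3 := (pl i.1).cl_par ((pl i.1).edge_P hv.1 hv.2.2.1 (Or.inl hv.2.1))
    have hed : H.ed ((pl i.1).cl v) ((pl i.1).cl (par v)) := by
      rw [h3.1]; exact (pl i.1).ed_cl H.ed_symm hv.1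
    rw [H.R_symm]
    refine le_trans ?_ (hR _ _ hed)
    have := demand_count H sig N pl (shf i.2.1 ((pl i.1).atom v)) (shf i.2.1 ((pl i.1).pa ((pl i.1).atom v))) (by
      rw [(pl i.1).pa_atom hv]; exact H.ed_ne _ _ hed)
    rw [(pl i.1).pa_atom hv] at this
    simp only [(pl i.1).pa_atom hv]
    refine le_trans (le_of_eq ?_) this
    congr
  · intro i j v w hv hw hij hkey he
    apply hij
    have hm : (pl i.1).atom v ∈ (pl i.1).NA := (pl i.1).mem_NA.mpr ⟨v, hv, rfl⟩
    have hm' : (pl j.1).atom w ∈ (pl j.1).NA := (pl j.1).mem_NA.mpr ⟨w, hw, rfl⟩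
    have := hk2 (i, (pl i.1).atom v) (by simp [hm]) (j, (pl j.1).atom w) (by simp [hm']) (by
      simp only; rw [(pl i.1).pa_atom hv, (pl j.1).pa_atom hw]; exact hkey) he
    exact congrArg Prod.fst this

end main

end PartC2b

section PartC2c

open scoped Classical

/-- tree adjacency -/
def nbr (par : ℕ → ℕ) (x y : ℕ) : Prop := (y ≠ 0 ∧ par y = x) ∨ (x ≠ 0 ∧ par x = y)

/-- the outcome of the main phase -/
structure MainOut {V : Type} [Fintype V] {G : SimpleGraph V} {K Q S : Type} [Fintype Q] [Fintype S]
    {R : K → K → ℕ} {fa κ t β g g' : ℕ} (H : Host G K Q S R fa κ t β g g') (n : ℕ) (par : ℕ → ℕ)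
    (I : Type) [Fintype I] (D capJ FL TL : ℕ) where
  C : I → ℕ → Prop
  J : I → ℕ → Bool
  cl : I → ℕ → K
  pcl : I → ℕ → K
  φ0 : I → ℕ → V
  J_C : ∀ i v, J i v = true → C i v
  inj : ∀ i v w, v < n → w < n → ¬ C i v → ¬ C i w → φ0 i v = φ0 i w → v = w
  nz : ∀ i v, v < n → ¬ C i v → ∀ c b, φ0 i v ∉ H.zone c b
  adj : ∀ i v, v < n → v ≠ 0 → ¬ C i v → ¬ C i (par v) → G.Adj (φ0 i v) (φ0 i (par v))
  disj : ∀ i j, i ≠ j → ∀ v w, v < n → v ≠ 0 → w < n → w ≠ 0 → ¬ C i v → ¬ C i (par v) →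
    ¬ C j w → ¬ C j (par w) → s(φ0 i v, φ0 i (par v)) ≠ s(φ0 j w, φ0 j (par w))
  ed : ∀ i v, v < n → H.ed (cl i v) (pcl i v)
  edge : ∀ i v, v < n → v ≠ 0 → (cl i (par v) = pcl i v ∧ pcl i (par v) = cl i v) ∨
    (J i v = true ∧ J i (par v) = true)
  typ : ∀ i y b, y < n → ¬ C i y → κ ≤ ((H.zone (pcl i y) b).filter (fun u => G.Adj (φ0 i y) u)).card
  one_nbr : ∀ i x y z, x < n → y < n → z < n → C i x → ¬ C i y → ¬ C i z → nbr par x y → nbr par x z → y = z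
  capD : ∀ i c, ((Finset.range n).filter (fun v => C i v ∧ cl i v = c)).card ≤ D
  capJ_le : ∀ i, ((Finset.range n).filter (fun v => J i v = true)).card ≤ capJ
  load1 : ∀ u c, (Finset.univ.filter (fun i => ∃ y, y < n ∧ ¬ C i y ∧ φ0 i y = u ∧ pcl i y = c ∧
    ∃ x, x < n ∧ C i x ∧ nbr par x y)).card ≤ FL
  load2 : ∀ c c', H.ed c c' → ∑ i, ((Finset.range n).filter (fun v => v ≠ 0 ∧ C i v ∧ C i (par v) ∧
    s(cl i v, cl i (par v)) = s(c, c'))).card ≤ TL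

section compl
variable {V : Type} [Fintype V] {G : SimpleGraph V} {K Q S : Type} [Fintype Q] [Fintype S]
    {R : K → K → ℕ} {fa κ t β g g' : ℕ} {H : Host G K Q S R fa κ t β g g'} {n : ℕ} {par : ℕ → ℕ}
    {I : Type} [Fintype I] {D capJ FL TL : ℕ} (mo : MainOut H n par I D capJ FL TL)

structure LocalOK (i : I) (f : ℕ → V) : Prop where
  inj : ∀ v w, v < n → w < n → f v = f w → v = w
  adj : ∀ v, v < n → v ≠ 0 → G.Adj (f v) (f (par v))
  off : ∀ v, v < n → ¬ mo.C i v → f v = mo.φ0 i v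
  on : ∀ v, v < n → mo.C i v → f v ∈ H.zone (mo.cl i v) (mo.J i v)

variable {mo}

theorem LocalOK.zone {i : I} {f : ℕ → V} (h : LocalOK mo i f) {v : ℕ} (hv : v < n) {c : K} {b : Bool}
    (hz : f v ∈ H.zone c b) : mo.C i v ∧ mo.cl i v = c ∧ mo.J i v = b := by
  by_cases hC : mo.C i v
  · refine ⟨hC, ?_⟩
    have h1 := h.on v hv hC
    by_contra hne
    have := H.zone_disj (mo.cl i v) (mo.J i v) c b (by
      intro he; apply hne; simpa using he)
    exact Finset.disjoint_left.mp this h1 hz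
  · rw [h.off v hv hC] at hz
    exact absurd hz (mo.nz i v hv hC c b)

theorem LocalOK.nzone {i : I} {f : ℕ → V} (h : LocalOK mo i f) {v : ℕ} (hv : v < n)
    (hz : ∀ c b, f v ∉ H.zone c b) : ¬ mo.C i v := fun hC => hz _ _ (h.on v hv hC)

/-- used edges -/
def Us (n : ℕ) (par : ℕ → ℕ) (I0 : Finset I) (φ : I → ℕ → V) (e : Sym2 V) : Prop :=
  ∃ j ∈ I0, ∃ w, w < n ∧ w ≠ 0 ∧ e = s(φ j w, φ j (par w))

/-- union of the two zones -/
noncomputable def ZZ (H : Host G K Q S R fa κ t β g g') (c : K) : Finset V := H.zone c false ∪ H.zone c true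

theorem mem_ZZ {c : K} {v : V} : v ∈ ZZ H c ↔ ∃ b, v ∈ H.zone c b := by
  unfold ZZ; rw [Finset.mem_union]; constructor
  · rintro (h | h)
    · exact ⟨_, h⟩
    · exact ⟨_, h⟩
  · rintro ⟨b, h⟩; cases b
    · left; exact h
    · right; exact h

theorem card_le_mul_rel {A B : Type*} (s : Finset A) (t : Finset B) (r : A → B → Prop) (k : ℕ)
    (h1 : ∀ a ∈ s, ∃ b ∈ t, r a b) (h2 : ∀ b ∈ t, ∀ X : Finset A, (∀ a ∈ X, a ∈ s ∧ r a b) → X.card ≤ k) :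
    s.card ≤ t.card * k := by
  have : s ⊆ t.biUnion (fun b => s.filter (fun a => r a b)) := by
    intro a ha
    obtain ⟨b, hb, hr⟩ := h1 a ha
    exact Finset.mem_biUnion.mpr ⟨b, hb, Finset.mem_filter.mpr ⟨ha, hr⟩⟩
  exact (Finset.card_le_card this).trans (Finset.card_biUnion_le_card_mul _ _ _
    (fun b hb => h2 b hb _ (fun a ha => Finset.mem_filter.mp ha)))

theorem used_two (hp : ∀ v, v ≠ 0 → par v < v) (I0 : Finset I) (φ : I → ℕ → V)
    (hl : ∀ j ∈ I0, LocalOK mo j (φ j))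
    (c c' : K) (hc : H.ed c c') :
    ((ZZ H c ×ˢ ZZ H c').filter (fun p => Us n par I0 φ s(p.1, p.2))).card ≤ TL := by
  have hne := H.ed_ne c c' hc
  refine le_trans ?_ (mo.load2 c c' hc)
  rw [← Finset.card_sigma]
  refine le_trans ?_ (le_of_eq (mul_one _))
  refine card_le_mul_rel _ _ (fun (p : V × V) (d : Σ _ : I, ℕ) => s(p.1, p.2) = s(φ d.1 d.2, φ d.1 (par d.2))) 1 ?_ ?_
  · intro p hpm
    simp only [Finset.mem_filter, Finset.mem_product, mem_ZZ] at hpm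
    obtain ⟨⟨⟨b, hb⟩, ⟨b', hb'⟩⟩, j, hj, w, hw, hw0, he⟩ := hpm
    refine ⟨⟨j, w⟩, ?_, he⟩
    simp only [Finset.mem_sigma, Finset.mem_univ, true_and, Finset.mem_filter, Finset.mem_range]
    have hwp := (hp w hw0).trans hw
    rw [Sym2.eq_iff] at he
    rcases he with ⟨h1, h2⟩ | ⟨h1, h2⟩
    · rw [h1] at hb; rw [h2] at hb'
      obtain ⟨a1, a2, _⟩ := (hl j hj).zone hw hb
      obtain ⟨b1, b2, _⟩ := (hl j hj).zone hwp hb'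
      exact ⟨hw, hw0, a1, b1, by rw [a2, b2]⟩
    · rw [h1] at hb; rw [h2] at hb'
      obtain ⟨a1, a2, _⟩ := (hl j hj).zone hw hb'
      obtain ⟨b1, b2, _⟩ := (hl j hj).zone hwp hb
      exact ⟨hw, hw0, a1, b1, by rw [a2, b2, Sym2.eq_swap]⟩
  · intro d _ X hX
    rw [Finset.card_le_one]
    intro p hp1 p' hp2
    replace hp1 := hX p hp1
    replace hp2 := hX p' hp2
    have h1 : s(p.1, p.2) = s(p'.1, p'.2) := hp1.2.trans hp2.2.symm
    rw [Sym2.eq_iff] at h1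
    rcases h1 with ⟨h1, h2⟩ | ⟨h1, h2⟩
    · exact Prod.ext h1 h2
    · exfalso
      have hpm := (Finset.mem_product.mp (Finset.mem_filter.mp hp1.1).1).1
      have hpm' := (Finset.mem_product.mp (Finset.mem_filter.mp hp2.1).1).2
      rw [← h1, mem_ZZ] at hpm'
      rw [mem_ZZ] at hpm
      obtain ⟨b, hb⟩ := hpm
      obtain ⟨b', hb'⟩ := hpm'
      exact Finset.disjoint_left.mp (H.zone_disj c b c' b' (by simp [hne])) hb hb'

theorem used_J (I0 : Finset I) (φ : I → ℕ → V)
    (hl : ∀ j ∈ I0, LocalOK mo j (φ j)) :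
    ((Finset.univ : Finset (V × V)).filter (fun p => (∃ c, p.1 ∈ H.zone c true) ∧
      (∃ c, p.2 ∈ H.zone c true) ∧ Us n par I0 φ s(p.1, p.2))).card ≤ 2 * (Fintype.card I * capJ) := by
  have h0 : ((Finset.univ : Finset I).sigma (fun i =>
        (Finset.range n).filter (fun v => mo.J i v = true))).card ≤ Fintype.card I * capJ := by
    rw [Finset.card_sigma]
    refine (Finset.sum_le_card_nsmul _ _ capJ (fun i _ => mo.capJ_le i)).trans ?_
    simp
  rw [mul_comm]
  refine le_trans ?_ (Nat.mul_le_mul_right 2 h0)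
  refine card_le_mul_rel _ _ (fun p d => s(p.1, p.2) = s(φ d.1 d.2, φ d.1 (par d.2))) 2 ?_ ?_
  · intro p hpm
    simp only [Finset.mem_filter, Finset.mem_univ, true_and] at hpm
    obtain ⟨⟨b, hb⟩, ⟨b', hb'⟩, j, hj, w, hw, hw0, he⟩ := hpm
    refine ⟨⟨j, w⟩, ?_, he⟩
    simp only [Finset.mem_sigma, Finset.mem_univ, true_and, Finset.mem_filter, Finset.mem_range]
    rw [Sym2.eq_iff] at he
    rcases he with ⟨h1, h2⟩ | ⟨h1, h2⟩
    · rw [h1] at hb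
      exact ⟨hw, ((hl j hj).zone hw hb).2.2⟩
    · rw [h2] at hb'
      exact ⟨hw, ((hl j hj).zone hw hb').2.2⟩
  · intro d _ X hX
    have hsub : X ⊆
      {(φ d.1 d.2, φ d.1 (par d.2)), (φ d.1 (par d.2), φ d.1 d.2)} := by
      intro p hpp
      have := (hX p hpp).2
      rw [Sym2.eq_iff] at this
      rw [Finset.mem_insert, Finset.mem_singleton]
      rcases this with ⟨a, b⟩ | ⟨a, b⟩
      · left; exact Prod.ext a b
      · right; exact Prod.ext a b
    exact (Finset.card_le_card hsub).trans (Finset.card_le_two)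

theorem used_main {Δ : ℕ} (hP : ParArr n Δ par) (I0 : Finset I) (φ : I → ℕ → V)
    (hl : ∀ j ∈ I0, LocalOK mo j (φ j)) (u : V) (hu : ∀ c b, u ∉ H.zone c b) (c : K) :
    ((ZZ H c).filter (fun x => Us n par I0 φ s(u, x))).card ≤ FL * (Δ + 1) := by
  refine le_trans ?_ (Nat.mul_le_mul_right _ (mo.load1 u c))
  refine card_le_mul_rel _ _ (fun x j => j ∈ I0 ∧ ∃ y x', y < n ∧ φ j y = u ∧ x = φ j x' ∧ x' < n ∧ nbr par x' y) _ ?_ ?_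
  · intro x hx
    simp only [Finset.mem_filter, mem_ZZ] at hx
    obtain ⟨⟨b, hb⟩, j, hj, w, hw, hw0, he⟩ := hx
    have hwp := (hP.lt w hw0).trans hw
    refine ⟨j, ?_, hj, ?_⟩
    · simp only [Finset.mem_filter, Finset.mem_univ, true_and]
      rw [Sym2.eq_iff] at he
      rcases he with ⟨h1, h2⟩ | ⟨h1, h2⟩
      · have hn := (hl j hj).nzone hw (by rw [← h1]; exact hu)
        rw [h2] at hb
        obtain ⟨a1, a2, _⟩ := (hl j hj).zone hwp hb
        refine ⟨w, hw, hn, by rw [h1, (hl j hj).off w hw hn], ?_, par w, hwp, a1, Or.inl ⟨hw0, rfl⟩⟩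
        rcases mo.edge j w hw hw0 with h | h
        · rw [← h.1, a2]
        · exact absurd (mo.J_C _ _ h.1) hn
      · have hn := (hl j hj).nzone hwp (by rw [← h1]; exact hu)
        rw [h2] at hb
        obtain ⟨a1, a2, _⟩ := (hl j hj).zone hw hb
        refine ⟨par w, hwp, hn, by rw [h1, (hl j hj).off _ hwp hn], ?_, w, hw, a1, Or.inr ⟨hw0, rfl⟩⟩
        rcases mo.edge j w hw hw0 with h | h
        · rw [h.2, a2]
        · exact absurd (mo.J_C _ _ h.2) hn
    · rw [Sym2.eq_iff] at he
      rcases he with ⟨h1, h2⟩ | ⟨h1, h2⟩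
      · exact ⟨w, par w, hw, h1.symm, h2, hwp, Or.inl ⟨hw0, rfl⟩⟩
      · exact ⟨par w, w, hwp, h1.symm, h2, hw, Or.inr ⟨hw0, rfl⟩⟩
  · intro j _ X hX
    by_cases hj : j ∈ I0 ∧ ∃ y, y < n ∧ φ j y = u
    · obtain ⟨hj, y, hy, hyu⟩ := hj
      have hsub : X ⊆
        (insert (par y) ((Finset.range n).filter (fun v => v ≠ 0 ∧ par v = y))).image (φ j) := by
        intro x hx
        obtain ⟨_, _, y', x', h1, h2, h3, h4, h5⟩ := hX x hx
        have : y' = y := (hl j hj).inj y' y h1 hy (h2.trans hyu.symm)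
        subst this
        rw [Finset.mem_image]
        refine ⟨x', ?_, h3.symm⟩
        rw [Finset.mem_insert, Finset.mem_filter, Finset.mem_range]
        rcases h5 with h5 | h5
        · left; exact h5.2.symm
        · right; exact ⟨h4, h5⟩
      refine (Finset.card_le_card hsub).trans (Finset.card_image_le.trans ((Finset.card_insert_le _ _).trans ?_))
      exact Nat.add_le_add_right (hP.ch y) 1
    · have : X = ∅ := by
        rw [Finset.eq_empty_iff_forall_notMem]
        intro x hx
        obtain ⟨_, h, y, x', h1, h2, _⟩ := hX x hx
        exact hj ⟨h, y, h1, h2⟩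
      rw [this]; simp

/-- Markov -/
theorem card_big {A B : Type*} (X : Finset A) (Y : Finset B) (r : A → B → Prop) (θ OV T : ℕ)
    (hT : ((X ×ˢ Y).filter (fun p => r p.1 p.2)).card ≤ T) (h : T < (OV + 1) * (θ + 1)) :
    (X.filter (fun v => θ < (Y.filter (fun u => r v u)).card)).card ≤ OV := by
  by_contra hc
  push Not at hc
  have h1 : ((X ×ˢ Y).filter (fun p => r p.1 p.2)).card = ∑ v ∈ X, (Y.filter (fun u => r v u)).card := by
    rw [Finset.card_filter, Finset.sum_product]
    refine Finset.sum_congr rfl fun v _ => ?_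
    rw [Finset.card_filter]
  have h2 : (X.filter (fun v => θ < (Y.filter (fun u => r v u)).card)).card * (θ + 1) ≤
      ∑ v ∈ X, (Y.filter (fun u => r v u)).card := by
    rw [← smul_eq_mul]
    refine (Finset.card_nsmul_le_sum _ _ _ ?_).trans (Finset.sum_le_sum_of_subset (Finset.filter_subset _ _))
    intro v hv
    exact (Finset.mem_filter.mp hv).2
  have h3 := Nat.mul_le_mul_right (θ + 1) (Nat.succ_le_of_lt hc)
  have : (OV + 1) * (θ + 1) ≤ OV.succ * (θ + 1) := le_refl _
  omega

end compl

end PartC2c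

section PartC2d

open scoped Classical

section compl
variable {V : Type} [Fintype V] {G : SimpleGraph V} {K Q S : Type} [Fintype Q] [Fintype S]
    {R : K → K → ℕ} {fa κ t β g g' : ℕ} {H : Host G K Q S R fa κ t β g g'} {n : ℕ} {par : ℕ → ℕ}
    {I : Type} [Fintype I] {D capJ FL TL : ℕ} {mo : MainOut H n par I D capJ FL TL}

theorem card_filter_three {A : Type*} (X X1 X2 X3 : Finset A) (P : A → Prop)
    (h : ∀ x ∈ X, ¬ P x → x ∈ X1 ∨ x ∈ X2 ∨ x ∈ X3) :
    X.card ≤ (X.filter P).card + X1.card + X2.card + X3.card := by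
  have : X ⊆ ((X.filter P) ∪ X1) ∪ X2 ∪ X3 := by
    intro x hx
    simp only [Finset.mem_union, Finset.mem_filter]
    by_cases hp : P x
    · exact Or.inl (Or.inl (Or.inl ⟨hx, hp⟩))
    · rcases h x hx hp with h | h | h
      · exact Or.inl (Or.inl (Or.inr h))
      · exact Or.inl (Or.inr h)
      · exact Or.inr h
  refine (Finset.card_le_card this).trans ?_
  have h1 := Finset.card_union_le (((X.filter P) ∪ X1) ∪ X2) X3
  have h2 := Finset.card_union_le ((X.filter P) ∪ X1) X2
  have h3 := Finset.card_union_le (X.filter P) X1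
  omega

theorem zone_sub_ZZ (c : K) (b : Bool) : H.zone c b ⊆ ZZ H c := fun _ hv => mem_ZZ.mpr ⟨b, hv⟩

/-- One step of the sequential packing. -/
theorem compl_step [Nonempty V] {Δ θ W OV1 OV2 : ℕ} (hP : ParArr n Δ par)
    (hn4 : 2 * β + FL * (Δ + 1) + OV1 + OV2 ≤ κ)
    (hOV1 : TL < (OV1 + 1) * (θ + 1))
    (hOV2 : 2 * (Fintype.card I * capJ) < (OV2 + 1) * (W + 1))
    (hg1 : θ + D ≤ g) (hg2 : θ + capJ ≤ g) (hg3 : W + capJ ≤ g')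
    (ht : Δ * t ≤ β) (hJb : capJ ≤ β) (hDb : D ≤ β)
    (I0 : Finset I) (φ : I → ℕ → V) (hl : ∀ j ∈ I0, LocalOK mo j (φ j)) (i : I) (hi : i ∉ I0) :
    ∃ f, LocalOK mo i f ∧ ∀ v, v < n → v ≠ 0 → ¬ Us n par I0 φ s(f v, f (par v)) := by
  set U : V → V → Prop := fun v u => Us n par I0 φ s(v, u) with hU
  have Usymm : ∀ v u, U v u → U u v := by
    intro v u h; simp only [hU] at h ⊢; rwa [Sym2.eq_swap]
  obtain ⟨cand, hcand⟩ : ∃ cand : ℕ → V → Prop, ∀ x v, cand x v ↔ (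
    ((ZZ H (mo.pcl i x)).filter (fun u => U v u)).card ≤ θ ∧
    (mo.J i x = true → ((Finset.univ.filter (fun u => ∃ c, u ∈ H.zone c true)).filter (fun u => U v u)).card ≤ W) ∧
    ∀ y, y < n → ¬ mo.C i y → nbr par x y → G.Adj (mo.φ0 i y) v ∧ ¬ U (mo.φ0 i y) v) := ⟨_, fun _ _ => Iff.rfl⟩
  set A : ℕ → Finset V := fun x => (H.zone (mo.cl i x) (mo.J i x)).filter (cand x) with hA
  set need : K × Bool → ℕ := fun z => if z.2 then capJ else D with hneed
  set zn : ℕ → K × Bool := fun x => (mo.cl i x, mo.J i x) with hzn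
  set C : Finset ℕ := (Finset.range n).filter (fun v => mo.C i v) with hC
  have memC : ∀ x, x ∈ C ↔ x < n ∧ mo.C i x := by intro x; simp [hC]
  have needb : ∀ z, need z ≤ β := by
    intro z; simp only [hneed]; split_ifs <;> assumption
  have hzone : ∀ x, x < n → H.ed (mo.cl i x) (mo.pcl i x) := fun x hx => mo.ed i x hx
  -- overloaded vertices
  have ov1 : ∀ x, x < n → ((ZZ H (mo.cl i x)).filter (fun v =>
      θ < ((ZZ H (mo.pcl i x)).filter (fun u => U v u)).card)).card ≤ OV1 := by
    intro x hx
    exact card_big _ _ U θ OV1 TL (used_two hP.lt I0 φ hl _ _ (hzone x hx)) hOV1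
  have ov2 : ((Finset.univ.filter (fun v : V => ∃ c, v ∈ H.zone c true)).filter (fun v =>
      W < ((Finset.univ.filter (fun u => ∃ c, u ∈ H.zone c true)).filter (fun u => U v u)).card)).card ≤ OV2 := by
    refine card_big _ _ U W OV2 _ (le_trans (Finset.card_le_card ?_) (used_J I0 φ hl)) hOV2
    intro p hp
    simp only [Finset.mem_filter, Finset.mem_product, Finset.mem_univ, true_and] at hp ⊢
    exact ⟨hp.1.1, hp.1.2, hp.2⟩
  -- sizes
  have Abig : ∀ x ∈ C, 2 * β ≤ (A x).card := by
    intro x hx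
    obtain ⟨hxn, hxC⟩ := (memC x).mp hx
    by_cases hy : ∃ y, y < n ∧ ¬ mo.C i y ∧ nbr par x y
    · obtain ⟨y, hyn, hyC, hyx⟩ := hy
      have huniq : ∀ z, z < n → ¬ mo.C i z → nbr par x z → z = y := fun z hz hzC hzx =>
        mo.one_nbr i x z y hxn hz hyn hxC hzC hyC hzx hyx
      have hpc : mo.pcl i y = mo.cl i x := by
        rcases hyx with ⟨h0, h1⟩ | ⟨h0, h1⟩
        · rcases mo.edge i y hyn h0 with h | h
          · rw [← h.1, h1]
          · exact absurd (mo.J_C _ _ h.1) hyC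
        · rcases mo.edge i x hxn h0 with h | h
          · rw [← h.2, h1]
          · rw [h1] at h
            exact absurd (mo.J_C _ _ h.2) hyC
      have htyp := mo.typ i y (mo.J i x) hyn hyC
      rw [hpc] at htyp
      have hm := used_main hP I0 φ hl (mo.φ0 i y) (mo.nz i y hyn hyC) (mo.cl i x)
      have h3 := card_filter_three ((H.zone (mo.cl i x) (mo.J i x)).filter (fun u => G.Adj (mo.φ0 i y) u))
        ((ZZ H (mo.cl i x)).filter (fun u => U (mo.φ0 i y) u))
        ((ZZ H (mo.cl i x)).filter (fun v => θ < ((ZZ H (mo.pcl i x)).filter (fun u => U v u)).card))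
        ((Finset.univ.filter (fun v : V => ∃ c, v ∈ H.zone c true)).filter (fun v =>
      W < ((Finset.univ.filter (fun u => ∃ c, u ∈ H.zone c true)).filter (fun u => U v u)).card)) (cand x) (by
          intro v hv hnc
          rw [Finset.mem_filter] at hv
          have hvZ := zone_sub_ZZ _ _ hv.1
          by_contra hcon
          push Not at hcon
          obtain ⟨c1, c2, c3⟩ := hcon
          refine hnc ((hcand _ _).mpr ⟨?_, ?_, ?_⟩)
          · by_contra hh
            exact c2 (Finset.mem_filter.mpr ⟨hvZ, not_le.mp hh⟩)
          · intro hJ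
            by_contra hh
            rw [hJ] at hv
            exact c3 (Finset.mem_filter.mpr ⟨Finset.mem_filter.mpr ⟨Finset.mem_univ _, _, hv.1⟩, not_le.mp hh⟩)
          · intro z hz hzC hzx
            rw [huniq z hz hzC hzx]
            refine ⟨hv.2, fun hu => c1 (Finset.mem_filter.mpr ⟨hvZ, hu⟩)⟩)
      have h4 : (((H.zone (mo.cl i x) (mo.J i x)).filter (fun u => G.Adj (mo.φ0 i y) u)).filter (cand x)).card ≤ (A x).card := by
        refine Finset.card_le_card ?_
        intro v hv
        rw [Finset.mem_filter, Finset.mem_filter] at hv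
        exact Finset.mem_filter.mpr ⟨hv.1.1, hv.2⟩
      have h5 := ov1 x hxn
      simp only [hU] at hm h3 h5 ov2
      omega
    · push Not at hy
      have hzc := H.zone_card (mo.cl i x) (mo.J i x)
      have h3 := card_filter_three (H.zone (mo.cl i x) (mo.J i x)) ∅
        ((ZZ H (mo.cl i x)).filter (fun v => θ < ((ZZ H (mo.pcl i x)).filter (fun u => U v u)).card))
        ((Finset.univ.filter (fun v : V => ∃ c, v ∈ H.zone c true)).filter (fun v =>
      W < ((Finset.univ.filter (fun u => ∃ c, u ∈ H.zone c true)).filter (fun u => U v u)).card)) (cand x) (by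
          intro v hv hnc
          have hvZ := zone_sub_ZZ _ _ hv
          by_contra hcon
          push Not at hcon
          obtain ⟨c1, c2, c3⟩ := hcon
          refine hnc ((hcand _ _).mpr ⟨?_, ?_, ?_⟩)
          · by_contra hh
            exact c2 (Finset.mem_filter.mpr ⟨hvZ, not_le.mp hh⟩)
          · intro hJ
            by_contra hh
            rw [hJ] at hv
            exact c3 (Finset.mem_filter.mpr ⟨Finset.mem_filter.mpr ⟨Finset.mem_univ _, _, hv⟩, not_le.mp hh⟩)
          · intro z hz hzC hzx
            exact absurd hzx (hy z hz hzC))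
      rw [Finset.card_empty] at h3
      have h5 := ov1 x hxn
      have h6 : ((H.zone (mo.cl i x) (mo.J i x)).filter (cand x)).card = (A x).card := rfl
      omega
  obtain ⟨Rr, hRr⟩ : ∃ Rr : V → V → Prop, ∀ v u, Rr v u ↔ G.Adj v u ∧ ¬ U v u := ⟨_, fun _ _ => Iff.rfl⟩
  obtain ⟨ψ, ψ1, ψ2, ψ3⟩ := exists_extension hP C (by rw [hC]; exact Finset.filter_subset _ _) A zn need
    Rr (by
      intro x _ y _ hne
      refine Finset.disjoint_of_subset_left (Finset.filter_subset _ _)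
        (Finset.disjoint_of_subset_right (Finset.filter_subset _ _) (H.zone_disj _ _ _ _ hne))) (by
      rintro ⟨c, b⟩
      cases b
      · refine le_trans (Finset.card_le_card ?_) (mo.capD i c)
        intro x hx
        simp only [hC, hzn, Finset.mem_filter, Prod.mk.injEq] at hx
        simp only [Finset.mem_filter]
        exact ⟨hx.1.1, hx.1.2, hx.2.1⟩
      · refine le_trans (Finset.card_le_card ?_) (mo.capJ_le i)
        intro x hx
        simp only [hC, hzn, Finset.mem_filter, Prod.mk.injEq] at hx
        simp only [Finset.mem_filter]
        exact ⟨hx.1.1, hx.2.2⟩) (by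
      intro x hx
      have := Abig x hx
      have := needb (zn x)
      omega) (by
      intro x hx hx0 hpx B hB hBc
      have hb1 := Abig x hx
      have hb2 := Abig _ hpx
      have hBβ : β ≤ B.card := by omega
      obtain ⟨hxn, hxC⟩ := (memC x).mp hx
      have hpn := (hP.lt x hx0).trans hxn
      suffices h : ((A (par x)).filter (fun v => (B.filter (fun u => Rr v u)).card < need (zn x))).card ≤ t by
        calc _ ≤ 2 * Δ * t := Nat.mul_le_mul_left _ h
          _ ≤ 2 * β := by rw [mul_assoc]; exact Nat.mul_le_mul_left _ ht
          _ ≤ _ := hb2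
      have hBz : B ⊆ H.zone (mo.cl i x) (mo.J i x) := hB.trans (Finset.filter_subset _ _)
      have split : ∀ v, (B.filter (fun u => G.Adj v u)).card ≤
          (B.filter (fun u => Rr v u)).card + (B.filter (fun u => U v u)).card := by
        intro v
        refine le_trans (Finset.card_le_card ?_) (Finset.card_union_le _ _)
        intro u hu
        simp only [Finset.mem_union, Finset.mem_filter, hRr] at hu ⊢
        tauto
      rcases mo.edge i x hxn hx0 with he | he
      · refine le_trans (Finset.card_le_card ?_) (H.h2 (mo.cl i (par x)) (mo.cl i x) (by
          rw [← he.2]; exact mo.ed i _ hpn) (mo.J i (par x)) (mo.J i x) B hBz hBβ)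
        intro v hv
        simp only [hA, Finset.mem_filter] at hv ⊢
        refine ⟨hv.1.1, ?_⟩
        have hs := split v
        have hload := ((hcand _ _).mp hv.1.2).1
        rw [he.2] at hload
        have : (B.filter (fun u => U v u)).card ≤ ((ZZ H (mo.cl i x)).filter (fun u => U v u)).card :=
          Finset.card_le_card (Finset.filter_subset_filter _ (hBz.trans (zone_sub_ZZ _ _)))
        have hnd : θ + need (zn x) ≤ g := by
          simp only [hneed]; split_ifs <;> assumption
        omega
      · rw [he.1] at hBz
        refine le_trans (Finset.card_le_card ?_) (H.h4 (mo.cl i x) B hBz hBβ)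
        intro v hv
        simp only [hA, Finset.mem_filter] at hv ⊢
        refine ⟨Finset.mem_univ _, ?_⟩
        have hs := split v
        have hload := ((hcand _ _).mp hv.1.2).2.1 he.2
        have : (B.filter (fun u => U v u)).card ≤ ((Finset.univ.filter (fun u => ∃ c, u ∈ H.zone c true)).filter (fun u => U v u)).card :=
          Finset.card_le_card (Finset.filter_subset_filter _ (by
            intro u hu; simp only [Finset.mem_filter, Finset.mem_univ, true_and]; exact ⟨_, hBz hu⟩))
        have hnd : need (zn x) = capJ := by
          simp only [hneed, hzn, he.1, if_true]
        omega)
  set f : ℕ → V := fun v => if mo.C i v then ψ v else mo.φ0 i v with hf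
  have fC : ∀ v, mo.C i v → f v = ψ v := fun v hv => by simp only [hf, if_pos hv]
  have fN : ∀ v, ¬ mo.C i v → f v = mo.φ0 i v := fun v hv => by simp only [hf, if_neg hv]
  have ψz : ∀ v, v < n → mo.C i v → ψ v ∈ H.zone (mo.cl i v) (mo.J i v) ∧ cand v (ψ v) := by
    intro v hv hC
    exact Finset.mem_filter.mp (ψ2 v ((memC v).mpr ⟨hv, hC⟩))
  -- mixed edges
  have mixed : ∀ x y, x < n → y < n → mo.C i x → ¬ mo.C i y → nbr par x y →
      G.Adj (f y) (f x) ∧ ¬ U (f y) (f x) := by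
    intro x y hx hy hxC hyC hxy
    rw [fC x hxC, fN y hyC]
    exact ((hcand _ _).mp (ψz x hx hxC).2).2.2 y hy hyC hxy
  refine ⟨f, ⟨?_, ?_, ?_, ?_⟩, ?_⟩
  · intro v w hv hw he
    by_cases h1 : mo.C i v <;> by_cases h2 : mo.C i w
    · rw [fC v h1, fC w h2] at he
      exact ψ1 ((memC v).mpr ⟨hv, h1⟩) ((memC w).mpr ⟨hw, h2⟩) he
    · rw [fC v h1, fN w h2] at he
      exact absurd (he ▸ (ψz v hv h1).1) (mo.nz i w hw h2 _ _)
    · rw [fN v h1, fC w h2] at he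
      exact absurd (he ▸ (ψz w hw h2).1) (mo.nz i v hv h1 _ _)
    · rw [fN v h1, fN w h2] at he
      exact mo.inj i v w hv hw h1 h2 he
  · intro v hv h0
    have hpn := (hP.lt v h0).trans hv
    by_cases h1 : mo.C i v <;> by_cases h2 : mo.C i (par v)
    · rw [fC v h1, fC _ h2]
      exact ((hRr _ _).mp (ψ3 v ((memC v).mpr ⟨hv, h1⟩) h0 ((memC _).mpr ⟨hpn, h2⟩))).1.symm
    · exact (mixed v (par v) hv hpn h1 h2 (Or.inr ⟨h0, rfl⟩)).1.symm
    · exact (mixed (par v) v hpn hv h2 h1 (Or.inl ⟨h0, rfl⟩)).1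
    · rw [fN v h1, fN _ h2]
      exact mo.adj i v hv h0 h1 h2
  · intro v _ h; exact fN v h
  · intro v hv h; rw [fC v h]; exact (ψz v hv h).1
  · intro v hv h0 hus
    have hpn := (hP.lt v h0).trans hv
    by_cases h1 : mo.C i v <;> by_cases h2 : mo.C i (par v)
    · rw [fC v h1, fC _ h2] at hus
      exact ((hRr _ _).mp (ψ3 v ((memC v).mpr ⟨hv, h1⟩) h0 ((memC _).mpr ⟨hpn, h2⟩))).2 (Usymm _ _ hus)
    · exact (mixed v (par v) hv hpn h1 h2 (Or.inr ⟨h0, rfl⟩)).2 (Usymm _ _ hus)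
    · exact (mixed (par v) v hpn hv h2 h1 (Or.inl ⟨h0, rfl⟩)).2 hus
    · rw [fN v h1, fN _ h2] at hus
      obtain ⟨j, hj, w, hw, hw0, he⟩ := hus
      have hwp := (hP.lt w hw0).trans hw
      have hij : i ≠ j := fun h => hi (h ▸ hj)
      have nz1 := mo.nz i v hv h1
      have nz2 := mo.nz i _ hpn h2
      have hh : ¬ mo.C j w ∧ ¬ mo.C j (par w) := by
        have he' := he
        rw [Sym2.eq_iff] at he'
        rcases he' with ⟨a, b⟩ | ⟨a, b⟩
        · exact ⟨(hl j hj).nzone hw (a ▸ nz1), (hl j hj).nzone hwp (b ▸ nz2)⟩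
        · exact ⟨(hl j hj).nzone hw (b ▸ nz2), (hl j hj).nzone hwp (a ▸ nz1)⟩
      rw [(hl j hj).off w hw hh.1, (hl j hj).off _ hwp hh.2] at he
      exact mo.disj i j hij v w hv h0 hw hw0 h1 h2 hh.1 hh.2 he

theorem compl_all [Nonempty V] {Δ θ W OV1 OV2 : ℕ} (hP : ParArr n Δ par)
    (mo : MainOut H n par I D capJ FL TL)
    (hn4 : 2 * β + FL * (Δ + 1) + OV1 + OV2 ≤ κ)
    (hOV1 : TL < (OV1 + 1) * (θ + 1))
    (hOV2 : 2 * (Fintype.card I * capJ) < (OV2 + 1) * (W + 1))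
    (hg1 : θ + D ≤ g) (hg2 : θ + capJ ≤ g) (hg3 : W + capJ ≤ g')
    (ht : Δ * t ≤ β) (hJb : capJ ≤ β) (hDb : D ≤ β) :
    ∃ φ : I → ℕ → V,
      (∀ i, Set.InjOn (φ i) {v | v < n}) ∧
      (∀ i, ∀ v, v < n → v ≠ 0 → G.Adj (φ i v) (φ i (par v))) ∧
      (∀ i j, i ≠ j → ∀ v w, v < n → v ≠ 0 → w < n → w ≠ 0 →
        s(φ i v, φ i (par v)) ≠ s(φ j w, φ j (par w))) := by
  have key : ∀ I0 : Finset I, ∃ φ : I → ℕ → V, (∀ j ∈ I0, LocalOK mo j (φ j)) ∧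
      ∀ i ∈ I0, ∀ j ∈ I0, i ≠ j → ∀ v w, v < n → v ≠ 0 → w < n → w ≠ 0 →
        s(φ i v, φ i (par v)) ≠ s(φ j w, φ j (par w)) := by
    intro I0
    induction I0 using Finset.induction_on with
    | empty => exact ⟨fun _ _ => Classical.arbitrary V, by simp, by simp⟩
    | insert i I0 hi ih =>
      obtain ⟨φ, h1, h2⟩ := ih
      obtain ⟨f, hf1, hf2⟩ := compl_step hP hn4 hOV1 hOV2 hg1 hg2 hg3 ht hJb hDb I0 φ h1 i hi
      have e1 : (Function.update φ i f) i = f := by simp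
      have e2 : ∀ j ∈ I0, (Function.update φ i f) j = φ j := by
        intro j hj
        rw [Function.update_of_ne]
        rintro rfl
        exact hi hj
      refine ⟨Function.update φ i f, ?_, ?_⟩
      · intro j hj
        rcases Finset.mem_insert.mp hj with rfl | hj
        · rw [e1]; exact hf1
        · rw [e2 j hj]; exact h1 j hj
      · intro a ha b hb hab v w hv hv0 hw hw0
        rcases Finset.mem_insert.mp ha with rfl | ha' <;> rcases Finset.mem_insert.mp hb with rfl | hb'
        · exact absurd rfl hab
        · rw [e1, e2 b hb']
          intro he
          exact hf2 v hv hv0 ⟨b, hb', w, hw, hw0, he⟩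
        · rw [e1, e2 a ha']
          intro he
          exact hf2 w hw hw0 ⟨a, ha', v, hv, hv0, he.symm⟩
        · rw [e2 a ha', e2 b hb']
          exact h2 a ha' b hb' hab v w hv hv0 hw hw0
  obtain ⟨φ, h1, h2⟩ := key Finset.univ
  refine ⟨φ, ?_, ?_, ?_⟩
  · intro i v hv w hw he
    exact (h1 i (Finset.mem_univ _)).inj v w hv hw he
  · intro i v hv h0
    exact (h1 i (Finset.mem_univ _)).adj v hv h0
  · intro i j hij
    exact h2 i (Finset.mem_univ _) j (Finset.mem_univ _) hij

end compl

end PartC2d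

section PartC2e

open scoped Classical

section single
variable {V : Type} [Fintype V] {G : SimpleGraph V} {K Q S : Type} [Fintype Q] [Fintype S]
  [AddCommGroup Q] {R : K → K → ℕ} {fa κ t β g g' : ℕ} {H : Host G K Q S R fa κ t β g g'}
  {n : ℕ} {par : ℕ → ℕ} {σ : K → K} {B capA capF capC capJ : ℕ}
  (pl : Plan n par H.ed σ Q S B capA capF capC capJ) (s : K → Q) (k : K × Q → ℕ)

/-- the slot recursion -/
structure ZRec (z : ℕ → S) : Prop where
  root : ∀ v, v < n → (v = 0 ∨ ¬ pl.P (par v)) → z v = pl.zr v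
  step : ∀ v, pl.NR v → z v = H.col (pl.cl (par v)) (pl.cl v) (shf s (pl.atom (par v))).2
    (shf s (pl.atom v)).2 (k (pl.atom v)) (z (par v))

theorem exists_zrec (hp : ∀ v, v ≠ 0 → par v < v) : ∃ z, ZRec pl s k z := by
  obtain ⟨f, hf0, hf⟩ := exists_rec par hp (pl.zr 0) (fun v z => if pl.NR v then
    H.col (pl.cl (par v)) (pl.cl v) (shf s (pl.atom (par v))).2
    (shf s (pl.atom v)).2 (k (pl.atom v)) z else pl.zr v)
  refine ⟨f, ⟨?_, ?_⟩⟩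
  · intro v hv h
    by_cases h0 : v = 0
    · rw [h0, hf0]
    · rw [hf v h0, if_neg]
      intro hN
      rcases h with h | h
      · exact h0 h
      · exact h hN.2.2.2
  · intro v hv
    rw [hf v hv.2.2.1, if_pos hv]

def phi0 (z : ℕ → S) (v : ℕ) : V := H.mn (pl.cl v) (shf s (pl.atom v)).2 (z v)

variable {pl s k} {z : ℕ → S}

theorem ZRec.inj (hz : ZRec pl s k z) (hp : ∀ v, v ≠ 0 → par v < v) : ∀ v w, v < n → w < n → pl.P v → pl.P w →
    pl.atom v = pl.atom w → z v = z w → v = w := by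
  intro v
  induction v using Nat.strong_induction_on with
  | _ v ih =>
  intro w hv hw hPv hPw hat hzz
  have hcl : pl.cl v = pl.cl w := congrArg Prod.fst hat
  have hpos : pl.pos v = pl.pos w := congrArg Prod.snd hat
  have hh := (pl.homog v w hv hw hPv hPw hcl hpos).2.2
  refine pl.slot v w hv hw hPv hPw hcl hpos ?_
  by_cases hr : v = 0 ∨ ¬ pl.P (par v)
  · rw [← hz.root v hv hr, ← hz.root w hw (hh.mp hr), hzz]
  · have hr' := mt hh.mpr hr
    push Not at hr hr'
    have n1 : pl.NR v := ⟨hv, hPv, hr.1, hr.2⟩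
    have n2 : pl.NR w := ⟨hw, hPw, hr'.1, hr'.2⟩
    have hpa : pl.atom (par v) = pl.atom (par w) := by rw [← pl.pa_atom n1, ← pl.pa_atom n2, hat]
    have hclp : pl.cl (par v) = pl.cl (par w) := congrArg Prod.fst hpa
    rw [hz.step v n1, hz.step w n2, hat, hpa, hclp, hcl] at hzz
    have := (Equiv.injective _) hzz
    have hlt := hp v hr.1
    have hlt2 := hp w hr'.1
    have he := ih (par v) hlt (par w) (hlt.trans hv) (hlt2.trans hw) hr.2 hr'.2 hpa this
    rw [(pl.piece v hv hr.1 hPv hr.2).2, (pl.piece w hw hr'.1 hPw hr'.2).2, he]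

theorem ZRec.phi_inj (hz : ZRec pl s k z) (hp : ∀ v, v ≠ 0 → par v < v) (v w : ℕ) (hv : v < n) (hw : w < n) (hPv : pl.P v)
    (hPw : pl.P w) (he : phi0 pl s z v = phi0 pl s z w) : v = w := by
  obtain ⟨h1, h2, h3⟩ := H.mn_inj _ _ _ _ _ _ he
  refine hz.inj hp v w hv hw hPv hPw ?_ h3
  have h1' : (pl.atom v).1 = (pl.atom w).1 := h1
  unfold shf at h2
  simp only [h1'] at h2
  exact Prod.ext h1' (add_right_cancel h2)

variable (pl s k z)

def RealE (v : ℕ) : Prop := H.real (pl.cl (par v)) (pl.cl v) (shf s (pl.atom (par v))).2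
    (shf s (pl.atom v)).2 (k (pl.atom v)) (z (par v))
def BadE (v : ℕ) : Prop := pl.NR v ∧ ¬ RealE pl s k z v
def BadT (v : ℕ) : Prop := ∃ b, ((H.zone (pl.pcl v) b).filter (fun u => G.Adj (phi0 pl s z v) u)).card < κ
def BadP (p : ℕ) : Prop := ∃ v, v < n ∧ pl.P v ∧ pl.pid v = p ∧ (BadE pl s k z v ∨ BadT pl s z v)
def CC (v : ℕ) : Prop := ¬ pl.P v ∨ BadP pl s k z (pl.pid v)
variable {pl s k z}

theorem ZRec.badE_card (hz : ZRec pl s k z) (hp : ∀ v, v ≠ 0 → par v < v)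
    (hk : ∀ v, pl.NR v → k (pl.atom v) < R (pl.cl (par v)) (pl.cl v)) (c : K) :
    ((Finset.range n).filter (fun v => BadE pl s k z v ∧ pl.pr v = c)).card ≤ capA * fa := by
  refine le_trans ?_ (Nat.mul_le_mul_right fa (pl.capA_le c))
  refine card_le_mul_rel _ _ (fun v A => pl.atom v = A) _ ?_ ?_
  · intro v hv
    rw [Finset.mem_filter] at hv
    refine ⟨_, Finset.mem_image.mpr ⟨v, ?_, rfl⟩, rfl⟩
    rw [Finset.mem_filter]
    exact ⟨hv.1, hv.2.1.1.2.1, hv.2.1.1.2.2.1, hv.2.1.1.2.2.2, hv.2.2⟩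
  · intro A _ X hX
    rcases X.eq_empty_or_nonempty with rfl | ⟨v0, hv0⟩
    · simp
    have h0 := hX v0 hv0
    rw [Finset.mem_filter] at h0
    obtain ⟨⟨_, ⟨h0N, _⟩, _⟩, h0A⟩ := h0
    have h3 := pl.cl_par (pl.edge_P h0N.1 h0N.2.2.1 (Or.inl h0N.2.1))
    have hed : H.ed (pl.cl (par v0)) (pl.cl v0) := by
      rw [h3.1]; exact H.ed_symm _ _ (pl.ed_cl H.ed_symm h0N.1)
    have hrc := H.real_card _ _ hed (shf s (pl.atom (par v0))).2 (shf s (pl.atom v0)).2 _ (hk v0 h0N)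
    have hall : ∀ v ∈ X, v < n ∧ pl.NR v ∧ ¬ RealE pl s k z v ∧ pl.atom v = pl.atom v0 ∧
        pl.atom (par v) = pl.atom (par v0) := by
      intro v hv
      have h := hX v hv
      rw [Finset.mem_filter, Finset.mem_range] at h
      refine ⟨h.1.1, h.1.2.1.1, h.1.2.1.2, h.2.trans h0A.symm, ?_⟩
      rw [← pl.pa_atom h.1.2.1.1, ← pl.pa_atom h0N, h.2, h0A]
    refine le_trans (Finset.card_le_card_of_injOn (fun v => z (par v)) ?_ ?_) hrc
    · intro v hv
      obtain ⟨a1, a2, a3, a4, a5⟩ := hall v hv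
      have b1 : pl.cl v = pl.cl v0 := congrArg Prod.fst a4
      have b2 : pl.cl (par v) = pl.cl (par v0) := congrArg Prod.fst a5
      unfold RealE at a3
      rw [b1, b2, a4, a5] at a3
      simpa using a3
    · intro v hv w hw he
      obtain ⟨a1, a2, a3, a4, a5⟩ := hall v hv
      obtain ⟨d1, d2, d3, d4, d5⟩ := hall w hw
      refine hz.inj hp v w a1 d1 a2.2.1 d2.2.1 (a4.trans d4.symm) ?_
      have b1 : pl.cl v = pl.cl v0 := congrArg Prod.fst a4
      have b2 : pl.cl (par v) = pl.cl (par v0) := congrArg Prod.fst a5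
      have e1 : pl.cl w = pl.cl v0 := congrArg Prod.fst d4
      have e2 : pl.cl (par w) = pl.cl (par v0) := congrArg Prod.fst d5
      simp only at he
      rw [hz.step v a2, hz.step w d2, he, a4, a5, b1, b2, d4, d5, e1, e2]

theorem ZRec.badT_card (hz : ZRec pl s k z) (hp : ∀ v, v ≠ 0 → par v < v) (c : K) :
    ((Finset.range n).filter (fun v => (pl.P v ∧ BadT pl s z v) ∧ pl.pr v = c)).card ≤ 4 * t := by
  have h4 : (Finset.univ : Finset (Bool × Bool)).card = 4 := by decide
  rw [← h4]
  refine card_le_mul_rel _ _ (fun v d => pl.sd v = d.1 ∧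
    ((H.zone (pl.pcl v) d.2).filter (fun u => G.Adj (phi0 pl s z v) u)).card < κ) _ ?_ ?_
  · intro v hv
    rw [Finset.mem_filter] at hv
    obtain ⟨b, hb⟩ := hv.2.1.2
    exact ⟨(pl.sd v, b), Finset.mem_univ _, rfl, hb⟩
  · rintro ⟨d, b⟩ _ X hX
    rcases X.eq_empty_or_nonempty with rfl | ⟨v0, hv0⟩
    · simp
    have hall : ∀ v ∈ X, v < n ∧ pl.P v ∧ pl.cl v = clOf σ c d ∧ pl.pcl v = clOf σ c (!d) ∧
       ((H.zone (pl.pcl v) b).filter (fun u => G.Adj (phi0 pl s z v) u)).card < κ := by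
      intro v hv
      have h := hX v hv
      rw [Finset.mem_filter, Finset.mem_range] at h
      refine ⟨h.1.1, h.1.2.1.1, ?_, ?_, h.2.2⟩
      · unfold Plan.cl; rw [h.1.2.2, h.2.1]
      · unfold Plan.pcl; rw [h.1.2.2, h.2.1]
    obtain ⟨a1, a2, a3, a4, a5⟩ := hall v0 hv0
    have hed : H.ed (clOf σ c d) (clOf σ c (!d)) := by
      rw [← a3, ← a4]; exact pl.ed_cl H.ed_symm a1
    refine le_trans (Finset.card_le_card_of_injOn (fun v => ((shf s (pl.atom v)).2, z v)) ?_ ?_) (H.typ _ _ hed b)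
    · intro v hv
      obtain ⟨a1, a2, a3, a4, a5⟩ := hall v hv
      unfold phi0 at a5
      rw [a3, a4] at a5
      simpa using a5
    · intro v hv w hw he
      obtain ⟨a1, a2, a3, a4, a5⟩ := hall v hv
      obtain ⟨b1, b2, b3, b4, b5⟩ := hall w hw
      refine hz.phi_inj hp v w a1 b1 a2 b2 ?_
      simp only [Prod.mk.injEq] at he
      unfold phi0
      rw [a3, b3, he.1, he.2]

theorem ZRec.C_card (hz : ZRec pl s k z) (hp : ∀ v, v ≠ 0 → par v < v)
    (hk : ∀ v, pl.NR v → k (pl.atom v) < R (pl.cl (par v)) (pl.cl v)) (c : K) :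
    ((Finset.range n).filter (fun v => CC pl s k z v ∧ pl.pr v = c)).card ≤
      capC + (capA * fa + 4 * t) * B := by
  have hbad : (((Finset.range n).filter (fun v => BadE pl s k z v ∧ pl.pr v = c)) ∪
    ((Finset.range n).filter (fun v => (pl.P v ∧ BadT pl s z v) ∧ pl.pr v = c))).card ≤ capA * fa + 4 * t :=
    (Finset.card_union_le _ _).trans (Nat.add_le_add (hz.badE_card hp hk c) (hz.badT_card hp c))
  have h2 : ((Finset.range n).filter (fun v => (pl.P v ∧ BadP pl s k z (pl.pid v)) ∧ pl.pr v = c)).card ≤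
      (capA * fa + 4 * t) * B := by
    refine le_trans ?_ (Nat.mul_le_mul_right B hbad)
    refine card_le_mul_rel _ _ (fun v w => pl.P v ∧ pl.pid v = pl.pid w) _ ?_ ?_
    · intro v hv
      rw [Finset.mem_filter, Finset.mem_range] at hv
      obtain ⟨hvn, ⟨hPv, w, hw, hPw, hpid, hb⟩, hpr⟩ := hv
      have hprw : pl.pr w = c := by
        rw [← hpr]; exact pl.pid_pr w v hw hvn hPw hPv hpid
      refine ⟨w, ?_, hPv, hpid.symm⟩
      rw [Finset.mem_union, Finset.mem_filter, Finset.mem_filter, Finset.mem_range]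
      rcases hb with hb | hb
      · left; exact ⟨hw, hb, hprw⟩
      · right; exact ⟨hw, ⟨hPw, hb⟩, hprw⟩
    · intro w _ X hX
      refine le_trans (Finset.card_le_card ?_) (pl.pid_card (pl.pid w))
      intro v hv
      have h := hX v hv
      rw [Finset.mem_filter] at h
      rw [Finset.mem_filter]
      exact ⟨h.1.1, h.2⟩
  refine le_trans (Finset.card_le_card ?_) ((Finset.card_union_le _ _).trans (Nat.add_le_add (pl.capC_le c) h2))
  intro v hv
  rw [Finset.mem_filter] at hv
  rw [Finset.mem_union, Finset.mem_filter, Finset.mem_filter]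
  by_cases hPv : pl.P v
  · right
    refine ⟨hv.1, ⟨hPv, ?_⟩, hv.2.2⟩
    rcases hv.2.1 with h | h
    · exact absurd hPv h
    · exact h
  · left; exact ⟨hv.1, hPv, hv.2.2⟩


/-- a good vertex adjacent to a `CC` vertex: the latter is not placed -/
theorem CC_nbr {x y : ℕ} (hx : x < n) (hy : y < n) (hxC : CC pl s k z x)
    (hyC : ¬ CC pl s k z y) (hn : nbr par x y) : ¬ pl.P x ∧ pl.P y := by
  unfold CC at hyC
  push Not at hyC
  refine ⟨fun hPx => ?_, hyC.1⟩
  rcases hxC with h | h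
  · exact h hPx
  · apply hyC.2
    rcases hn with ⟨h0, h1⟩ | ⟨h0, h1⟩
    · rw [(pl.piece y hy h0 hyC.1 (h1 ▸ hPx)).1, h1]; exact h
    · rw [← h1, ← (pl.piece x hx h0 hPx (h1 ▸ hyC.1)).1]; exact h

end single

end PartC2e

section PartC2f

open scoped Classical

section fat
variable {K Q S : Type} {n : ℕ} {par : ℕ → ℕ} {B capA capF capC capJ : ℕ}

/-- atoms meeting unplaced vertices -/
noncomputable def FAt {ed : K → K → Prop} {σ : K → K} (p : Plan n par ed σ Q S B capA capF capC capJ) (c c' : K) : Finset (K × Q) :=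
  ((Finset.range n).filter (fun y => p.P y ∧ (∃ x, x < n ∧ ¬ p.P x ∧ nbr par x y) ∧
    p.cl y = c ∧ p.pcl y = c')).image p.atom

theorem FAt_card {ed : K → K → Prop} {σ : K → K} (p : Plan n par ed σ Q S B capA capF capC capJ) (c c' : K) :
    (FAt p c c').card ≤ capF * cnt σ c c' := by
  have hsub : FAt p c c' ⊆
      (if σ c = c' then (((Finset.range n).filter (fun v => p.P v ∧ p.pr v = c ∧ ∃ x, x < n ∧ ¬ p.P x ∧
    ((v ≠ 0 ∧ par v = x) ∨ (x ≠ 0 ∧ par x = v)))).image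
    (fun v => (clOf σ (p.pr v) (p.sd v), p.pos v))) else ∅) ∪
      (if σ c' = c then (((Finset.range n).filter (fun v => p.P v ∧ p.pr v = c' ∧ ∃ x, x < n ∧ ¬ p.P x ∧
    ((v ≠ 0 ∧ par v = x) ∨ (x ≠ 0 ∧ par x = v)))).image
    (fun v => (clOf σ (p.pr v) (p.sd v), p.pos v))) else ∅) := by
    intro A hA
    unfold FAt at hA
    rw [Finset.mem_image] at hA
    obtain ⟨v, hv, rfl⟩ := hA
    rw [Finset.mem_filter] at hv
    obtain ⟨h1, h2, h3, h4, h5⟩ := hv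
    rw [Finset.mem_union]
    rcases p.pair_pr h4 h5 with ⟨a, b⟩ | ⟨a, b⟩
    · left; rw [if_pos b, Finset.mem_image]
      exact ⟨v, by simp only [Finset.mem_filter]; exact ⟨h1, h2, a, h3⟩, rfl⟩
    · right; rw [if_pos b, Finset.mem_image]
      exact ⟨v, by simp only [Finset.mem_filter]; exact ⟨h1, h2, a, h3⟩, rfl⟩
  refine (Finset.card_le_card hsub).trans ((Finset.card_union_le _ _).trans ?_)
  have h1 := p.capF_le c
  have h2 := p.capF_le c'
  unfold cnt
  split_ifs <;> (try simp only [Finset.card_empty]) <;> omega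

end fat

section main
variable {V : Type} [Fintype V] {G : SimpleGraph V} {K Q S : Type} [Fintype K] [Fintype Q] [Fintype S]
  [AddCommGroup Q] {R : K → K → ℕ} {fa κ t β g g' : ℕ} (H : Host G K Q S R fa κ t β g g')
  {n : ℕ} {par : ℕ → ℕ} {Sg : Type} [Fintype Sg] (sig : Sg → K → K) (N : Sg → ℕ)
  {B capA capF capC capJ : ℕ}

theorem exists_mainOut (pl : ∀ j, Plan n par H.ed (sig j) Q S B capA capF capC capJ) {Δ FL TL : ℕ} (hP : ParArr n Δ par)
    (hR : ∀ c c', H.ed c c' → capA * Fintype.card Q ^ (Fintype.card K - 2) * ∑ j, N j * cnt (sig j) c c' ≤ R c c')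
    (hF : ∀ c c', H.ed c c' → capF * Fintype.card Q ^ (Fintype.card K - 1) * ∑ j, N j * cnt (sig j) c c' ≤ FL)
    (hT : ∀ c c', H.ed c c' → (capC + (capA * fa + 4 * t) * B) *
      (Fintype.card Q ^ (Fintype.card K) * ∑ j, N j * cnt (sig j) c c') +
      Fintype.card (Idx K Q N) * capJ ≤ TL) :
    Nonempty (MainOut H n par (Idx K Q N) (2 * (capC + (capA * fa + 4 * t) * B)) capJ FL TL) := by
  obtain ⟨kc, hk1, hk2⟩ := exists_colours H sig N pl hR
  have hzz : ∀ i : Idx K Q N, ∃ z, ZRec (pl i.1) i.2.1 (kc i) z := fun i => exists_zrec _ _ _ hP.lt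
  choose z hz using hzz
  have hCC : ∀ (i : Idx K Q N) v, ¬ CC (pl i.1) i.2.1 (kc i) (z i) v → (pl i.1).P v := by
    intro i v h; by_contra hh; exact h (Or.inl hh)
  have hreal : ∀ (i : Idx K Q N) v, v < n → v ≠ 0 → ¬ CC (pl i.1) i.2.1 (kc i) (z i) v → ¬ CC (pl i.1) i.2.1 (kc i) (z i) (par v) →
      (pl i.1).NR v ∧ RealE (pl i.1) i.2.1 (kc i) (z i) v := by
    intro i v hv h0 h1 h2
    have hN : (pl i.1).NR v := ⟨hv, hCC i v h1, h0, hCC i _ h2⟩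
    refine ⟨hN, ?_⟩
    by_contra hh
    exact h1 (Or.inr ⟨v, hv, hN.2.1, rfl, Or.inl ⟨hN, hh⟩⟩)
  have hedp : ∀ (i : Idx K Q N) v, (pl i.1).NR v → H.ed ((pl i.1).cl (par v)) ((pl i.1).cl v) := by
    intro i v hv
    have h3 := (pl i.1).cl_par ((pl i.1).edge_P hv.1 hv.2.2.1 (Or.inl hv.2.1))
    rw [h3.1]; exact H.ed_symm _ _ ((pl i.1).ed_cl H.ed_symm hv.1)
  have hCcard : ∀ (i : Idx K Q N) c, ((Finset.range n).filter (fun v => CC (pl i.1) i.2.1 (kc i) (z i) v ∧ (pl i.1).pr v = c)).card ≤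
      capC + (capA * fa + 4 * t) * B := fun i c => (hz i).C_card hP.lt (hk1 i) c
  refine ⟨{
    C := fun i v => CC (pl i.1) i.2.1 (kc i) (z i) v
    J := fun i v => decide ((pl i.1).J v)
    cl := fun i v => (pl i.1).cl v
    pcl := fun i v => (pl i.1).pcl v
    φ0 := fun i v => phi0 (pl i.1) i.2.1 (z i) v
    J_C := ?_
    inj := ?_
    nz := ?_
    adj := ?_
    disj := ?_
    ed := ?_
    edge := ?_
    typ := ?_
    one_nbr := ?_
    capD := ?_
    capJ_le := ?_
    load1 := ?_
    load2 := ?_ }⟩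
  · intro i v h
    exact Or.inl ((pl i.1).JP v (by simpa using h))
  · intro i v w hv hw h1 h2 he
    exact (hz i).phi_inj hP.lt v w hv hw (hCC i v h1) (hCC i w h2) he
  · intro i v hv h c b
    exact H.mn_zone _ _ _ _ _
  · intro i v hv h0 h1 h2
    obtain ⟨hN, hr⟩ := hreal i v hv h0 h1 h2
    have := H.real_adj _ _ (hedp i v hN) _ _ _ _ (hk1 i v hN) hr
    rw [← (hz i).step v hN] at this
    exact this.symm
  · intro i j hij v w hv hv0 hw hw0 h1 h2 h3 h4 he
    obtain ⟨hN, hr⟩ := hreal i v hv hv0 h1 h2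
    obtain ⟨hN', hr'⟩ := hreal j w hw hw0 h3 h4
    have hki := hk1 i v hN
    have hkj := hk1 j w hN'
    have hed := hedp i v hN
    have hed' := hedp j w hN'
    unfold RealE at hr hr'
    have hs1 := (hz i).step v hN
    have hs2 := (hz j).step w hN'
    have he' := he
    rw [Sym2.eq_iff] at he
    have toatom : ∀ a b, phi0 (pl i.1) i.2.1 (z i) a = phi0 (pl j.1) j.2.1 (z j) b →
        shf i.2.1 ((pl i.1).atom a) = shf j.2.1 ((pl j.1).atom b) ∧ z i a = z j b ∧
        (pl i.1).cl a = (pl j.1).cl b := by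
      intro a b hab
      obtain ⟨x1, x2, x3⟩ := H.mn_inj _ _ _ _ _ _ hab
      exact ⟨Prod.ext x1 x2, x3, x1⟩
    rcases he with ⟨a, b⟩ | ⟨a, b⟩
    · obtain ⟨a1, a2, a3⟩ := toatom _ _ a
      obtain ⟨b1, b2, b3⟩ := toatom _ _ b
      refine hk2 i j v w hN hN' hij (by rw [a1, b1]) ?_
      rw [← b3, ← a3, ← a1, ← b1, ← b2] at hr' hs2
      rw [← b3, ← a3] at hkj
      rw [← a3, ← b3] at hed'
      refine H.real_uniq _ _ hed _ _ _ _ _ hki hkj hr hr' ?_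
      rw [← hs1, ← hs2, a2]
    · obtain ⟨a1, a2, a3⟩ := toatom _ _ a
      obtain ⟨b1, b2, b3⟩ := toatom _ _ b
      refine hk2 i j v w hN hN' hij (by rw [a1, b1, Sym2.eq_swap]) ?_
      rw [← b3, ← a3, ← a1, ← b1, ← a2] at hr' hs2
      rw [← b3, ← a3] at hkj
      rw [← a3, ← b3] at hed'
      have hr2 := H.real_symm _ _ hed' _ _ _ _ hr'
      have hc2 := H.col_symm _ _ hed' (shf i.2.1 ((pl i.1).atom v)).2 (shf i.2.1 ((pl i.1).atom (par v))).2
        (kc j ((pl j.1).atom w)) (z i v)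
      rw [← hs2, ← b2] at hr2 hc2
      rw [H.R_symm] at hkj
      refine H.real_uniq _ _ hed _ _ _ _ _ hki hkj hr hr2 ?_
      rw [← hs1, hc2]
  · intro i v hv
    exact (pl i.1).ed_cl H.ed_symm hv
  · intro i v hv h0
    rcases (pl i.1).edge v hv h0 with h | h
    · left; exact (pl i.1).cl_par h
    · right; simpa using h
  · intro i y b hy hC
    by_contra hh
    push Not at hh
    exact hC (Or.inr ⟨y, hy, hCC i y hC, rfl, Or.inr ⟨b, hh⟩⟩)
  · intro i x y w hx hy hw hxC hyC hwC hxy hxw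
    have h1 := CC_nbr hx hy hxC hyC hxy
    have h2 := CC_nbr hx hw hxC hwC hxw
    exact (pl i.1).one_nbr x y w hx hy hw h1.1 h1.2 h2.2 hxy hxw
  · intro i c
    have hsub : ∃ c1 c2, ∀ v, v < n → (pl i.1).cl v = c → (pl i.1).pr v = c1 ∨ (pl i.1).pr v = c2 := by
      by_cases hc : ∃ c2, sig i.1 c2 = c
      · obtain ⟨c2, hc2⟩ := hc
        refine ⟨c, c2, ?_⟩
        intro v hv hcl
        rcases (pl i.1).pair_cases v with ⟨a, b⟩ | ⟨a, b⟩
        · left; rw [← a, hcl]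
        · right; apply (pl i.1).inj; rw [← a, hcl, hc2]
      · refine ⟨c, c, ?_⟩
        intro v hv hcl
        rcases (pl i.1).pair_cases v with ⟨a, b⟩ | ⟨a, b⟩
        · left; rw [← a, hcl]
        · exact absurd ⟨_, a.symm.trans hcl⟩ hc
    obtain ⟨c1, c2, h12⟩ := hsub
    rw [two_mul]
    refine le_trans (Finset.card_le_card ?_) ((Finset.card_union_le _ _).trans (Nat.add_le_add (hCcard i c1) (hCcard i c2)))
    intro v hv
    rw [Finset.mem_filter, Finset.mem_range] at hv
    rw [Finset.mem_union, Finset.mem_filter, Finset.mem_filter, Finset.mem_range]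
    rcases h12 v hv.1 hv.2.2 with h | h
    · left; exact ⟨hv.1, hv.2.1, h⟩
    · right; exact ⟨hv.1, hv.2.1, h⟩
  · intro i
    refine le_trans (Finset.card_le_card ?_) (pl i.1).capJ_le
    intro v hv
    simpa using hv
  · intro u c'
    rcases (Finset.univ.filter (fun i : Idx K Q N => ∃ y, y < n ∧ ¬ CC (pl i.1) i.2.1 (kc i) (z i) y ∧
      phi0 (pl i.1) i.2.1 (z i) y = u ∧ (pl i.1).pcl y = c' ∧
      ∃ x, x < n ∧ CC (pl i.1) i.2.1 (kc i) (z i) x ∧ nbr par x y)).eq_empty_or_nonempty with h | ⟨i0, hi0⟩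
    · rw [h]; simp
    rw [Finset.mem_filter] at hi0
    obtain ⟨_, y0, hy0, hyC0, hu0, hpc0, -⟩ := hi0
    set c := (pl i0.1).cl y0 with hc
    set X := (shf i0.2.1 ((pl i0.1).atom y0)).2 with hX
    have hed : H.ed c c' := by rw [← hpc0]; exact (pl i0.1).ed_cl H.ed_symm hy0
    refine le_trans ?_ (hF c c' hed)
    calc _ ≤ ∑ i : Idx K Q N, ((FAt (pl i.1) c c').filter (fun A => shf i.2.1 A = (c, X))).card := by
          rw [Finset.card_filter]
          refine Finset.sum_le_sum fun i _ => ?_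
          split_ifs with h
          · obtain ⟨y, hy, hyC, hu, hpc, x, hx, hxC, hxy⟩ := h
            rw [Nat.succ_le_iff, Finset.card_pos]
            rw [← hu0] at hu
            obtain ⟨x1, x2, x3⟩ := H.mn_inj _ _ _ _ _ _ hu
            refine ⟨(pl i.1).atom y, ?_⟩
            rw [Finset.mem_filter]
            refine ⟨?_, Prod.ext x1 x2⟩
            unfold FAt
            rw [Finset.mem_image]
            refine ⟨y, ?_, rfl⟩
            rw [Finset.mem_filter, Finset.mem_range]
            have := CC_nbr hx hy hxC hyC hxy
            exact ⟨hy, this.2, ⟨x, hx, this.1, hxy⟩, x1, hpc⟩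
          · exact Nat.zero_le _
      _ = ∑ j, N j * ∑ s : K → Q, ((FAt (pl j) c c').filter (fun A => shf s A = (c, X))).card :=
          sum_idx N (fun j s => ((FAt (pl j) c c').filter (fun A => shf s A = (c, X))).card)
      _ ≤ ∑ j, N j * (Fintype.card Q ^ (Fintype.card K - 1) * (capF * cnt (sig j) c c')) := by
          refine Finset.sum_le_sum fun j _ => Nat.mul_le_mul_left _ ?_
          simp_rw [Finset.card_filter]
          rw [Finset.sum_comm]
          calc _ ≤ ∑ A ∈ FAt (pl j) c c', Fintype.card Q ^ (Fintype.card K - 1) := by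
                refine Finset.sum_le_sum fun A hA => ?_
                rw [← Finset.card_filter, ← card_shift1 c (X - A.2)]
                refine Finset.card_le_card ?_
                intro s hs
                rw [Finset.mem_filter] at hs ⊢
                have h1 := hs.2
                unfold shf at h1
                rw [Prod.mk.injEq] at h1
                refine ⟨Finset.mem_univ _, ?_⟩
                rw [← h1.2, h1.1]; simp
            _ ≤ _ := by
                rw [Finset.sum_const, smul_eq_mul, mul_comm]
                exact Nat.mul_le_mul_left _ (FAt_card _ _ _)
      _ = _ := by
          rw [Finset.mul_sum]
          refine Finset.sum_congr rfl fun j _ => by ring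
  · intro c c' hed
    refine le_trans ?_ (hT c c' hed)
    calc _ ≤ ∑ i : Idx K Q N, ((capC + (capA * fa + 4 * t) * B) * cnt (sig i.1) c c' + capJ) := by
          refine Finset.sum_le_sum fun i _ => ?_
          have hsub : ((Finset.range n).filter (fun v => v ≠ 0 ∧ CC (pl i.1) i.2.1 (kc i) (z i) v ∧
              CC (pl i.1) i.2.1 (kc i) (z i) (par v) ∧ s((pl i.1).cl v, (pl i.1).cl (par v)) = s(c, c'))) ⊆
            ((if sig i.1 c = c' then ((Finset.range n).filter (fun v => CC (pl i.1) i.2.1 (kc i) (z i) v ∧ (pl i.1).pr v = c)) else ∅) ∪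
            (if sig i.1 c' = c then ((Finset.range n).filter (fun v => CC (pl i.1) i.2.1 (kc i) (z i) v ∧ (pl i.1).pr v = c')) else ∅)) ∪
            (Finset.range n).filter (fun v => (pl i.1).J v) := by
            intro v hv
            rw [Finset.mem_filter, Finset.mem_range] at hv
            obtain ⟨hvn, hv0, hC1, hC2, hs⟩ := hv
            rw [Finset.mem_union, Finset.mem_union]
            rcases (pl i.1).edge v hvn hv0 with h | h
            · left
              have h3 := (pl i.1).cl_par h
              rw [h3.1] at hs
              have h5 : ((pl i.1).pr v = c ∧ sig i.1 c = c') ∨ ((pl i.1).pr v = c' ∧ sig i.1 c' = c) := by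
                rw [Sym2.eq_iff] at hs
                rcases hs with ⟨a, b⟩ | ⟨a, b⟩
                · exact (pl i.1).pair_pr a b
                · exact ((pl i.1).pair_pr a b).symm
              rcases h5 with ⟨a, b⟩ | ⟨a, b⟩
              · left; rw [if_pos b, Finset.mem_filter, Finset.mem_range]; exact ⟨hvn, hC1, a⟩
              · right; rw [if_pos b, Finset.mem_filter, Finset.mem_range]; exact ⟨hvn, hC1, a⟩
            · right
              rw [Finset.mem_filter, Finset.mem_range]; exact ⟨hvn, h.1⟩
          refine (Finset.card_le_card hsub).trans ((Finset.card_union_le _ _).trans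
            (Nat.add_le_add ((Finset.card_union_le _ _).trans ?_) (pl i.1).capJ_le))
          have h1 := hCcard i c
          have h2 := hCcard i c'
          unfold cnt
          rw [mul_add]
          refine Nat.add_le_add ?_ ?_
          · split_ifs
            · rw [mul_one]; exact h1
            · simp
          · split_ifs
            · rw [mul_one]; exact h2
            · simp
      _ = _ := by
          rw [Finset.sum_add_distrib, sum_idx N (fun j s => (capC + (capA * fa + 4 * t) * B) * cnt (sig j) c c')]
          congr 1
          · rw [Finset.mul_sum, Finset.mul_sum]
            refine Finset.sum_congr rfl fun j _ => ?_
            rw [Finset.sum_const, Finset.card_univ, Fintype.card_fun, smul_eq_mul]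
            ring
          · rw [Finset.sum_const, Finset.card_univ, smul_eq_mul]

end main

end PartC2f

section PartA4a

open scoped Classical

theorem exists_bins {ι K : Type*} (G : Finset K) (hG : G.Nonempty) (w : ι → ℕ) (mx : ℕ) (X : Finset ι)
    (hw : ∀ l ∈ X, w l ≤ mx) :
    ∃ f : ι → K, (∀ l, f l ∈ G) ∧
      ∀ c, G.card * ∑ l ∈ X.filter (fun l => f l = c), w l ≤ ∑ l ∈ X, w l + G.card * mx := by
  induction X using Finset.induction_on with
  | empty =>
    obtain ⟨c, hc⟩ := hG
    exact ⟨fun _ => c, fun _ => hc, by simp⟩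
  | insert i X hi ih =>
    obtain ⟨f, hf1, hf2⟩ := ih (fun l hl => hw l (Finset.mem_insert_of_mem hl))
    obtain ⟨c0, hc0, hmin⟩ := G.exists_min_image (fun c => ∑ l ∈ X.filter (fun l => f l = c), w l) hG
    have hsum : ∑ c ∈ G, ∑ l ∈ X.filter (fun l => f l = c), w l = ∑ l ∈ X, w l :=
      Finset.sum_fiberwise_of_maps_to (fun l _ => hf1 l) w
    have hle : G.card * ∑ l ∈ X.filter (fun l => f l = c0), w l ≤ ∑ l ∈ X, w l := by
      rw [← hsum, ← smul_eq_mul]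
      exact Finset.card_nsmul_le_sum _ _ _ (fun c hc => hmin c hc)
    refine ⟨Function.update f i c0, ?_, ?_⟩
    · intro l
      by_cases hl : l = i
      · subst hl; simpa using hc0
      · rw [Function.update_of_ne hl]; exact hf1 l
    · intro c
      have hX : ∀ l ∈ X, Function.update f i c0 l = f l := by
        intro l hl
        rw [Function.update_of_ne]
        rintro rfl; exact hi hl
      have hfil : X.filter (fun l => Function.update f i c0 l = c) = X.filter (fun l => f l = c) :=
        Finset.filter_congr (fun l hl => by rw [hX l hl])
      rw [Finset.filter_insert, Finset.sum_insert hi, hfil]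
      have hwi := hw i (Finset.mem_insert_self _ _)
      split_ifs with h
      · simp only [Function.update_self] at h
        subst h
        rw [Finset.sum_insert (by simp [hi]), mul_add]
        have := Nat.mul_le_mul_left G.card hwi
        omega
      · have := hf2 c
        omega

theorem exists_balance {ι : Type*} (x y : ι → ℕ) (mx : ℕ) (X : Finset ι)
    (hw : ∀ l ∈ X, x l + y l ≤ mx) :
    ∃ o : ι → Bool, ∑ l ∈ X, (if o l then x l else y l) ≤ ∑ l ∈ X, (if o l then y l else x l) + mx ∧
      ∑ l ∈ X, (if o l then y l else x l) ≤ ∑ l ∈ X, (if o l then x l else y l) + mx := by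
  induction X using Finset.induction_on with
  | empty => exact ⟨fun _ => true, by simp⟩
  | insert i X hi ih =>
    obtain ⟨o, h1, h2⟩ := ih (fun l hl => hw l (Finset.mem_insert_of_mem hl))
    have hwi := hw i (Finset.mem_insert_self _ _)
    have key : ∀ b : Bool, (∑ l ∈ insert i X, (if Function.update o i b l then x l else y l) =
        (if b then x i else y i) + ∑ l ∈ X, (if o l then x l else y l)) ∧
        (∑ l ∈ insert i X, (if Function.update o i b l then y l else x l) =
        (if b then y i else x i) + ∑ l ∈ X, (if o l then y l else x l)) := by
      intro b
      have hX : ∀ l ∈ X, Function.update o i b l = o l := by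
        intro l hl
        rw [Function.update_of_ne]
        rintro rfl; exact hi hl
      constructor
      · rw [Finset.sum_insert hi]
        simp only [Function.update_self]
        congr 1
        exact Finset.sum_congr rfl (fun l hl => by rw [hX l hl])
      · rw [Finset.sum_insert hi]
        simp only [Function.update_self]
        congr 1
        exact Finset.sum_congr rfl (fun l hl => by rw [hX l hl])
    set A := ∑ l ∈ X, (if o l then x l else y l)
    set A' := ∑ l ∈ X, (if o l then y l else x l)
    by_cases hc : (A ≤ A') ↔ (y i ≤ x i)
    · refine ⟨Function.update o i true, ?_⟩
      rw [(key true).1, (key true).2]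
      simp only [if_true]
      by_cases h : A ≤ A' <;> have := hc <;> simp only [h, true_iff, false_iff] at this <;> constructor <;> omega
    · refine ⟨Function.update o i false, ?_⟩
      rw [(key false).1, (key false).2]
      simp only [Bool.false_eq_true, if_false]
      by_cases h : A ≤ A' <;> have := hc <;> simp only [h, true_iff, false_iff] at this <;> constructor <;> omega

theorem exists_groups {D E : Type*} (s : Finset D) (key : D → E) (a : ℕ) (ha : 0 < a) :
    ∃ (tup : D → ℕ) (slot : D → Fin a) (kept : D → Prop),
      (∀ d ∈ s, ∀ d' ∈ s, key d = key d' → tup d = tup d' → slot d = slot d' → d = d') ∧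
      (∀ d ∈ s, ∀ d' ∈ s, key d = key d' → tup d = tup d' → kept d → kept d') ∧
      (∀ d ∈ s, kept d → a ≤ (s.filter (fun d' => key d' = key d ∧ tup d' = tup d)).card) ∧
      (∀ e, (s.filter (fun d => key d = e ∧ ¬ kept d)).card ≤ a) := by
  obtain ⟨k, hk1, hk2⟩ := exists_rank s key
  have hsurj : ∀ d ∈ s, ∀ r, r < (s.filter (fun d' => key d' = key d)).card → ∃ d' ∈ s, key d' = key d ∧ k d' = r := by
    intro d hd r hr
    have himg : (s.filter (fun d' => key d' = key d)).image k = Finset.range (s.filter (fun d' => key d' = key d)).card := by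
      apply Finset.eq_of_subset_of_card_le
      · intro x hx
        obtain ⟨d', hd', rfl⟩ := Finset.mem_image.mp hx
        rw [Finset.mem_filter] at hd'
        have := hk1 d' hd'.1
        rw [hd'.2] at this
        exact Finset.mem_range.mpr this
      · rw [Finset.card_range, Finset.card_image_of_injOn]
        intro x hx y hy hxy
        have hx' := Finset.mem_filter.mp hx
        have hy' := Finset.mem_filter.mp hy
        exact hk2 x hx'.1 y hy'.1 (hx'.2.trans hy'.2.symm) hxy
    have : r ∈ (s.filter (fun d' => key d' = key d)).image k := by rw [himg]; simpa using hr
    obtain ⟨d', hd', rfl⟩ := Finset.mem_image.mp this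
    rw [Finset.mem_filter] at hd'
    exact ⟨d', hd'.1, hd'.2, rfl⟩
  obtain ⟨kept, hkept⟩ : ∃ kept : D → Prop, ∀ d, kept d ↔ (k d / a + 1) * a ≤ (s.filter (fun d' => key d' = key d)).card :=
    ⟨_, fun _ => Iff.rfl⟩
  refine ⟨fun d => k d / a, fun d => ⟨k d % a, Nat.mod_lt _ ha⟩, kept, ?_, ?_, ?_, ?_⟩
  · intro d hd d' hd' h1 h2 h3
    refine hk2 d hd d' hd' h1 ?_
    simp only [Fin.mk.injEq] at h3
    have h2' : k d / a = k d' / a := h2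
    rw [← Nat.div_add_mod (k d) a, ← Nat.div_add_mod (k d') a, h2', h3]
  · intro d hd d' hd' h1 h2 h3
    have h2' : k d / a = k d' / a := h2
    rw [hkept] at h3 ⊢
    rw [← h2', ← h1]; exact h3
  · intro d hd h
    rw [hkept] at h
    have : Finset.Ico (k d / a * a) ((k d / a + 1) * a) ⊆
        (s.filter (fun d' => key d' = key d ∧ k d' / a = k d / a)).image k := by
      intro r hr
      rw [Finset.mem_Ico] at hr
      obtain ⟨d', hd', e1, e2⟩ := hsurj d hd r (lt_of_lt_of_le hr.2 h)
      rw [Finset.mem_image]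
      refine ⟨d', Finset.mem_filter.mpr ⟨hd', e1, ?_⟩, e2⟩
      rw [e2, Nat.div_eq_iff ha]
      rw [Nat.add_mul] at hr
      constructor <;> omega
    have h2 := (Finset.card_le_card this).trans Finset.card_image_le
    rw [Nat.card_Ico, Nat.add_mul] at h2
    simp only
    omega
  · intro e
    rcases (s.filter (fun d => key d = e ∧ ¬ kept d)).eq_empty_or_nonempty with h | ⟨d0, hd0⟩
    · rw [h]; simp
    set c := (s.filter (fun d' => key d' = e)).card with hc
    have : (s.filter (fun d => key d = e ∧ ¬ kept d)).image k ⊆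
        Finset.Ico (c - a) c := by
      intro r hr
      obtain ⟨d, hd, rfl⟩ := Finset.mem_image.mp hr
      rw [Finset.mem_filter] at hd
      obtain ⟨h1, h2, h3⟩ := hd
      have h4 := hk1 d h1
      rw [hkept] at h3
      rw [h2, ← hc] at h3 h4
      rw [Finset.mem_Ico]
      refine ⟨?_, h4⟩
      rw [Nat.add_mul] at h3
      have := Nat.div_mul_le_self (k d) a
      omega
    have h5 := Finset.card_le_card this
    rw [Finset.card_image_of_injOn, Nat.card_Ico] at h5
    · omega
    · intro x hx y hy hxy
      have hx' := Finset.mem_filter.mp hx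
      have hy' := Finset.mem_filter.mp hy
      exact hk2 x hx'.1 y hy'.1 (hx'.2.1.trans hy'.2.1.symm) hxy

theorem exists_injOn_of_card_le {A Q : Type*} [Fintype Q] [Nonempty Q] (X : Finset A) (h : X.card ≤ Fintype.card Q) :
    ∃ f : A → Q, Set.InjOn f (X : Set A) := by
  have : Nonempty (X ↪ Q) := Function.Embedding.nonempty_of_card_le (by simpa using h)
  obtain ⟨e⟩ := this
  refine ⟨fun x => if hx : x ∈ X then e ⟨x, hx⟩ else Classical.arbitrary Q, ?_⟩
  intro x hx y hy hxy
  have hx' : x ∈ X := hx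
  have hy' : y ∈ X := hy
  simp only [hx', hy', dif_pos] at hxy
  simpa using e.injective hxy

end PartA4a

section PartA4b

open scoped Classical

theorem plan_pre {n Δ : ℕ} {par : ℕ → ℕ} (hP : ParArr n Δ par) (hn : 0 < n) (s : ℕ) (hs : 1 ≤ s)
    (C : ℕ → Prop) {K : Type} (Gd : Finset K) (hGd : Gd.Nonempty) (Λ L load : ℕ)  (hL : 0 < L)
    (hC : L * ((Finset.range n).filter (fun v => C v)).card ≤ n * (Δ + 1))
    (hload : n * L + Λ * (n * (Δ + 1)) + Gd.card * L * ((1 + Λ) * ((Δ + 1) * s)) ≤ Gd.card * L * load) :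
    ∃ (J : ℕ → Prop) (pr : ℕ → K) (sd : ℕ → Bool), (∀ v, pr v ∈ Gd) ∧
      (∀ v, v < n → v ≠ 0 → (pr v = pr (par v) ∧ sd v ≠ sd (par v)) ∨ (J v ∧ J (par v))) ∧
      ((Finset.range n).filter (fun v => J v)).card ≤ 2 * (n / s) ∧
      (∀ c, ((Finset.range n).filter (fun v => pr v = c)).card ≤ load) ∧
      (∀ c, Λ * ((Finset.range n).filter (fun v => C v ∧ pr v = c)).card ≤ load) ∧
      (∀ c b, 2 * ((Finset.range n).filter (fun v => pr v = c ∧ sd v = b)).card ≤ load + (Δ + 1) * s) := by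
  obtain ⟨F, comp, hF1, hF2, hF3, hc0, hcF, hcN, hcm, hcard⟩ := exists_cuts hP s hs hn
  obtain ⟨dp, hdp0, hdp⟩ := exists_rec par hP.lt false (fun _ p => !p)
  set X := insert 0 F with hX
  set mx := (Δ + 1) * s with hmx
  have hfib : ∀ (p : ℕ → Prop) (Y : Finset ℕ), ∑ l ∈ Y, ((Finset.range n).filter (fun v => comp v = l ∧ p v)).card =
      ((Finset.range n).filter (fun v => comp v ∈ Y ∧ p v)).card := by
    intro p Y
    rw [Finset.card_eq_sum_card_fiberwise (f := comp) (t := Y)]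
    · refine Finset.sum_congr rfl (fun l hl => ?_)
      congr 1
      ext v
      simp only [Finset.mem_filter, Finset.mem_range]
      constructor
      · rintro ⟨h1, h2, h3⟩; exact ⟨⟨h1, h2 ▸ hl, h3⟩, h2⟩
      · rintro ⟨⟨h1, h2, h3⟩, h4⟩; exact ⟨h1, h4, h3⟩
    · intro v hv
      simp only [Finset.coe_filter, Finset.mem_range] at hv
      exact hv.2.1
  have hle : ∀ (p : ℕ → Prop) l, ((Finset.range n).filter (fun v => comp v = l ∧ p v)).card ≤ mx := by
    intro p l
    refine (Finset.card_le_card ?_).trans (hcard l)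
    intro v; simp only [Finset.mem_filter]; tauto
  obtain ⟨T0, hT0⟩ : ∃ T0 : ℕ → Prop, ∀ v, T0 v := ⟨fun _ => True, fun _ => trivial⟩
  obtain ⟨Dt, hDt⟩ : ∃ Dt : ℕ → Prop, ∀ v, Dt v ↔ dp v = true := ⟨_, fun _ => Iff.rfl⟩
  obtain ⟨Df, hDf⟩ : ∃ Df : ℕ → Prop, ∀ v, Df v ↔ dp v = false := ⟨_, fun _ => Iff.rfl⟩
  obtain ⟨f, hf1, hf2⟩ := exists_bins Gd hGd (fun l => ((Finset.range n).filter (fun v => comp v = l ∧ T0 v)).card +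
    Λ * ((Finset.range n).filter (fun v => comp v = l ∧ C v)).card) ((1 + Λ) * mx) X (by
      intro l _
      have h1 := hle T0 l
      have h2 := Nat.mul_le_mul_left Λ (hle C l)
      rw [add_mul, one_mul]
      exact Nat.add_le_add h1 h2)
  have hbal : ∀ c, ∃ o : ℕ → Bool, _ := fun c => exists_balance
    (fun l => ((Finset.range n).filter (fun v => comp v = l ∧ Dt v)).card)
    (fun l => ((Finset.range n).filter (fun v => comp v = l ∧ Df v)).card) mx (X.filter (fun l => f l = c)) (by
      intro l _
      rw [← Finset.card_union_of_disjoint]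
      · refine (Finset.card_le_card ?_).trans (hcard l)
        intro v; simp only [Finset.mem_filter, Finset.mem_union]; tauto
      · rw [Finset.disjoint_left]; intro v; simp only [Finset.mem_filter]
        rintro ⟨_, _, h⟩ ⟨_, _, h'⟩; rw [hDt] at h; rw [hDf, h] at h'; cases h')
  choose o ho1 ho2 using hbal
  -- loads
  have hld : ∀ c, ((Finset.range n).filter (fun v => f (comp v) = c ∧ T0 v)).card +
      Λ * ((Finset.range n).filter (fun v => f (comp v) = c ∧ C v)).card ≤ load := by
    intro c
    have h := hf2 c
    rw [Finset.sum_add_distrib, Finset.sum_add_distrib, ← Finset.mul_sum, ← Finset.mul_sum, hfib, hfib, hfib, hfib] at h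
    have e1 : ∀ p : ℕ → Prop, ((Finset.range n).filter (fun v => comp v ∈ X.filter (fun l => f l = c) ∧ p v)) =
        ((Finset.range n).filter (fun v => f (comp v) = c ∧ p v)) := by
      intro p
      apply Finset.filter_congr
      intro v hv
      have := hcm v (Finset.mem_range.mp hv)
      simp only [Finset.mem_filter]; tauto
    rw [e1, e1] at h
    have e2 : ((Finset.range n).filter (fun v => comp v ∈ X ∧ T0 v)).card ≤ n := by
      simpa using Finset.card_filter_le (Finset.range n) (fun v => comp v ∈ X ∧ T0 v)
    have e3 : ((Finset.range n).filter (fun v => comp v ∈ X ∧ C v)).card ≤ ((Finset.range n).filter (fun v => C v)).card := by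
      apply Finset.card_le_card
      intro v; simp only [Finset.mem_filter]; tauto
    obtain ⟨x, hx⟩ : ∃ x, x = ((Finset.range n).filter (fun v => f (comp v) = c ∧ T0 v)).card +
      Λ * ((Finset.range n).filter (fun v => f (comp v) = c ∧ C v)).card := ⟨_, rfl⟩
    rw [← hx] at h ⊢
    have hpos : 0 < Gd.card * L := Nat.mul_pos hGd.card_pos hL
    apply Nat.le_of_mul_le_mul_left _ hpos
    calc Gd.card * L * x = L * (Gd.card * x) := by ring
      _ ≤ L * (n + Λ * ((Finset.range n).filter (fun v => C v)).card + Gd.card * ((1 + Λ) * mx)) := by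
        apply Nat.mul_le_mul_left
        refine h.trans ?_
        have := Nat.mul_le_mul_left Λ e3
        omega
      _ = n * L + Λ * (L * ((Finset.range n).filter (fun v => C v)).card) + Gd.card * L * ((1 + Λ) * mx) := by ring
      _ ≤ n * L + Λ * (n * (Δ + 1)) + Gd.card * L * ((1 + Λ) * mx) := by
        have := Nat.mul_le_mul_left Λ hC
        omega
      _ ≤ _ := hload
  have hld1 : ∀ c, ((Finset.range n).filter (fun v => f (comp v) = c)).card ≤ load := by
    intro c
    have := hld c
    simp only [hT0, and_true] at this
    omega
  obtain ⟨sd, hsd⟩ : ∃ sd : ℕ → Bool, ∀ v, sd v = (if o (f (comp v)) (comp v) then dp v else !(dp v)) := ⟨_, fun _ => rfl⟩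
  obtain ⟨St, hSt⟩ : ∃ St : Bool → ℕ → Prop, ∀ b v, St b v ↔ sd v = b := ⟨_, fun _ _ => Iff.rfl⟩
  refine ⟨fun v => v ∈ F ∨ ∃ u ∈ F, par u = v, fun v => f (comp v),
    sd, fun v => hf1 _, ?_, ?_, hld1, ?_, ?_⟩
  · intro v hv h0
    by_cases h : v ∈ F
    · right; exact ⟨Or.inl h, Or.inr ⟨v, h, rfl⟩⟩
    · left
      have hh := hcN v hv h0 h
      simp only [hsd, hh, hdp v h0, true_and]
      split_ifs <;> simp
  · calc _ ≤ (F ∪ F.image par).card := by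
          apply Finset.card_le_card
          intro v
          simp only [Finset.mem_filter, Finset.mem_union, Finset.mem_image]; tauto
      _ ≤ F.card + F.card := (Finset.card_union_le _ _).trans (Nat.add_le_add_left Finset.card_image_le _)
      _ ≤ _ := by
        have := (Nat.le_div_iff_mul_le (by omega)).mpr hF3
        omega
  · intro c
    have := hld c
    have e : ((Finset.range n).filter (fun v => C v ∧ f (comp v) = c)) = ((Finset.range n).filter (fun v => f (comp v) = c ∧ C v)) := by
      apply Finset.filter_congr; intros; tauto
    rw [e]
    omega
  · intro c b
    -- counts of sides
    have e1 : ∑ l ∈ X.filter (fun l => f l = c), (if o c l then ((Finset.range n).filter (fun v => comp v = l ∧ Dt v)).card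
        else ((Finset.range n).filter (fun v => comp v = l ∧ Df v)).card) =
        ((Finset.range n).filter (fun v => comp v ∈ X.filter (fun l => f l = c) ∧ St true v)).card := by
      rw [← hfib]
      refine Finset.sum_congr rfl (fun l hl => ?_)
      have hl2 := (Finset.mem_filter.mp hl).2
      have : ∀ v, (comp v = l ∧ St true v) ↔
        comp v = l ∧ (if o c l then Dt v else Df v) := by
        intro v
        constructor
        · rintro ⟨rfl, h⟩; rw [hSt, hsd, hl2] at h; rw [hDt, hDf]; refine ⟨rfl, ?_⟩; split_ifs at h ⊢ <;> simpa using h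
        · rintro ⟨rfl, h⟩; rw [hSt, hsd, hl2]; rw [hDt, hDf] at h; refine ⟨rfl, ?_⟩; split_ifs at h ⊢ <;> simpa using h
      simp only [this]
      split_ifs with h <;> simp
    have e2 : ∑ l ∈ X.filter (fun l => f l = c), (if o c l then ((Finset.range n).filter (fun v => comp v = l ∧ Df v)).card
        else ((Finset.range n).filter (fun v => comp v = l ∧ Dt v)).card) =
        ((Finset.range n).filter (fun v => comp v ∈ X.filter (fun l => f l = c) ∧ St false v)).card := by
      rw [← hfib]
      refine Finset.sum_congr rfl (fun l hl => ?_)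
      have hl2 := (Finset.mem_filter.mp hl).2
      have : ∀ v, (comp v = l ∧ St false v) ↔
        comp v = l ∧ (if o c l then Df v else Dt v) := by
        intro v
        constructor
        · rintro ⟨rfl, h⟩; rw [hSt, hsd, hl2] at h; rw [hDt, hDf]; refine ⟨rfl, ?_⟩; split_ifs at h ⊢ <;> simpa using h
        · rintro ⟨rfl, h⟩; rw [hSt, hsd, hl2]; rw [hDt, hDf] at h; refine ⟨rfl, ?_⟩; split_ifs at h ⊢ <;> simpa using h
      simp only [this]
      split_ifs with h <;> simp
    have e3 : ∀ b, ((Finset.range n).filter (fun v => comp v ∈ X.filter (fun l => f l = c) ∧ St b v)) =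
        ((Finset.range n).filter (fun v => f (comp v) = c ∧ St b v)) := by
      intro b
      apply Finset.filter_congr
      intro v hv
      have := hcm v (Finset.mem_range.mp hv)
      simp only [Finset.mem_filter]; tauto
    have h1 := ho1 c
    have h2 := ho2 c
    rw [e1, e2, e3, e3] at h1 h2
    have h3 : ((Finset.range n).filter (fun v => f (comp v) = c ∧ St true v)).card +
      ((Finset.range n).filter (fun v => f (comp v) = c ∧ St false v)).card ≤ load := by
      rw [← Finset.card_union_of_disjoint]
      · refine (Finset.card_le_card ?_).trans (hld1 c)
        intro v; simp only [Finset.mem_filter, Finset.mem_union]; tauto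
      · rw [Finset.disjoint_left]; intro v; simp only [Finset.mem_filter]
        rintro ⟨_, _, h⟩ ⟨_, _, h'⟩; rw [hSt] at h h'; rw [h] at h'; cases h'
    have e4 : ((Finset.range n).filter (fun v => f (comp v) = c ∧ sd v = b)).card =
        ((Finset.range n).filter (fun v => f (comp v) = c ∧ St b v)).card := by
      congr 1
      apply Finset.filter_congr; intro v _; rw [hSt]
    refine le_trans (Nat.mul_le_mul_left 2 (le_of_eq e4)) ?_
    cases b <;> omega

end PartA4b

section PartA4c

open scoped Classical

theorem exists_fun_of_compat {A X Y : Type*} [Nonempty Y] (p : A → Prop) (f : A → X) (h : A → Y)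
    (hc : ∀ v w, p v → p w → f v = f w → h v = h w) : ∃ g : X → Y, ∀ v, p v → g (f v) = h v := by
  refine ⟨fun x => if hx : ∃ v, p v ∧ f v = x then h hx.choose else Classical.arbitrary Y, ?_⟩
  intro v hv
  have hx : ∃ w, p w ∧ f w = f v := ⟨v, hv, rfl⟩
  simp only [hx, dif_pos]
  exact hc _ _ hx.choose_spec.1 hv hx.choose_spec.2

theorem plan_core {n Δ L B a load Λ capJ mx : ℕ} {par : ℕ → ℕ} (hP : ParArr n Δ par) 
    (C : ℕ → Prop) (pt addr : ℕ → ℕ) (hB : B = (Δ + 1) ^ L) (ha : 0 < a) (hΛ : 0 < Λ)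
    (hp1 : ∀ x, C x → ∀ y z, ¬ C y → ¬ C z →
        ((y ≠ 0 ∧ par y = x) ∨ (x ≠ 0 ∧ par x = y)) →
        ((z ≠ 0 ∧ par z = x) ∨ (x ≠ 0 ∧ par x = z)) → y = z)
    (hp2 : ∀ v, ¬ C v → ¬ C (pt v) ∧ pt v ≤ v)
    (hp3 : ∀ v, (v = 0 ∨ C (par v)) → pt v = v ∧ addr v = 0)
    (hp4 : ∀ v, v < n → v ≠ 0 → ¬ C (par v) → pt v = pt (par v) ∧ addr v ≠ 0 ∧ (addr v - 1) / Δ = addr (par v))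
    (hp5 : ∀ v, v < n → ¬ C v → addr v < (Δ + 1) ^ L)
    (hp6 : ∀ v w, v < n → w < n → ¬ C v → ¬ C w → pt v = pt w → addr v = addr w → v = w)
    {K Q : Type} [Fintype Q] [Nonempty Q] (ed : K → K → Prop) (σ : K → K) (hσ : Function.Injective σ)
    (J : ℕ → Prop) (pr : ℕ → K) (sd : ℕ → Bool) (hgood : ∀ v, ed (pr v) (σ (pr v)))
    (hedge : ∀ v, v < n → v ≠ 0 → (pr v = pr (par v) ∧ sd v ≠ sd (par v)) ∨ (J v ∧ J (par v)))
    (hJ : ((Finset.range n).filter (fun v => J v)).card ≤ capJ)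
    (hl1 : ∀ c, ((Finset.range n).filter (fun v => pr v = c)).card ≤ load)
    (hl2 : ∀ c, Λ * ((Finset.range n).filter (fun v => C v ∧ pr v = c)).card ≤ load)
    (hl3 : ∀ c b, 2 * ((Finset.range n).filter (fun v => pr v = c ∧ sd v = b)).card ≤ load + mx)
    (hq : load + mx ≤ Fintype.card Q * a) :
    Nonempty (Plan n par ed σ Q (Fin a) B (load / a) ((Δ + 1) * (load / Λ) / a)
      (load / Λ + capJ * B + 2 ^ (4 * B) * a * B) capJ) := by
  have hpar : ∀ v, v ≠ 0 → v < n → par v < n := fun v h0 hv => (hP.lt v h0).trans hv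
  -- idempotence of `pt`
  have hptpt : ∀ v, v < n → ¬ C v → pt (pt v) = pt v := by
    intro v
    induction v using Nat.strong_induction_on with
    | _ v ih =>
      intro hv hc
      by_cases h : v = 0 ∨ C (par v)
      · rw [(hp3 v h).1, (hp3 v h).1]
      · push Not at h
        rw [(hp4 v hv h.1 h.2).1]
        exact ih _ (hP.lt v h.1) (hpar v h.1 hv) h.2
  obtain ⟨noJ, hnoJ⟩ : ∃ noJ : ℕ → Prop, ∀ d, noJ d ↔ ∀ w, w < n → ¬ C w → pt w = d → ¬ J w := ⟨_, fun _ => Iff.rfl⟩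
  have hprpt : ∀ v, v < n → ¬ C v → noJ (pt v) → pr v = pr (pt v) := by
    intro v
    induction v using Nat.strong_induction_on with
    | _ v ih =>
      intro hv hc hn
      by_cases h : v = 0 ∨ C (par v)
      · rw [(hp3 v h).1]
      · push Not at h
        have e := (hp4 v hv h.1 h.2).1
        have h1 := (hnoJ _).mp hn v hv hc rfl
        rcases hedge v hv h.1 with h2 | h2
        · rw [h2.1, e]
          exact ih _ (hP.lt v h.1) (hpar v h.1 hv) h.2 (e ▸ hn)
        · exact absurd h2.1 h1
  obtain ⟨flag, hflag⟩ : ∃ flag : ℕ → Bool, ∀ v, flag v = true ↔ ∃ x, x < n ∧ C x ∧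
      ((v ≠ 0 ∧ par v = x) ∨ (x ≠ 0 ∧ par x = v)) := ⟨fun v => decide (∃ x, x < n ∧ C x ∧
      ((v ≠ 0 ∧ par v = x) ∨ (x ≠ 0 ∧ par x = v))), fun v => by simp⟩
  obtain ⟨code, hcode⟩ : ∃ code : ℕ → Finset (ℕ × Bool × Bool), ∀ d x, x ∈ code d ↔
      ∃ w, w < n ∧ ¬ C w ∧ pt w = d ∧ (addr w, sd w, flag w) = x :=
    ⟨fun d => ((Finset.range n).filter (fun w => ¬ C w ∧ pt w = d)).image (fun w => (addr w, sd w, flag w)), by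
      intro d x
      simp only [Finset.mem_image, Finset.mem_filter, Finset.mem_range]
      constructor
      · rintro ⟨w, ⟨h1, h2, h3⟩, h4⟩; exact ⟨w, h1, h2, h3, h4⟩
      · rintro ⟨w, h1, h2, h3, h4⟩; exact ⟨w, ⟨h1, h2, h3⟩, h4⟩⟩
  obtain ⟨s, hs⟩ : ∃ s : Finset ℕ, ∀ d, d ∈ s ↔ d < n ∧ ¬ C d ∧ pt d = d ∧ noJ d :=
    ⟨(Finset.range n).filter (fun d => ¬ C d ∧ pt d = d ∧ noJ d), by intro d; simp⟩
  obtain ⟨kd, hkd⟩ : ∃ kd : ℕ → K × Finset (ℕ × Bool × Bool), ∀ d, kd d = (pr d, code d) := ⟨_, fun _ => rfl⟩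
  obtain ⟨tup, slot, kept, hg1, hg2, hg3, hg4⟩ := exists_groups s kd a ha
  obtain ⟨P, hPd⟩ : ∃ P : ℕ → Prop, ∀ v, P v ↔ v < n ∧ ¬ C v ∧ noJ (pt v) ∧ kept (pt v) := ⟨_, fun _ => Iff.rfl⟩
  have hPs : ∀ v, v < n → ¬ C v → noJ (pt v) → pt v ∈ s := by
    intro v h1 h2 h3
    rw [hs]
    exact ⟨lt_of_le_of_lt (hp2 v h2).2 h1, (hp2 v h2).1, hptpt v h1 h2, h3⟩
  have hPpr : ∀ v, P v → pr v = pr (pt v) := fun v h => by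
    rw [hPd] at h; exact hprpt v h.1 h.2.1 h.2.2.1
  have hPJ : ∀ v, P v → ¬ J v := fun v h => by
    rw [hPd] at h; exact (hnoJ _).mp h.2.2.1 v h.1 h.2.1 rfl
  obtain ⟨key, hkey⟩ : ∃ key : ℕ → K × Finset (ℕ × Bool × Bool) × ℕ × ℕ, ∀ v, key v = (pr (pt v), code (pt v), tup (pt v), addr v) :=
    ⟨_, fun _ => rfl⟩
  obtain ⟨cl, hcl⟩ : ∃ cl : ℕ → K, ∀ v, cl v = clOf σ (pr v) (sd v) := ⟨_, fun _ => rfl⟩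
  -- same key: same pr, sd, flag
  have hsame : ∀ v w, P v → P w → key v = key w → pr v = pr w ∧ sd v = sd w ∧ flag v = flag w := by
    intro v w hv hw h
    have hv' := (hPd v).mp hv
    have hw' := (hPd w).mp hw
    rw [hkey, hkey] at h
    simp only [Prod.mk.injEq] at h
    obtain ⟨h1, h2, h3, h4⟩ := h
    have h5 : (addr v, sd v, flag v) ∈ code (pt w) := by
      rw [← h2, hcode]; exact ⟨v, hv'.1, hv'.2.1, rfl, rfl⟩
    rw [hcode] at h5
    obtain ⟨u, u1, u2, u3, u4⟩ := h5
    simp only [Prod.mk.injEq] at u4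
    have := hp6 u w u1 hw'.1 u2 hw'.2.1 u3 (u4.1.trans h4)
    subst this
    exact ⟨by rw [hPpr v hv, hPpr u hw, h1], u4.2.1.symm, u4.2.2.symm⟩
  have hfibK : ∀ v, P v → ∀ X : Finset ℕ, (∀ w, P w → key w = key v → w ∈ X) → a ≤ X.card := by
    intro v hv X hX
    have hv' := (hPd v).mp hv
    have hvs := hPs v hv'.1 hv'.2.1 hv'.2.2.1
    refine (hg3 _ hvs hv'.2.2.2).trans ?_
    have hex : ∀ d, (d ∈ s ∧ kd d = kd (pt v) ∧ tup d = tup (pt v)) →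
        ∃ w ∈ X, pt w = d := by
      intro d hd
      obtain ⟨d1, d2, d3⟩ := hd
      have d4 := hg2 _ hvs d d1 d2.symm d3.symm hv'.2.2.2
      simp only [hkd, Prod.mk.injEq] at d2
      have h5 : (addr v, sd v, flag v) ∈ code d := by
        rw [d2.2, hcode]; exact ⟨v, hv'.1, hv'.2.1, rfl, rfl⟩
      rw [hcode] at h5
      obtain ⟨u, u1, u2, u3, u4⟩ := h5
      simp only [Prod.mk.injEq] at u4
      refine ⟨u, hX u ?_ ?_, u3⟩
      · rw [hPd, u3]; exact ⟨u1, u2, ((hs d).mp d1).2.2.2, d4⟩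
      · rw [hkey, hkey, u3, d2.1, d2.2, d3, u4.1]
    choose! g hgX hgp using hex
    refine Finset.card_le_card_of_injOn g (fun d hd => hgX d (by simpa using hd)) ?_
    intro x hx y hy hxy
    have hx := hgp x (by simpa using hx)
    have hy := hgp y (by simpa using hy)
    rw [← hx, ← hy, hxy]
  -- positions
  have hpos : ∀ c : K, ∃ g : (K × Finset (ℕ × Bool × Bool) × ℕ × ℕ) → Q, ∀ v w, P v → P w → cl v = c → cl w = c →
      g (key v) = g (key w) → key v = key w := by
    intro c
    set Y := (Finset.range n).filter (fun v => P v ∧ cl v = c) with hY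
    have h1 : (Y.image key).card * a ≤ Y.card := by
      rw [mul_comm]
      refine Finset.mul_card_image_le_card _ _ ?_
      intro e he
      obtain ⟨v, hv, rfl⟩ := Finset.mem_image.mp he
      simp only [hY, Finset.mem_filter, Finset.mem_range] at hv
      refine hfibK v hv.2.1 _ ?_
      intro w hw hk
      obtain ⟨e1, e2, e3⟩ := hsame w v hw hv.2.1 hk
      simp only [hY, Finset.mem_filter, Finset.mem_range]
      refine ⟨⟨((hPd w).mp hw).1, hw, ?_⟩, hk⟩
      rw [hcl, e1, e2, ← hcl, hv.2.2]
    have h2 : Y.card ≤ load + mx := by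
      have : Y ⊆ (Finset.range n).filter (fun v => pr v = c ∧ sd v = true) ∪
          (Finset.range n).filter (fun v => σ (pr v) = c ∧ sd v = false) := by
        intro v hv
        simp only [hY, Finset.mem_filter, Finset.mem_range, Finset.mem_union] at hv ⊢
        obtain ⟨v1, v2, v3⟩ := hv
        rw [hcl, clOf] at v3
        cases hsd : sd v <;> simp [hsd] at v3 <;> simp [v1, v3]
      have h3 := (Finset.card_le_card this).trans (Finset.card_union_le _ _)
      have h4 := hl3 c true
      have h5 : 2 * ((Finset.range n).filter (fun v => σ (pr v) = c ∧ sd v = false)).card ≤ load + mx := by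
        by_cases hc : ∃ p, σ p = c
        · obtain ⟨p, rfl⟩ := hc
          simp only [hσ.eq_iff]
          exact hl3 p false
        · rw [Finset.filter_false_of_mem]
          · simp
          · rintro v _ ⟨h, _⟩; exact hc ⟨_, h⟩
      omega
    have h3 : (Y.image key).card ≤ Fintype.card Q :=
      Nat.le_of_mul_le_mul_right (h1.trans (h2.trans hq)) ha
    obtain ⟨g, hg⟩ := exists_injOn_of_card_le (Q := Q) _ h3
    refine ⟨g, fun v w hv hw hcv hcw he => hg ?_ ?_ he⟩
    · simp only [Finset.coe_image]
      exact ⟨v, by simp [hY, hv, hcv, ((hPd v).mp hv).1], rfl⟩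
    · simp only [Finset.coe_image]
      exact ⟨w, by simp [hY, hw, hcw, ((hPd w).mp hw).1], rfl⟩
  choose g hg using hpos
  obtain ⟨pos, hposd⟩ : ∃ pos : ℕ → Q, ∀ v, pos v = g (cl v) (key v) := ⟨_, fun _ => rfl⟩
  have hkeyeq : ∀ v w, P v → P w → cl v = cl w → pos v = pos w → key v = key w := by
    intro v w hv hw h1 h2
    rw [hposd, hposd, ← h1] at h2
    exact hg (cl v) v w hv hw rfl h1.symm h2
  have hposeq : ∀ v w, P v → P w → key v = key w → (cl v, pos v) = (cl w, pos w) := by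
    intro v w hv hw h
    obtain ⟨e1, e2, e3⟩ := hsame v w hv hw h
    have : cl v = cl w := by rw [hcl, hcl, e1, e2]
    rw [hposd, hposd, this, h]
  -- non-C neighbours of P vertices are P
  have hPpar : ∀ v, v < n → v ≠ 0 → ¬ C v → ¬ C (par v) → (P v ↔ P (par v)) := by
    intro v hv h0 h1 h2
    rw [hPd, hPd, (hp4 v hv h0 h2).1]
    have := hpar v h0 hv
    tauto
  have hnbrC : ∀ y x, y < n → x < n → P y → ¬ P x → ((y ≠ 0 ∧ par y = x) ∨ (x ≠ 0 ∧ par x = y)) → C x := by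
    intro y x hy hx h1 h2 h3
    by_contra hC
    have hCy := ((hPd y).mp h1).2.1
    rcases h3 with ⟨h0, rfl⟩ | ⟨h0, rfl⟩
    · exact h2 ((hPpar y hy h0 hCy hC).mp h1)
    · exact h2 ((hPpar x hx h0 hC hCy).mpr h1)
  have hroot : ∀ v, P v → ((v = 0 ∨ ¬ P (par v)) ↔ addr v = 0) := by
    intro v hv
    have hv' := (hPd v).mp hv
    constructor
    · rintro (h | h)
      · exact (hp3 v (Or.inl h)).2
      · by_cases h0 : v = 0
        · exact (hp3 v (Or.inl h0)).2
        · by_cases hc : C (par v)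
          · exact (hp3 v (Or.inr hc)).2
          · exact absurd ((hPpar v hv'.1 h0 hv'.2.1 hc).mp hv) h
    · intro h
      by_contra hcon
      push Not at hcon
      have hc := ((hPd _).mp hcon.2).2.1
      exact (hp4 v hv'.1 hcon.1 hc).2.1 h
  have hedgeP : ∀ v, v < n → v ≠ 0 → P v → pr v = pr (par v) ∧ sd v ≠ sd (par v) := by
    intro v hv h0 h
    rcases hedge v hv h0 with h1 | h1
    · exact h1
    · exact absurd h1.1 (hPJ v h)
  have hkeypar : ∀ v, v < n → v ≠ 0 → P v → P (par v) → key (par v) = ((key v).1, (key v).2.1, (key v).2.2.1, ((key v).2.2.2 - 1) / Δ) := by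
    intro v hv h0 h1 h2
    obtain ⟨e1, e2, e3⟩ := hp4 v hv h0 ((hPd _).mp h2).2.1
    rw [hkey, hkey]
    simp only
    rw [e3, e1]
  have : Nonempty (K × Q) := ⟨(pr 0, Classical.arbitrary Q)⟩
  obtain ⟨pa, hpa⟩ := exists_fun_of_compat (Y := K × Q) (p := fun v => v < n ∧ v ≠ 0 ∧ P v ∧ P (par v))
    (h := fun v => (cl (par v), pos (par v))) (f := fun v => (cl v, pos v)) (by
      rintro v w ⟨v1, v2, v3, v4⟩ ⟨w1, w2, w3, w4⟩ h
      simp only [Prod.mk.injEq] at h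
      have h3 := hkeyeq v w v3 w3 h.1 h.2
      exact hposeq _ _ v4 w4 (by rw [hkeypar v v1 v2 v3 v4, hkeypar w w1 w2 w3 w4, h3]))
  have hpid : ∀ p, ∀ X : Finset ℕ, (∀ v ∈ X, v < n ∧ ¬ C v ∧ pt v = p) → X.card ≤ B := by
    intro p X hX
    have : X.card ≤ (Finset.range B).card := by
      refine Finset.card_le_card_of_injOn addr ?_ ?_
      · intro v hv
        have := hX v hv
        simp only [Finset.coe_range, Set.mem_Iio, hB]
        exact hp5 v this.1 this.2.1
      · intro v hv w hw h
        have h1 := hX v hv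
        have h2 := hX w hw
        exact hp6 v w h1.1 h2.1 h1.2.1 h2.2.1 (h1.2.2.trans h2.2.2.symm) h
    simpa using this
  have hload2 : ∀ c, ((Finset.range n).filter (fun v => C v ∧ pr v = c)).card ≤ load / Λ := by
    intro c
    rw [Nat.le_div_iff_mul_le hΛ, mul_comm]; exact hl2 c
  -- image bound
  have himg : ∀ (X Y : Finset ℕ), (∀ v ∈ X, P v) → (∀ v ∈ X, ∀ w, P w → key w = key v → w ∈ Y) →
      (X.image (fun v => (clOf σ (pr v) (sd v), pos v))).card ≤ Y.card / a := by
    intro X Y hX hXY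
    rw [Nat.le_div_iff_mul_le ha, mul_comm]
    have hsub : X ⊆ Y := fun v hv => hXY v hv v (hX v hv) rfl
    have h1 : X.image (fun v => (clOf σ (pr v) (sd v), pos v)) ⊆ 
      (X.image key).image (fun k => if h : ∃ v, P v ∧ key v = k then (cl h.choose, pos h.choose) else (pr 0, Classical.arbitrary Q)) := by
      intro e he
      obtain ⟨v, hv, rfl⟩ := Finset.mem_image.mp he
      rw [Finset.mem_image]
      refine ⟨key v, Finset.mem_image_of_mem _ hv, ?_⟩
      have hx : ∃ w, P w ∧ key w = key v := ⟨v, hX v hv, rfl⟩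
      rw [dif_pos hx, ← hcl]
      exact hposeq _ _ hx.choose_spec.1 (hX v hv) hx.choose_spec.2
    have h2 := (Finset.card_le_card h1).trans Finset.card_image_le
    refine (Nat.mul_le_mul_left a h2).trans ?_
    set Y' := Y.filter (fun w => key w ∈ X.image key) with hY'
    have h3 : X.image key ⊆ Y'.image key := by
      intro e he
      obtain ⟨v, hv, rfl⟩ := Finset.mem_image.mp he
      exact Finset.mem_image_of_mem _ (by simp only [hY', Finset.mem_filter]; exact ⟨hsub hv, he⟩)
    refine (Nat.mul_le_mul_left a (Finset.card_le_card h3)).trans ?_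
    refine le_trans ?_ (Finset.card_filter_le Y (fun w => key w ∈ X.image key))
    refine Finset.mul_card_image_le_card _ _ ?_
    intro e he
    obtain ⟨u, hu, rfl⟩ := Finset.mem_image.mp he
    simp only [hY', Finset.mem_filter] at hu
    obtain ⟨v, hv, hvu⟩ := Finset.mem_image.mp hu.2
    refine hfibK v (hX v hv) _ ?_
    intro w hw hk
    simp only [hY', Finset.mem_filter]
    have hmem : key w ∈ X.image key := by rw [hk]; exact Finset.mem_image_of_mem _ hv
    exact ⟨⟨hXY v hv w hw hk, hmem⟩, by rw [hk, hvu]⟩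
  refine ⟨{
    P := P
    J := J
    pr := pr
    sd := sd
    pos := pos
    zr := fun v => slot (pt v)
    pid := pt
    pa := pa
    inj := hσ
    good := fun v _ => hgood v
    edge := hedge
    JP := fun v h1 h2 => hPJ v h2 h1
    piece := ?_
    pid_pr := ?_
    pid_card := ?_
    slot := ?_
    homog := ?_
    pa_spec := ?_
    one_nbr := ?_
    capA_le := ?_
    capF_le := ?_
    capC_le := ?_
    capJ_le := hJ }⟩
  · intro v hv h0 h1 h2
    have := (hp4 v hv h0 ((hPd _).mp h2).2.1).1
    exact ⟨this, by rw [this]⟩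
  · intro v w hv hw h1 h2 h3
    rw [hPpr v h1, hPpr w h2, h3]
  · intro p
    refine hpid p _ ?_
    intro v hv
    simp only [Finset.mem_filter, Finset.mem_range] at hv
    have := (hPd v).mp hv.2.1
    exact ⟨hv.1, this.2.1, hv.2.2⟩
  · intro v w hv hw h1 h2 h3 h4 h5
    rw [← hcl, ← hcl] at h3
    have h6 := hkeyeq v w h1 h2 h3 h4
    rw [hkey, hkey] at h6
    simp only [Prod.mk.injEq] at h6
    have hv' := (hPd v).mp h1
    have hw' := (hPd w).mp h2
    have h7 := hg1 _ (hPs v hv hv'.2.1 hv'.2.2.1) _ (hPs w hw hw'.2.1 hw'.2.2.1) (by simp [hkd, h6.1, h6.2.1]) h6.2.2.1 h5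
    exact hp6 v w hv hw hv'.2.1 hw'.2.1 h7 h6.2.2.2
  · intro v w hv hw h1 h2 h3 h4
    rw [← hcl, ← hcl] at h3
    have h6 := hkeyeq v w h1 h2 h3 h4
    obtain ⟨e1, e2, e3⟩ := hsame v w h1 h2 h6
    refine ⟨e1, e2, ?_⟩
    rw [hroot v h1, hroot w h2]
    rw [hkey, hkey] at h6
    simp only [Prod.mk.injEq] at h6
    rw [h6.2.2.2]
  · intro v hv h0 h1 h2
    rw [← hcl, ← hcl]
    exact hpa v ⟨hv, h0, h1, h2⟩
  · intro x y z hx hy hz h1 h2 h3 h4 h5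
    exact hp1 x (hnbrC y x hy hx h2 h1 h4) y z ((hPd y).mp h2).2.1 ((hPd z).mp h3).2.1 h4 h5
  · intro c
    refine (himg _ ((Finset.range n).filter (fun v => pr v = c)) ?_ ?_).trans (Nat.div_le_div_right (hl1 c))
    · intro v hv; simp only [Finset.mem_filter] at hv; exact hv.2.1
    · intro v hv w hw hk
      simp only [Finset.mem_filter, Finset.mem_range] at hv ⊢
      exact ⟨((hPd w).mp hw).1, by rw [(hsame w v hw hv.2.1 hk).1]; exact hv.2.2.2.2⟩
  · intro c
    refine (himg _ ((Finset.range n).filter (fun v => P v ∧ flag v = true ∧ pr v = c)) ?_ ?_).trans (Nat.div_le_div_right ?_)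
    · intro v hv; simp only [Finset.mem_filter] at hv; exact hv.2.1
    · intro v hv w hw hk
      simp only [Finset.mem_filter, Finset.mem_range] at hv ⊢
      obtain ⟨v1, v2, v3, x, x1, x2, x3⟩ := hv
      obtain ⟨e1, e2, e3⟩ := hsame w v hw v2 hk
      refine ⟨((hPd w).mp hw).1, hw, ?_, by rw [e1]; exact v3⟩
      rw [e3, hflag]
      exact ⟨x, x1, hnbrC v x v1 x1 v2 x2 x3, x3⟩
    · rw [mul_comm]
      refine le_trans ?_ (Nat.mul_le_mul_right (Δ + 1) (hload2 c))
      refine card_le_mul_rel _ _ (fun v x => (v ≠ 0 ∧ par v = x) ∨ (x ≠ 0 ∧ par x = v)) _ ?_ ?_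
      · intro v hv
        simp only [Finset.mem_filter, Finset.mem_range] at hv
        obtain ⟨v1, v2, v3, v4⟩ := hv
        rw [hflag] at v3
        obtain ⟨x, x1, x2, x3⟩ := v3
        refine ⟨x, ?_, x3⟩
        simp only [Finset.mem_filter, Finset.mem_range]
        refine ⟨x1, x2, ?_⟩
        rcases x3 with ⟨h0, rfl⟩ | ⟨h0, rfl⟩
        · rw [← (hedgeP v v1 h0 v2).1]; exact v4
        · rcases hedge x x1 h0 with h1 | h1
          · rw [h1.1]; exact v4
          · exact absurd h1.2 (hPJ _ v2)
      · intro x hx X hX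
        have : X ⊆ insert (par x) ((Finset.range n).filter (fun v => v ≠ 0 ∧ par v = x)) := by
          intro v hv
          obtain ⟨h1, h2⟩ := hX v hv
          simp only [Finset.mem_filter, Finset.mem_range, Finset.mem_insert] at h1 ⊢
          rcases h2 with h2 | h2
          · exact Or.inr ⟨h1.1, h2⟩
          · exact Or.inl h2.2.symm
        refine (Finset.card_le_card this).trans ((Finset.card_insert_le _ _).trans ?_)
        exact Nat.add_le_add_right (hP.ch x) 1
  · intro c
    have hsub : (Finset.range n).filter (fun v => ¬ P v ∧ pr v = c) ⊆
        ((Finset.range n).filter (fun v => C v ∧ pr v = c) ∪ (Finset.range n).filter (fun v => ¬ C v ∧ ¬ noJ (pt v))) ∪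
        (Finset.range n).filter (fun v => ¬ C v ∧ noJ (pt v) ∧ ¬ kept (pt v) ∧ pr v = c) := by
      intro v
      simp only [Finset.mem_filter, Finset.mem_union, Finset.mem_range]
      rintro ⟨h1, h2, h3⟩
      rw [hPd] at h2
      tauto
    refine (Finset.card_le_card hsub).trans ((Finset.card_union_le _ _).trans (Nat.add_le_add ((Finset.card_union_le _ _).trans (Nat.add_le_add (hload2 c) ?_)) ?_))
    · refine le_trans ?_ (Nat.mul_le_mul_right B hJ)
      refine card_le_mul_rel _ _ (fun v w => ¬ C w ∧ pt w = pt v) _ ?_ ?_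
      · intro v hv
        simp only [Finset.mem_filter, Finset.mem_range, hnoJ] at hv
        obtain ⟨v1, v2, v3⟩ := hv
        push Not at v3
        obtain ⟨w, w1, w2, w3, w4⟩ := v3
        exact ⟨w, by simp [w1, w4], w2, w3⟩
      · intro w hw X hX
        refine hpid (pt w) X ?_
        intro v hv
        obtain ⟨h1, h2⟩ := hX v hv
        simp only [Finset.mem_filter, Finset.mem_range] at h1
        exact ⟨h1.1, h1.2.1, h2.2.symm⟩
    · have hk : ((s.filter (fun d => ¬ kept d ∧ pr d = c))).card ≤ 2 ^ (4 * B) * a := by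
        have : (((Finset.range B) ×ˢ (Finset.univ : Finset (Bool × Bool))).powerset).card = 2 ^ (4 * B) := by
          rw [Finset.card_powerset, Finset.card_product]; simp [mul_comm]
        rw [← this]
        refine card_le_mul_rel _ _ (fun d k => code d = k) _ ?_ ?_
        · intro d hd
          refine ⟨code d, ?_, rfl⟩
          rw [Finset.mem_powerset]
          intro x hx
          rw [hcode] at hx
          obtain ⟨w, w1, w2, w3, rfl⟩ := hx
          simp only [Finset.mem_product, Finset.mem_range, Finset.mem_univ, and_true, hB]
          exact hp5 w w1 w2
        · intro k hk X hX
          refine (Finset.card_le_card ?_).trans (hg4 (c, k))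
          intro d hd
          obtain ⟨h1, h2⟩ := hX d hd
          simp only [Finset.mem_filter] at h1 ⊢
          exact ⟨h1.1, by rw [hkd, h1.2.2, h2], h1.2.1⟩
      refine le_trans ?_ (Nat.mul_le_mul_right B hk)
      refine card_le_mul_rel _ _ (fun v d => pt v = d) _ ?_ ?_
      · intro v hv
        simp only [Finset.mem_filter, Finset.mem_range] at hv
        obtain ⟨v1, v2, v3, v4, v5⟩ := hv
        refine ⟨pt v, ?_, rfl⟩
        rw [Finset.mem_filter]
        exact ⟨hPs v v1 v2 v3, v4, by rw [← hprpt v v1 v2 v3]; exact v5⟩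
      · intro d hd X hX
        refine hpid d X ?_
        intro v hv
        obtain ⟨h1, h2⟩ := hX v hv
        simp only [Finset.mem_filter, Finset.mem_range] at h1
        exact ⟨h1.1, h1.2.1, h2⟩

theorem exists_plan {n Δ L s a load Λ : ℕ} {par : ℕ → ℕ} (hP : ParArr n Δ par) (hn : 0 < n) (hΔ : 1 ≤ Δ) (hL : 3 ≤ L)
    (hs : 1 ≤ s) (ha : 0 < a) (hΛ : 0 < Λ)
    {K Q : Type} [Fintype Q] [Nonempty Q] (ed : K → K → Prop) (σ : K → K) (hσ : Function.Injective σ)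
    (Gd : Finset K) (hGd : Gd.Nonempty) (hG : ∀ c ∈ Gd, ed c (σ c))
    (hload : n * L + Λ * (n * (Δ + 1)) + Gd.card * L * ((1 + Λ) * ((Δ + 1) * s)) ≤ Gd.card * L * load)
    (hq : load + (Δ + 1) * s ≤ Fintype.card Q * a) :
    Nonempty (Plan n par ed σ Q (Fin a) ((Δ + 1) ^ L) (load / a) ((Δ + 1) * (load / Λ) / a)
      (load / Λ + 2 * (n / s) * (Δ + 1) ^ L + 2 ^ (4 * (Δ + 1) ^ L) * a * (Δ + 1) ^ L) (2 * (n / s))) := by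
  obtain ⟨C, pt, addr, h1, h2, h3, h4, h5, h6, h7⟩ := exists_pieces hP hΔ hL
  obtain ⟨J, pr, sd, g1, g2, g3, g4, g5, g6⟩ := plan_pre hP hn s hs C Gd hGd Λ L load (by omega) h1 hload
  exact plan_core hP C pt addr rfl ha hΛ h2 h3 h4 h5 h6 h7 ed σ hσ J pr sd (fun v => hG _ (g1 v)) g2 g3 g4 g5 g6 hq

end PartA4c

section PartB2

open scoped Classical

theorem exists_perm_weights {K : Type} [Fintype K] (ed : K → K → Prop) (hne : ∀ c c', ed c c' → c ≠ c')
    (W : K → K → ℝ) (hW0 : ∀ c c', 0 ≤ W c c') (hWs : ∀ c c', W c c' = W c' c) (hWe : ∀ c c', ¬ ed c c' → W c c' = 0)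
    (hrow : ∀ c, ∑ c', W c c' ≤ 1) :
    ∃ w : Equiv.Perm K → ℝ, (∀ σ, 0 ≤ w σ) ∧ ∑ σ, w σ = 1 ∧
      (∀ c c', c ≠ c' → ∑ σ, w σ * (if σ c = c' then 1 else 0) = W c c') ∧
      ∑ σ, w σ * ((Finset.univ.filter (fun c => ¬ ed c (σ c))).card : ℝ) = Fintype.card K - ∑ c, ∑ c', W c c' := by
  have hdiag : ∀ c, W c c = 0 := fun c => hWe c c (fun h => hne c c h rfl)
  set A : Matrix K K ℝ := fun c c' => W c c' + if c = c' then 1 - ∑ e, W c e else 0 with hA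
  have hmem : A ∈ doublyStochastic ℝ K := by
    rw [mem_doublyStochastic_iff_sum]
    refine ⟨?_, ?_, ?_⟩
    · intro i j
      simp only [hA]
      have := hrow i
      have := hW0 i j
      split_ifs <;> linarith
    · intro i
      simp only [hA]
      rw [Finset.sum_add_distrib]
      simp
    · intro j
      simp only [hA]
      rw [Finset.sum_add_distrib]
      simp only [Finset.sum_ite_eq', Finset.mem_univ, if_true]
      rw [Finset.sum_congr rfl (fun i _ => hWs i j)]
      ring
  obtain ⟨w, hw0, hw1, hw⟩ := exists_eq_sum_perm_of_mem_doublyStochastic hmem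
  have hent : ∀ c c', ∑ σ, w σ * (if σ c = c' then 1 else 0) = A c c' := by
    intro c c'
    rw [← hw, Matrix.sum_apply]
    refine Finset.sum_congr rfl (fun σ _ => ?_)
    rw [Matrix.smul_apply, smul_eq_mul]
    congr 1
    simp only [Equiv.Perm.permMatrix, PEquiv.toMatrix_apply, Equiv.toPEquiv_apply, Option.mem_some_iff]
  refine ⟨w, hw0, hw1, ?_, ?_⟩
  · intro c c' hc
    rw [hent]
    simp [hA, hc]
  · have h1 : ∀ σ : Equiv.Perm K, ((Finset.univ.filter (fun c => ¬ ed c (σ c))).card : ℝ) =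
        ∑ c, ∑ c', (if σ c = c' then 1 else 0) * (if ed c c' then 0 else 1 : ℝ) := by
      intro σ
      rw [Finset.card_filter]
      push_cast
      refine Finset.sum_congr rfl (fun c _ => ?_)
      rw [Finset.sum_eq_single (σ c)]
      · by_cases h : ed c (σ c) <;> simp [h]
      · intro c' _ hc'; rw [if_neg (fun h => hc' h.symm)]; ring
      · simp
    calc ∑ σ, w σ * ((Finset.univ.filter (fun c => ¬ ed c (σ c))).card : ℝ)
        = ∑ σ, ∑ c, ∑ c', (w σ * (if σ c = c' then 1 else 0)) * (if ed c c' then 0 else 1 : ℝ) := by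
          refine Finset.sum_congr rfl (fun σ _ => ?_)
          rw [h1, Finset.mul_sum]
          refine Finset.sum_congr rfl (fun c _ => ?_)
          rw [Finset.mul_sum]
          refine Finset.sum_congr rfl (fun c' _ => ?_)
          ring
      _ = ∑ c, ∑ c', A c c' * (if ed c c' then 0 else 1 : ℝ) := by
          rw [Finset.sum_comm]
          refine Finset.sum_congr rfl (fun c _ => ?_)
          rw [Finset.sum_comm]
          refine Finset.sum_congr rfl (fun c' _ => ?_)
          rw [← Finset.sum_mul, hent]
      _ = ∑ c, (1 - ∑ e, W c e) := by
          refine Finset.sum_congr rfl (fun c _ => ?_)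
          rw [Finset.sum_eq_single c]
          · simp only [hA, if_true, hdiag, zero_add]
            rw [if_neg (fun h => hne c c h rfl)]; ring
          · intro c' _ hc'
            split_ifs with h
            · ring
            · simp [hA, hWe c c' h, hc'.symm]
          · simp
      _ = _ := by simp

theorem exists_multiplicities {K : Type} [Fintype K] (ed : K → K → Prop) (hne : ∀ c c', ed c c' → c ≠ c')
    (W : K → K → ℝ) (hW0 : ∀ c c', 0 ≤ W c c') (hWs : ∀ c c', W c c' = W c' c) (hWe : ∀ c c', ¬ ed c c' → W c c' = 0)
    (hrow : ∀ c, ∑ c', W c c' ≤ 1) (μ : ℝ) (hμ : 0 < μ) (hμ1 : μ < 1) (hK : 0 < Fintype.card K)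
    (htot : (1 - 2 * μ ^ 2) * Fintype.card K ≤ ∑ c, ∑ c', W c c') (τ Y : ℕ) (hY : 0 < Y) :
    ∃ (Sg : Type) (_ : Fintype Sg) (sg : Sg → Equiv.Perm K) (N : Sg → ℕ),
      τ ≤ Y * ∑ j, N j ∧
      (∀ j, (1 - 2 * μ) * Fintype.card K ≤ ((Finset.univ.filter (fun c => ed c (sg j c))).card : ℝ)) ∧
      (∀ c c', ed c c' → (Y : ℝ) * ∑ j, (N j : ℝ) * (cnt (sg j) c c' : ℝ) ≤
        τ * (2 * W c c') / (1 - μ) + 2 * (Y * Nat.factorial (Fintype.card K))) ∧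
      (Y : ℝ) * ∑ j, (N j : ℝ) ≤ τ / (1 - μ) + Y * Nat.factorial (Fintype.card K) := by
  obtain ⟨w, hw0, hw1, hw2, hw3⟩ := exists_perm_weights ed hne W hW0 hWs hWe hrow
  obtain ⟨good, hgood⟩ : ∃ good : Equiv.Perm K → Prop, ∀ σ, good σ ↔
    (1 - 2 * μ) * Fintype.card K ≤ ((Finset.univ.filter (fun c => ed c (σ c))).card : ℝ) := ⟨_, fun _ => Iff.rfl⟩
  have hYr : (0 : ℝ) < Y := by exact_mod_cast hY
  have hKr : (0 : ℝ) < Fintype.card K := by exact_mod_cast hK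
  have h1μ : 0 < 1 - μ := by linarith
  have hbad : ∑ σ, w σ * (if good σ then 0 else 1) ≤ μ := by
    have h1 : ∑ σ, w σ * (if good σ then 0 else 1) * (2 * μ * Fintype.card K) ≤
        ∑ σ, w σ * ((Finset.univ.filter (fun c => ¬ ed c (σ c))).card : ℝ) := by
      refine Finset.sum_le_sum (fun σ _ => ?_)
      rw [mul_assoc]
      refine mul_le_mul_of_nonneg_left ?_ (hw0 σ)
      split_ifs with h
      · simp
      · rw [hgood] at h
        push Not at h
        have : ((Finset.univ.filter (fun c => ed c (σ c))).card : ℝ) + ((Finset.univ.filter (fun c => ¬ ed c (σ c))).card : ℝ) = Fintype.card K := by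
          exact_mod_cast (Finset.card_filter_add_card_filter_not (s := Finset.univ) (fun c => ed c (σ c)))
        nlinarith
    rw [← Finset.sum_mul, hw3] at h1
    have h2 : (∑ σ, w σ * (if good σ then 0 else 1)) * (2 * μ * Fintype.card K) ≤ μ * (2 * μ * Fintype.card K) := by nlinarith
    exact le_of_mul_le_mul_right h2 (by positivity)
  have hsub : ∀ f : Equiv.Perm K → ℝ, ∑ j : {σ // good σ}, f j.1 = ∑ σ, if good σ then f σ else 0 := by
    intro f
    rw [← Finset.sum_filter]
    exact (Finset.sum_subtype (Finset.univ.filter good) (by simp) f).symm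
  have hsuble : ∀ f : Equiv.Perm K → ℝ, (∀ σ, 0 ≤ f σ) → ∑ j : {σ // good σ}, f j.1 ≤ ∑ σ, f σ := by
    intro f hf
    rw [hsub]
    refine Finset.sum_le_sum (fun σ _ => ?_)
    split_ifs
    · exact le_rfl
    · exact hf σ
  have hgw : 1 - μ ≤ ∑ j : {σ // good σ}, w j.1 := by
    rw [hsub]
    have : ∑ σ, (if good σ then w σ else 0) + ∑ σ, w σ * (if good σ then 0 else 1) = ∑ σ, w σ := by
      rw [← Finset.sum_add_distrib]
      refine Finset.sum_congr rfl (fun σ _ => ?_)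
      split_ifs <;> simp
    linarith
  have hcardP : (Fintype.card (Equiv.Perm K) : ℝ) = Nat.factorial (Fintype.card K) := by
    rw [Fintype.card_perm]
  have hNle : ∀ σ, (Nat.ceil (τ * w σ / (Y * (1 - μ))) : ℝ) ≤ τ * w σ / (Y * (1 - μ)) + 1 := fun σ =>
    (Nat.ceil_lt_add_one (by have := hw0 σ; positivity)).le
  refine ⟨{σ // good σ}, inferInstance, fun j => j.1, fun j => Nat.ceil (τ * w j.1 / (Y * (1 - μ))), ?_, ?_, ?_, ?_⟩
  · have : (τ : ℝ) ≤ (Y * ∑ j : {σ // good σ}, Nat.ceil (τ * w j.1 / (Y * (1 - μ))) : ℕ) := by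
      push_cast
      calc (τ : ℝ) = τ / (1 - μ) * (1 - μ) := by field_simp
        _ ≤ τ / (1 - μ) * ∑ j : {σ // good σ}, w j.1 := by gcongr
        _ = Y * ∑ j : {σ // good σ}, (τ * w j.1 / (Y * (1 - μ))) := by
          rw [Finset.mul_sum, Finset.mul_sum]
          refine Finset.sum_congr rfl (fun j _ => ?_)
          field_simp
        _ ≤ _ := by
          gcongr
          exact Nat.le_ceil _
    exact_mod_cast this
  · intro j; exact (hgood _).mp j.2
  · intro c c' he
    have hcn : ∀ σ : Equiv.Perm K, (cnt σ c c' : ℝ) = (if σ c = c' then 1 else 0) + (if σ c' = c then 1 else 0) := by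
      intro σ; simp [cnt]
    have hcn2 : ∀ σ : Equiv.Perm K, (cnt σ c c' : ℝ) ≤ 2 := by
      intro σ; rw [hcn]; split_ifs <;> norm_num
    have hcn0 : ∀ σ : Equiv.Perm K, (0 : ℝ) ≤ cnt σ c c' := fun σ => Nat.cast_nonneg _
    have hsum : ∑ σ, w σ * (cnt σ c c' : ℝ) = 2 * W c c' := by
      simp only [hcn, mul_add]
      rw [Finset.sum_add_distrib, hw2 c c' (hne _ _ he), hw2 c' c (hne _ _ he).symm, hWs c' c]; ring
    calc (Y : ℝ) * ∑ j : {σ // good σ}, (Nat.ceil (τ * w j.1 / (Y * (1 - μ))) : ℝ) * (cnt j.1 c c' : ℝ)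
        ≤ Y * ∑ σ : Equiv.Perm K, (Nat.ceil (τ * w σ / (Y * (1 - μ))) : ℝ) * (cnt σ c c' : ℝ) := by
          gcongr
          exact hsuble (fun σ => (Nat.ceil (τ * w σ / (Y * (1 - μ))) : ℝ) * (cnt σ c c' : ℝ)) (fun σ => by positivity)
      _ ≤ Y * ∑ σ : Equiv.Perm K, (τ / (Y * (1 - μ)) * (w σ * (cnt σ c c' : ℝ)) + 2) := by
          gcongr with σ
          have := hNle σ
          have h2 := hcn2 σ
          have h0 := hcn0 σ
          calc _ ≤ (τ * w σ / (Y * (1 - μ)) + 1) * (cnt σ c c' : ℝ) := by gcongr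
            _ = τ / (Y * (1 - μ)) * (w σ * (cnt σ c c' : ℝ)) + cnt σ c c' := by ring
            _ ≤ _ := by linarith
      _ = _ := by
          rw [Finset.sum_add_distrib, ← Finset.mul_sum, hsum, Finset.sum_const, Finset.card_univ, nsmul_eq_mul, hcardP]
          field_simp
  · calc (Y : ℝ) * ∑ j : {σ // good σ}, (Nat.ceil (τ * w j.1 / (Y * (1 - μ))) : ℝ)
        ≤ Y * ∑ σ : Equiv.Perm K, (Nat.ceil (τ * w σ / (Y * (1 - μ))) : ℝ) := by
          gcongr
          exact hsuble (fun σ => (Nat.ceil (τ * w σ / (Y * (1 - μ))) : ℝ)) (fun σ => by positivity)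
      _ ≤ Y * ∑ σ : Equiv.Perm K, (τ / (Y * (1 - μ)) * w σ + 1) := by
          gcongr with σ
          refine (hNle σ).trans (le_of_eq ?_)
          ring
      _ = _ := by
          rw [Finset.sum_add_distrib, ← Finset.mul_sum, hw1, Finset.sum_const, Finset.card_univ, nsmul_eq_mul, hcardP]
          field_simp

end PartB2

section PartB2b

open scoped Classical

theorem combine {V : Type} [Fintype V] [Nonempty V] {G : SimpleGraph V}
    {n Δ L s a load Λ gd τ fa κ t β g g' θ W OV1 OV2 FL TL B capA capF capC capJ X Itot : ℕ} {par : ℕ → ℕ}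
    (hP : ParArr n Δ par) (hn : 0 < n) (hΔ : 1 ≤ Δ) (hL : 3 ≤ L)
    (hs : 1 ≤ s) (ha : 0 < a) (hΛ : 0 < Λ) {K Q : Type} [Fintype K] [Fintype Q] [AddCommGroup Q]
    {R : K → K → ℕ} (H : Host G K Q (Fin a) R fa κ t β g g')
    (hK : 2 ≤ Fintype.card K)
    {Sg : Type} [Fintype Sg] (sg : Sg → Equiv.Perm K) (N : Sg → ℕ)
    (hτ : τ ≤ Fintype.card Q ^ Fintype.card K * ∑ j, N j)
    (hgd0 : 0 < gd) (hgd : ∀ j, gd ≤ (Finset.univ.filter (fun c => H.ed c (sg j c))).card)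
    (hload : n * L + Λ * (n * (Δ + 1)) + gd * L * ((1 + Λ) * ((Δ + 1) * s)) ≤ gd * L * load)
    (hq : load + (Δ + 1) * s ≤ Fintype.card Q * a)
    (hB : B = (Δ + 1) ^ L) (hcA : capA = load / a) (hcF : capF = (Δ + 1) * (load / Λ) / a)
    (hcC : capC = load / Λ + 2 * (n / s) * (Δ + 1) ^ L + 2 ^ (4 * (Δ + 1) ^ L) * a * (Δ + 1) ^ L)
    (hcJ : capJ = 2 * (n / s))
    (hR : ∀ c c', H.ed c c' → capA * (Fintype.card Q ^ Fintype.card K * ∑ j, N j * cnt (sg j) c c') ≤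
      Fintype.card Q ^ 2 * R c c')
    (hX : ∀ c c', H.ed c c' → Fintype.card Q ^ Fintype.card K * ∑ j, N j * cnt (sg j) c c' ≤ X)
    (hI : Fintype.card Q ^ Fintype.card K * ∑ j, N j ≤ Itot)
    (hF : capF * X ≤ Fintype.card Q * FL)
    (hT : (capC + (capA * fa + 4 * t) * B) * X + Itot * capJ ≤ TL)
    (hn4 : 2 * β + FL * (Δ + 1) + OV1 + OV2 ≤ κ)
    (hOV1 : TL < (OV1 + 1) * (θ + 1))
    (hOV2 : 2 * (Itot * capJ) < (OV2 + 1) * (W + 1))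
    (hg1 : θ + 2 * (capC + (capA * fa + 4 * t) * B) ≤ g) (hg2 : θ + capJ ≤ g) (hg3 : W + capJ ≤ g')
    (ht : Δ * t ≤ β) (hJb : capJ ≤ β) (hDb : 2 * (capC + (capA * fa + 4 * t) * B) ≤ β) :
    ∃ φ : Fin τ → ℕ → V,
      (∀ i, Set.InjOn (φ i) {v | v < n}) ∧
      (∀ i, ∀ v, v < n → v ≠ 0 → G.Adj (φ i v) (φ i (par v))) ∧
      (∀ i j, i ≠ j → ∀ v w, v < n → v ≠ 0 → w < n → w ≠ 0 →
        s(φ i v, φ i (par v)) ≠ s(φ j w, φ j (par w))) := by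
  have hq0 : 0 < Fintype.card Q := Fintype.card_pos
  have hpl : ∀ j, Nonempty (Plan n par H.ed (sg j) Q (Fin a) B capA capF capC capJ) := by
    intro j
    obtain ⟨Gd, hGd1, hGd2⟩ := Finset.exists_subset_card_eq (hgd j)
    rw [hB, hcA, hcF, hcC, hcJ]
    refine exists_plan hP hn hΔ hL hs ha hΛ H.ed (sg j) (sg j).injective Gd ?_ ?_ ?_ hq
    · rw [← Finset.card_pos]; omega
    · intro c hc; simpa using hGd1 hc
    · rw [hGd2]; exact hload
  have hIdx : Fintype.card (Idx K Q N) = Fintype.card Q ^ Fintype.card K * ∑ j, N j := by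
    rw [Fintype.card_sigma, Finset.mul_sum]
    refine Finset.sum_congr rfl (fun j _ => ?_)
    rw [Fintype.card_prod, Fintype.card_fun, Fintype.card_fin]
  have hM2 : Fintype.card Q ^ Fintype.card K = Fintype.card Q ^ (Fintype.card K - 2) * Fintype.card Q ^ 2 := by
    rw [← pow_add]; congr 1; omega
  have hM1 : Fintype.card Q ^ Fintype.card K = Fintype.card Q ^ (Fintype.card K - 1) * Fintype.card Q := by
    rw [← pow_succ]; congr 1; omega
  obtain ⟨mo⟩ := exists_mainOut H (fun j => (sg j : K → K)) N (fun j => (hpl j).some) (FL := FL) (TL := TL) hP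
    (by
      intro c c' he
      have h := hR c c' he
      rw [hM2] at h
      have h2 : Fintype.card Q ^ 2 * (capA * Fintype.card Q ^ (Fintype.card K - 2) * ∑ j, N j * cnt (sg j) c c') ≤
        Fintype.card Q ^ 2 * R c c' := by
        refine le_trans (le_of_eq ?_) h; ring
      exact Nat.le_of_mul_le_mul_left h2 (by positivity))
    (by
      intro c c' he
      have h := (Nat.mul_le_mul_left capF (hX c c' he)).trans hF
      rw [hM1] at h
      have h2 : Fintype.card Q * (capF * Fintype.card Q ^ (Fintype.card K - 1) * ∑ j, N j * cnt (sg j) c c') ≤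
        Fintype.card Q * FL := by
        refine le_trans (le_of_eq ?_) h; ring
      exact Nat.le_of_mul_le_mul_left h2 (by positivity))
    (by
      intro c c' he
      refine le_trans ?_ hT
      refine Nat.add_le_add (Nat.mul_le_mul_left _ (hX c c' he)) (Nat.mul_le_mul_right _ ?_)
      rw [hIdx]; exact hI)
  obtain ⟨φ, h1, h2, h3⟩ := compl_all (θ := θ) (W := W) (OV1 := OV1) (OV2 := OV2) hP mo hn4 hOV1
    (lt_of_le_of_lt (Nat.mul_le_mul_left 2 (Nat.mul_le_mul_right _ (by rw [hIdx]; exact hI))) hOV2) hg1 hg2 hg3 ht hJb hDb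
  have hcard : Fintype.card (Fin τ) ≤ Fintype.card (Idx K Q N) := by
    rw [hIdx, Fintype.card_fin]; exact hτ
  obtain ⟨e⟩ := Function.Embedding.nonempty_of_card_le hcard
  exact ⟨fun i => φ (e i), fun i => h1 _, fun i => h2 _, fun i j hij => h3 _ _ (fun h => hij (e.injective h))⟩

end PartB2b

section PartB3a

open scoped Classical

theorem card_interedges_sum {V : Type} (G : SimpleGraph V) (X B : Finset V) :
    (G.interedges X B).card = ∑ x ∈ X, (B.filter (fun u => G.Adj x u)).card := by
  rw [SimpleGraph.interedges_def, Finset.card_filter, Finset.sum_product]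
  refine Finset.sum_congr rfl (fun x _ => ?_)
  rw [Finset.card_filter]

theorem dens_mul {V : Type} (G : SimpleGraph V) (X B : Finset V) :
    (G.edgeDensity X B : ℝ) * (X.card * B.card) = ∑ x ∈ X, ((B.filter (fun u => G.Adj x u)).card : ℝ) := by
  have h := card_interedges_sum G X B
  rw [← Nat.cast_sum, ← h, SimpleGraph.edgeDensity_def]
  push_cast
  by_cases h0 : ((X.card : ℝ) * B.card) = 0
  · rw [h0, mul_zero]
    symm
    have h1 : (G.interedges X B).card ≤ X.card * B.card := Rel.card_interedges_le_mul _ _ _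
    have h2 : ((G.interedges X B).card : ℝ) ≤ X.card * B.card := by exact_mod_cast h1
    rw [h0] at h2
    exact le_antisymm h2 (by positivity)
  · exact div_mul_cancel₀ _ h0

theorem few_low {V : Type} (G : SimpleGraph V) {ε d0 : ℝ} {A A' X B : Finset V} (hε : 0 < ε) (hA : 0 < A.card)
    (hu : G.IsUniform ε A A') (hd : d0 ≤ (G.edgeDensity A A' : ℝ)) (hX : X ⊆ A) (hB : B ⊆ A')
    (hBc : A'.card * ε ≤ B.card)
    (h : ∀ x ∈ X, ((B.filter (fun u => G.Adj x u)).card : ℝ) < (d0 - ε) * B.card) : (X.card : ℝ) < A.card * ε := by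
  by_contra hh
  push Not at hh
  have h1 := hu hX hB hh hBc
  have hAr : (0 : ℝ) < A.card := by exact_mod_cast hA
  have hXr : (0 : ℝ) < X.card := lt_of_lt_of_le (by positivity) hh
  have hXn : X.Nonempty := by rw [← Finset.card_pos]; exact_mod_cast hXr
  have h2 := dens_mul G X B
  have h3 : ∑ x ∈ X, ((B.filter (fun u => G.Adj x u)).card : ℝ) < ∑ x ∈ X, (d0 - ε) * B.card :=
    Finset.sum_lt_sum_of_nonempty hXn h
  rw [Finset.sum_const, nsmul_eq_mul, ← h2] at h3
  have h4 : d0 - ε < (G.edgeDensity X B : ℝ) := by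
    rw [abs_lt] at h1; linarith
  have h5 : (0 : ℝ) ≤ X.card * B.card := by positivity
  nlinarith

theorem few_high {V : Type} (G : SimpleGraph V) {ε : ℝ} {A A' X B : Finset V} (hε : 0 < ε) (hA : 0 < A.card)
    (hu : G.IsUniform ε A A') (hX : X ⊆ A) (hB : B ⊆ A')
    (hBc : A'.card * ε ≤ B.card)
    (h : ∀ x ∈ X, ((G.edgeDensity A A' : ℝ) + ε) * B.card < ((B.filter (fun u => G.Adj x u)).card : ℝ)) :
    (X.card : ℝ) < A.card * ε := by
  by_contra hh
  push Not at hh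
  have h1 := hu hX hB hh hBc
  have hAr : (0 : ℝ) < A.card := by exact_mod_cast hA
  have hXr : (0 : ℝ) < X.card := lt_of_lt_of_le (by positivity) hh
  have hXn : X.Nonempty := by rw [← Finset.card_pos]; exact_mod_cast hXr
  have h2 := dens_mul G X B
  have h3 : ∑ x ∈ X, ((G.edgeDensity A A' : ℝ) + ε) * B.card < ∑ x ∈ X, ((B.filter (fun u => G.Adj x u)).card : ℝ) :=
    Finset.sum_lt_sum_of_nonempty hXn h
  rw [Finset.sum_const, nsmul_eq_mul, ← h2] at h3
  have h4 : (G.edgeDensity X B : ℝ) < (G.edgeDensity A A' : ℝ) + ε := by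
    rw [abs_lt] at h1; linarith
  have h5 : (0 : ℝ) ≤ X.card * B.card := by positivity
  nlinarith

theorem card_filter_embed {V : Type} {a : ℕ} (f : Fin a → V) (hf : Function.Injective f) (P : V → Prop) :
    (Finset.univ.filter (fun x => P (f x))).card = ((Finset.univ.image f).filter P).card := by
  rw [Finset.filter_image, Finset.card_image_of_injective _ hf]

theorem atom_matchings {V : Type} (G : SimpleGraph V) {ε δ : ℝ} {A A' : Finset V} {a : ℕ} (hε : 0 < ε)
    (hu : G.IsUniform ε A A') (hA : 0 < A.card) (hA' : 0 < A'.card)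
    (f f' : Fin a → V) (hf : Function.Injective f) (hf' : Function.Injective f')
    (hfA : ∀ x, f x ∈ A) (hfA' : ∀ x, f' x ∈ A') (hδ : 0 < δ)
    (hδd : δ ≤ (G.edgeDensity A A' : ℝ)) (ha : A.card * ε ≤ a) (ha' : A'.card * ε ≤ a)
    (hmain : 2 * ε * a + 1 + A.card * ε + A'.card * ε ≤ δ ^ 2 * a) :
    ∃ (π : ℕ → Equiv.Perm (Fin a)) (real : ℕ → Fin a → Prop),
      (∀ k x, k < Nat.ceil (((G.edgeDensity A A' : ℝ) + ε) * a) - Nat.floor (δ * a) → real k x → G.Adj (f x) (f' (π k x))) ∧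
      (∀ k k' x, k < Nat.ceil (((G.edgeDensity A A' : ℝ) + ε) * a) - Nat.floor (δ * a) →
        k' < Nat.ceil (((G.edgeDensity A A' : ℝ) + ε) * a) - Nat.floor (δ * a) →
        real k x → real k' x → π k x = π k' x → k = k') ∧
      (∀ k, k < Nat.ceil (((G.edgeDensity A A' : ℝ) + ε) * a) - Nat.floor (δ * a) →
        (Finset.univ.filter (fun x => ¬ real k x)).card ≤ Nat.floor (δ * a)) := by
  have hfin : Nonempty (Fin a → Prop) := ⟨fun _ => True⟩
  set d : ℝ := (G.edgeDensity A A' : ℝ) with hd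
  set D := Nat.ceil ((d + ε) * a) with hD
  set r := Nat.floor (δ * a) with hr
  have hApos : (0 : ℝ) < A.card := by exact_mod_cast hA
  have har : (0 : ℝ) < a := lt_of_lt_of_le (by positivity) ha
  have hd0 : 0 < d := lt_of_lt_of_le hδ hδd
  have hDge : (d + ε) * a ≤ D := Nat.le_ceil _
  have hDle : (D : ℝ) ≤ (d + ε) * a + 1 := (Nat.ceil_lt_add_one (by positivity)).le
  have hrge : δ * a < r + 1 := Nat.lt_floor_add_one _
  have hrle : (r : ℝ) ≤ δ * a := Nat.floor_le (by positivity)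
  have hrD : r ≤ D := by
    have : (r : ℝ) ≤ D := by nlinarith
    exact_mod_cast this
  set I := Finset.univ.image f with hI
  set I' := Finset.univ.image f' with hI'
  have hIA : I ⊆ A := by
    intro v hv; simp only [hI, Finset.mem_image, Finset.mem_univ, true_and] at hv
    obtain ⟨x, rfl⟩ := hv; exact hfA x
  have hIA' : I' ⊆ A' := by
    intro v hv; simp only [hI', Finset.mem_image, Finset.mem_univ, true_and] at hv
    obtain ⟨x, rfl⟩ := hv; exact hfA' x
  have hIc : I.card = a := by rw [hI, Finset.card_image_of_injective _ hf]; simp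
  have hIc' : I'.card = a := by rw [hI', Finset.card_image_of_injective _ hf']; simp
  obtain ⟨hi, hhi⟩ : ∃ hi : Fin a → Prop, ∀ x, hi x ↔ D < (Finset.univ.filter (fun y => G.Adj (f x) (f' y))).card :=
    ⟨_, fun _ => Iff.rfl⟩
  obtain ⟨hi', hhi'⟩ : ∃ hi' : Fin a → Prop, ∀ y, hi' y ↔ D < (Finset.univ.filter (fun x => G.Adj (f x) (f' y))).card :=
    ⟨_, fun _ => Iff.rfl⟩
  have hcnt : ∀ v, (Finset.univ.filter (fun y => G.Adj v (f' y))).card = (I'.filter (fun u => G.Adj v u)).card :=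
    fun v => card_filter_embed f' hf' (fun u => G.Adj v u)
  have hcnt' : ∀ v, (Finset.univ.filter (fun x => G.Adj (f x) v)).card = (I.filter (fun u => G.Adj v u)).card := by
    intro v
    rw [← card_filter_embed f hf (fun u => G.Adj v u)]
    congr 1; ext x; simp [SimpleGraph.adj_comm]
  have hbad : ((Finset.univ.filter hi).card : ℝ) ≤ A.card * ε := by
    have h1 : ((Finset.univ.filter hi).image f).card = (Finset.univ.filter hi).card := Finset.card_image_of_injective _ hf
    rw [← h1]
    refine (few_high G hε hA hu (B := I') ?_ hIA' (by rw [hIc']; exact ha') ?_).le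
    · exact (Finset.image_subset_image (Finset.filter_subset _ _)).trans hIA
    · intro v hv
      simp only [Finset.mem_image, Finset.mem_filter, Finset.mem_univ, true_and] at hv
      obtain ⟨x, hx, rfl⟩ := hv
      rw [hhi, hcnt] at hx
      rw [hIc']
      exact lt_of_le_of_lt hDge (by exact_mod_cast hx)
  have hbad' : ((Finset.univ.filter hi').card : ℝ) ≤ A'.card * ε := by
    have h1 : ((Finset.univ.filter hi').image f').card = (Finset.univ.filter hi').card := Finset.card_image_of_injective _ hf'
    rw [← h1]
    refine (few_high G hε hA' hu.symm (B := I) ?_ hIA (by rw [hIc]; exact ha) ?_).le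
    · exact (Finset.image_subset_image (Finset.filter_subset _ _)).trans hIA'
    · intro v hv
      simp only [Finset.mem_image, Finset.mem_filter, Finset.mem_univ, true_and] at hv
      obtain ⟨x, hx, rfl⟩ := hv
      rw [hhi', hcnt'] at hx
      rw [hIc, SimpleGraph.edgeDensity_comm]
      exact lt_of_le_of_lt hDge (by exact_mod_cast hx)
  obtain ⟨E, hE⟩ : ∃ E : Fin a → Fin a → Prop, ∀ x y, E x y ↔ G.Adj (f x) (f' y) ∧ ¬ hi x ∧ ¬ hi' y := ⟨_, fun _ _ => Iff.rfl⟩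
  have htot : (d - ε) * (a * a) ≤ ((Finset.univ.filter (fun p : Fin a × Fin a => G.Adj (f p.1) (f' p.2))).card : ℝ) := by
    have h1 := hu hIA hIA' (by rw [hIc]; exact ha) (by rw [hIc']; exact ha')
    have h2 := dens_mul G I I'
    rw [abs_lt] at h1
    have h3 : ∑ x ∈ I, ((I'.filter (fun u => G.Adj x u)).card : ℝ) =
        ((Finset.univ.filter (fun p : Fin a × Fin a => G.Adj (f p.1) (f' p.2))).card : ℝ) := by
      rw [hI, Finset.sum_image (fun x _ y _ h => hf h)]
      rw [Finset.card_filter, ← Finset.univ_product_univ, Finset.sum_product]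
      push_cast
      refine Finset.sum_congr rfl (fun x _ => ?_)
      rw [← hcnt, Finset.card_filter]
      push_cast; rfl
    rw [← h3, ← h2, hIc, hIc']
    have : (0 : ℝ) ≤ a * a := by positivity
    refine mul_le_mul_of_nonneg_right ?_ this
    linarith [h1.1]
  have hEc : (d - ε) * (a * a) - A.card * ε * a - A'.card * ε * a ≤ ((Finset.univ.filter (fun p : Fin a × Fin a => E p.1 p.2)).card : ℝ) := by
    have hsub : Finset.univ.filter (fun p : Fin a × Fin a => G.Adj (f p.1) (f' p.2)) ⊆
        (Finset.univ.filter (fun p : Fin a × Fin a => E p.1 p.2) ∪ (Finset.univ.filter hi) ×ˢ Finset.univ) ∪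
          Finset.univ ×ˢ (Finset.univ.filter hi') := by
      intro p hp
      simp only [Finset.mem_filter, Finset.mem_univ, true_and, Finset.mem_union, Finset.mem_product, and_true, hE] at hp ⊢
      tauto
    have h1 := Finset.card_le_card hsub
    have h2 := h1.trans (Finset.card_union_le _ _)
    have h3 := h2.trans (Nat.add_le_add_right (Finset.card_union_le _ _) _)
    rw [Finset.card_product, Finset.card_product, Finset.card_univ, Fintype.card_fin] at h3
    have h4 : ((Finset.univ.filter (fun p : Fin a × Fin a => G.Adj (f p.1) (f' p.2))).card : ℝ) ≤
      ((Finset.univ.filter (fun p : Fin a × Fin a => E p.1 p.2)).card : ℝ) + (Finset.univ.filter hi).card * a + a * (Finset.univ.filter hi').card := by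
      exact_mod_cast h3
    nlinarith
  have hmono : ∀ X Y : Finset (Fin a), X ⊆ Y → Y.card ≤ D → X.card ≤ D := fun X Y h h2 => (Finset.card_le_card h).trans h2
  obtain ⟨π, real, p1, p2, p3⟩ := exists_matchings (a := a) (D := D) (R := D - r) (fa := r) E
    (by
      intro x
      by_cases hx : hi x
      · have : (Finset.univ.filter (fun y => E x y)) = ∅ := by
          ext y; simp [hE, hx]
        simp only [hE, hx, not_true, false_and, and_false, Finset.filter_false, Finset.card_empty, Nat.zero_le]
      · refine hmono _ (Finset.univ.filter (fun y => G.Adj (f x) (f' y))) ?_ ?_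
        · intro y hy
          simp only [Finset.mem_filter, Finset.mem_univ, true_and, hE] at hy ⊢
          exact hy.1
        · rw [hhi] at hx; omega)
    (by
      intro y
      by_cases hy : hi' y
      · simp only [hE, hy, not_true, and_false, Finset.filter_false, Finset.card_empty, Nat.zero_le]
      · refine hmono _ (Finset.univ.filter (fun x => G.Adj (f x) (f' y))) ?_ ?_
        · intro x hx
          simp only [Finset.mem_filter, Finset.mem_univ, true_and, hE] at hx ⊢
          exact hx.1
        · rw [hhi'] at hy; omega)
    (Nat.sub_le _ _)
    (by
      have e : D - (D - r) + 1 = r + 1 := by omega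
      rw [e]
      have : ((D * a : ℕ) : ℝ) < (((Finset.univ.filter (fun p : Fin a × Fin a => E p.1 p.2)).card + (r + 1) * (r + 1) : ℕ) : ℝ) := by
        push_cast
        have h1 : (δ * a) * (δ * a) < ((r : ℝ) + 1) * (r + 1) := by
          have : 0 < δ * a := by positivity
          nlinarith
        have h2 : (D : ℝ) * a ≤ ((d + ε) * a + 1) * a := by gcongr
        have h3 := mul_le_mul_of_nonneg_right hmain har.le
        nlinarith
      have h5 : D * a < (Finset.univ.filter (fun p : Fin a × Fin a => E p.1 p.2)).card + (r + 1) * (r + 1) := by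
        exact_mod_cast this
      convert h5)
  refine ⟨fun k => if h : k < D - r then π ⟨k, h⟩ else 1, fun k x => if h : k < D - r then real ⟨k, h⟩ x else True, ?_, ?_, ?_⟩
  · intro k x hk
    simp only [hk, dif_pos]
    intro h
    exact ((hE _ _).mp (p1 _ _ h)).1
  · intro k k' x hk hk'
    simp only [hk, hk', dif_pos]
    intro h1 h2 h3
    have := p2 _ _ _ h1 h2 h3
    simpa using this
  · intro k hk
    simp only [hk, dif_pos]
    have := p3 ⟨k, hk⟩
    convert this

end PartB3a

section PartB3b

open scoped Classical

theorem host_of_parts {V : Type} [Fintype V] (G : SimpleGraph V) {M a b m κ t β g g' : ℕ} (A : Fin M → Finset V)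
    (hdisj : ∀ c c', c ≠ c' → Disjoint (A c) (A c')) (hAm : ∀ c, m ≤ (A c).card) (hAm' : ∀ c, (A c).card ≤ m + 1)
    (hm : 0 < m) {Q : Type} [Fintype Q] (hab : Fintype.card Q * a + 2 * b ≤ m) {ε δ d0 : ℝ} (hε : 0 < ε) (hδ : 0 < δ)
    (hδd : δ ≤ d0) (hεd : ε ≤ d0) (ha : ((m : ℝ) + 1) * ε ≤ a)
    (hmain : 2 * ε * a + 1 + 2 * (((m : ℝ) + 1) * ε) ≤ δ ^ 2 * a)
    (hκb : κ ≤ b) (hκ : (κ : ℝ) ≤ (d0 - ε) * b) (hb : ((m : ℝ) + 1) * ε ≤ b) (ht : ((m : ℝ) + 1) * ε ≤ t)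
    (hβ : ((m : ℝ) + 1) * ε ≤ β) (hg : (g : ℝ) ≤ (d0 - ε) * β)
    (hole : ∀ B : Finset V, β ≤ B.card → ∀ X : Finset V,
      (∀ v ∈ X, (B.filter (fun u => G.Adj v u)).card < g') → X.card ≤ t) :
    ∃ H : Host G (Fin M) Q (Fin a)
      (fun c c' => Nat.ceil (((G.edgeDensity (A c) (A c') : ℝ) + ε) * a) - Nat.floor (δ * a))
      (Nat.floor (δ * a)) κ t β g g',
      ∀ c c', H.ed c c' ↔ (c ≠ c' ∧ G.IsUniform ε (A c) (A c') ∧ d0 ≤ (G.edgeDensity (A c) (A c') : ℝ)) := by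
  have hemb : ∀ c, ∃ e : (Q × Fin a) ⊕ (Bool × Fin b) → V, Function.Injective e ∧ ∀ p, e p ∈ A c := by
    intro c
    have : Fintype.card ((Q × Fin a) ⊕ (Bool × Fin b)) ≤ Fintype.card {v // v ∈ A c} := by
      rw [Fintype.card_sum, Fintype.card_prod, Fintype.card_prod, Fintype.card_fin, Fintype.card_fin, Fintype.card_bool,
        Fintype.card_coe]
      exact hab.trans (hAm c)
    obtain ⟨e⟩ := Function.Embedding.nonempty_of_card_le this
    exact ⟨fun p => (e p).1, fun p p' h => e.injective (Subtype.ext h), fun p => (e p).2⟩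
  choose e he1 he2 using hemb
  have heq : ∀ c c' p p', e c p = e c' p' → c = c' ∧ p = p' := by
    intro c c' p p' h
    have hc : c = c' := by
      by_contra hh
      exact Finset.disjoint_left.mp (hdisj c c' hh) (he2 c p) (h ▸ he2 c' p')
    subst hc
    exact ⟨rfl, he1 c h⟩
  have hApos : ∀ c, 0 < (A c).card := fun c => lt_of_lt_of_le hm (hAm c)
  have hAr : ∀ c, ((A c).card : ℝ) * ε ≤ ((m : ℝ) + 1) * ε := by
    intro c
    have : ((A c).card : ℝ) ≤ (m : ℝ) + 1 := by exact_mod_cast hAm' c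
    gcongr
  obtain ⟨ed, hed⟩ : ∃ ed : Fin M → Fin M → Prop, ∀ c c', ed c c' ↔
    (c ≠ c' ∧ G.IsUniform ε (A c) (A c') ∧ d0 ≤ (G.edgeDensity (A c) (A c') : ℝ)) := ⟨_, fun _ _ => Iff.rfl⟩
  obtain ⟨R, hR⟩ : ∃ R : Fin M → Fin M → ℕ, R = (fun c c' => Nat.ceil (((G.edgeDensity (A c) (A c') : ℝ) + ε) * a) - Nat.floor (δ * a)) :=
    ⟨_, rfl⟩
  have hRs : ∀ c c', R c c' = R c' c := by
    intro c c'; rw [hR]; simp only; rw [SimpleGraph.edgeDensity_comm]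
  have heds : ∀ c c', ed c c' → ed c' c := by
    intro c c' h
    rw [hed] at h ⊢
    exact ⟨h.1.symm, h.2.1.symm, by rw [SimpleGraph.edgeDensity_comm]; exact h.2.2⟩
  have hmat : ∀ c c' (x y : Q), ∃ (π : ℕ → Equiv.Perm (Fin a)) (real : ℕ → Fin a → Prop), ed c c' →
      ((∀ k z, k < R c c' → real k z → G.Adj (e c (Sum.inl (x, z))) (e c' (Sum.inl (y, π k z)))) ∧
      (∀ k k' z, k < R c c' → k' < R c c' → real k z → real k' z → π k z = π k' z → k = k') ∧
      (∀ k, k < R c c' → ∀ Z : Finset (Fin a), (∀ z ∈ Z, ¬ real k z) → Z.card ≤ Nat.floor (δ * a))) := by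
    intro c c' x y
    by_cases h : ed c c'
    · have h' := (hed c c').mp h
      obtain ⟨π, real, p1, p2, p3⟩ := atom_matchings G (δ := δ) (a := a) hε h'.2.1 (hApos c) (hApos c')
        (fun z => e c (Sum.inl (x, z))) (fun z => e c' (Sum.inl (y, z)))
        (fun z z' hh => by simpa using he1 c hh) (fun z z' hh => by simpa using he1 c' hh)
        (fun z => he2 _ _) (fun z => he2 _ _) hδ (hδd.trans h'.2.2) ((hAr c).trans ha) ((hAr c').trans ha)
        (by have := hAr c; have := hAr c'; linarith)
      refine ⟨π, real, fun _ => ⟨?_, ?_, ?_⟩⟩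
      · rw [hR]; exact p1
      · rw [hR]; exact p2
      · rw [hR]; intro k hk Z hZ
        refine (Finset.card_le_card ?_).trans (p3 k hk)
        intro z hz; simpa using hZ z hz
    · exact ⟨fun _ => 1, fun _ _ => True, fun hh => absurd hh h⟩
  choose π rl hmt using hmat
  obtain ⟨zone, hzone⟩ : ∃ zone : Fin M → Bool → Finset V, ∀ c bb v, v ∈ zone c bb ↔ ∃ i, e c (Sum.inr (bb, i)) = v :=
    ⟨fun c bb => Finset.univ.image (fun i => e c (Sum.inr (bb, i))), fun c bb v => by simp⟩
  have hzA : ∀ c bb, zone c bb ⊆ A c := by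
    intro c bb v hv
    obtain ⟨i, rfl⟩ := (hzone _ _ _).mp hv
    exact he2 _ _
  have hzc : ∀ c bb, (zone c bb).card = b := by
    intro c bb
    have : zone c bb = Finset.univ.image (fun i => e c (Sum.inr (bb, i))) := by
      ext v; rw [hzone]; simp
    rw [this, Finset.card_image_of_injective]
    · simp
    · intro i i' h; simpa using he1 c h
  have hcardt : ∀ X : Finset V, ∀ c, (X.card : ℝ) < (A c).card * ε → X.card ≤ t := by
    intro X c h
    have : (X.card : ℝ) ≤ t := (h.le.trans (hAr c)).trans ht
    exact_mod_cast this
  have hle : ∀ {B : Finset V}, β ≤ B.card → (g : ℝ) ≤ (d0 - ε) * B.card := by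
    intro B hB
    refine hg.trans ?_
    have : (β : ℝ) ≤ B.card := by exact_mod_cast hB
    have : 0 ≤ d0 - ε := by linarith
    gcongr
  have H : Σ' H : Host G (Fin M) Q (Fin a) R (Nat.floor (δ * a)) κ t β g g', H.ed = ed := {
    fst := {
      ed := ed
      mn := fun c x z => e c (Sum.inl (x, z))
      zone := zone
      col := fun c c' x y k => if c < c' then π c c' x y k else (π c' c y x k).symm
      real := fun c c' x y k z => if c < c' then rl c c' x y k z else rl c' c y x k ((π c' c y x k).symm z)
      ed_symm := heds
      ed_ne := fun c c' h => ((hed c c').mp h).1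
      R_symm := hRs
      mn_inj := by
        intro c x z c' x' z' h
        have := heq _ _ _ _ h
        simpa using this
      zone_disj := by
        intro c bb c' bb' h
        rw [Finset.disjoint_left]
        intro v hv hv'
        obtain ⟨i, hi⟩ := (hzone _ _ _).mp hv
        obtain ⟨i', hi'⟩ := (hzone _ _ _).mp hv'
        have := heq _ _ _ _ (hi.trans hi'.symm)
        simp at this
        exact h (by rw [this.1, this.2.1])
      mn_zone := by
        intro c x z c' bb hv
        obtain ⟨i, hi⟩ := (hzone _ _ _).mp hv
        have := heq _ _ _ _ hi
        simp at this
      zone_card := fun c bb => by rw [hzc]; exact hκb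
      col_symm := by
        intro c c' h x y k z
        have hne := ((hed c c').mp h).1
        rcases lt_or_gt_of_ne hne with hlt | hlt
        · simp [hlt, hlt.not_gt]
        · simp [hlt, hlt.not_gt]
      real_symm := by
        intro c c' h x y k z
        have hne := ((hed c c').mp h).1
        rcases lt_or_gt_of_ne hne with hlt | hlt
        · simp [hlt, hlt.not_gt]
        · simp [hlt, hlt.not_gt]
      real_adj := by
        intro c c' h x y k z hk
        have hne := ((hed c c').mp h).1
        rcases lt_or_gt_of_ne hne with hlt | hlt
        · simp only [hlt, if_true]
          exact (hmt c c' x y h).1 k z hk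
        · simp only [hlt.not_gt, if_false]
          intro hr
          have := (hmt c' c y x (heds _ _ h)).1 k _ (by rw [hRs]; exact hk) hr
          rw [Equiv.apply_symm_apply] at this
          exact this.symm
      real_uniq := by
        intro c c' h x y k k' z hk hk'
        have hne := ((hed c c').mp h).1
        rcases lt_or_gt_of_ne hne with hlt | hlt
        · simp only [hlt, if_true]
          exact (hmt c c' x y h).2.1 k k' z hk hk'
        · simp only [hlt.not_gt, if_false]
          intro hr hr' heqq
          refine (hmt c' c y x (heds _ _ h)).2.1 k k' _ (by rw [hRs]; exact hk) (by rw [hRs]; exact hk') hr (heqq ▸ hr') ?_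
          rw [Equiv.apply_symm_apply, heqq, Equiv.apply_symm_apply]
      real_card := by
        intro c c' h x y k hk
        have hne := ((hed c c').mp h).1
        rcases lt_or_gt_of_ne hne with hlt | hlt
        · simp only [hlt, if_true]
          exact (hmt c c' x y h).2.2 k hk _ (fun z hz => by simpa using hz)
        · simp only [hlt.not_gt, if_false]
          rw [← Finset.card_image_of_injective _ (π c' c y x k).symm.injective]
          refine (hmt c' c y x (heds _ _ h)).2.2 k (by rw [hRs]; exact hk) _ (fun z hz => ?_)
          rw [Finset.mem_image] at hz
          obtain ⟨w, hw, rfl⟩ := hz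
          simpa using hw
      typ := by
        intro c c' h bb
        have h' := (hed c c').mp h
        have hinj : Function.Injective (fun p : Q × Fin a => e c (Sum.inl p)) := fun p p' hh => by simpa using he1 c hh
        rw [← Finset.card_image_of_injective _ hinj]
        refine hcardt _ c (few_low G hε (hApos c) h'.2.1 h'.2.2 (B := zone c' bb) ?_ (hzA _ _) ?_ ?_)
        · intro v hv
          rw [Finset.mem_image] at hv
          obtain ⟨w, hw, rfl⟩ := hv
          exact he2 _ _
        · rw [hzc]; exact (hAr c').trans hb
        · intro v hv
          rw [Finset.mem_image] at hv
          obtain ⟨w, hw, rfl⟩ := hv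
          rw [Finset.mem_filter] at hw
          rw [hzc]
          refine lt_of_lt_of_le ?_ hκ
          have hw2 := hw.2
          exact_mod_cast hw2
      h2 := by
        intro c c' h bb bb' B hB hβB
        have h' := (hed c c').mp h
        refine hcardt _ c (few_low G hε (hApos c) h'.2.1 h'.2.2 (B := B) ?_ (hB.trans (hzA _ _)) ?_ ?_)
        · exact (Finset.filter_subset _ _).trans (hzA _ _)
        · exact ((hAr c').trans hβ).trans (by exact_mod_cast hβB)
        · intro v hv
          rw [Finset.mem_filter] at hv
          refine lt_of_lt_of_le ?_ (hle hβB)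
          have hw2 := hv.2
          exact_mod_cast hw2
      h4 := by
        intro c B _ hβB
        exact hole B hβB _ (fun v hv => by simpa using hv) }
    snd := rfl }
  rw [← hR]
  refine ⟨H.1, ?_⟩
  rw [H.2]; exact hed

end PartB3b

section PartB3c

open scoped Classical

theorem no_hole {V : Type} [Fintype V] (G : SimpleGraph V) {h0 : ℕ} (hb : biIndep G ≤ h0) (S T : Finset V)
    (hST : Disjoint S T) (hS : h0 + 1 ≤ S.card) (hT : h0 + 1 ≤ T.card) (hno : ∀ a ∈ S, ∀ b ∈ T, ¬ G.Adj a b) : False := by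
  have hmem : h0 + 1 ∈ {r : ℕ | ∀ s t : ℕ, s + t = r → HasBipartiteHole G s t} := by
    intro s t hst
    obtain ⟨S', hS1, hS2⟩ := Finset.exists_subset_card_eq (show s ≤ S.card by omega)
    obtain ⟨T', hT1, hT2⟩ := Finset.exists_subset_card_eq (show t ≤ T.card by omega)
    exact ⟨S', T', Finset.disjoint_of_subset_left hS1 (Finset.disjoint_of_subset_right hT1 hST), hS2, hT2,
      fun a ha b hb => hno a (hS1 ha) b (hT1 hb)⟩
  have hbdd : BddAbove {r : ℕ | ∀ s t : ℕ, s + t = r → HasBipartiteHole G s t} := by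
    refine ⟨Fintype.card V, ?_⟩
    intro r hr
    obtain ⟨S', T', _, h2, _⟩ := hr r 0 (by simp)
    rw [← h2]; exact Finset.card_le_univ _
  have := le_csSup hbdd hmem
  unfold biIndep at hb
  omega

theorem hole_lemma {V : Type} [Fintype V] (G : SimpleGraph V) {h0 β t g' : ℕ} (hb : biIndep G ≤ h0)
    (hβ : g' * (2 * (h0 + 1)) ≤ β) (ht : g' * (h0 + 1) ≤ t) (B : Finset V) (hB : β ≤ B.card) (X : Finset V)
    (hX : ∀ v ∈ X, (B.filter (fun u => G.Adj v u)).card < g') : X.card ≤ t := by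
  by_contra hh
  push Not at hh
  have hc : Fintype.card (Fin g' × Fin (2 * (h0 + 1))) ≤ Fintype.card {v // v ∈ B} := by
    rw [Fintype.card_prod, Fintype.card_fin, Fintype.card_fin, Fintype.card_coe]; omega
  obtain ⟨e⟩ := Function.Embedding.nonempty_of_card_le hc
  have hfree : ∀ v ∈ X, ∃ i : Fin g', ∀ j, ¬ G.Adj v (e (i, j)).1 := by
    intro v hv
    by_contra hcon
    push Not at hcon
    choose f hf using hcon
    have hi : Function.Injective (fun i => (e (i, f i)).1) := by
      intro i i' h
      have := e.injective (Subtype.ext h)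
      simp at this
      exact this.1
    have h1 : (Finset.univ.image (fun i => (e (i, f i)).1)) ⊆ B.filter (fun u => G.Adj v u) := by
      intro u hu
      simp only [Finset.mem_image, Finset.mem_univ, true_and] at hu
      obtain ⟨i, rfl⟩ := hu
      simp only [Finset.mem_filter]
      exact ⟨(e (i, f i)).2, hf i⟩
    have h2 := Finset.card_le_card h1
    rw [Finset.card_image_of_injective _ hi, Finset.card_univ, Fintype.card_fin] at h2
    have := hX v hv
    omega
  have hfr : ∀ v, ∃ i : Option (Fin g'), v ∈ X → ∃ i', i = some i' ∧ ∀ j, ¬ G.Adj v (e (i', j)).1 := by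
    intro v
    by_cases hv : v ∈ X
    · obtain ⟨i, hi⟩ := hfree v hv
      exact ⟨some i, fun _ => ⟨i, rfl, hi⟩⟩
    · exact ⟨none, fun h => absurd h hv⟩
  choose f hf using hfr
  have hpig : ∃ i ∈ (Finset.univ : Finset (Fin g')).image some, h0 + 1 < (X.filter (fun v => f v = i)).card + 1 := by
    by_contra hcon
    push Not at hcon
    have h3 := Finset.card_le_mul_card_image_of_maps_to (s := X) (t := (Finset.univ : Finset (Fin g')).image some) (f := f)
      (fun v hv => by
        obtain ⟨i, hi, _⟩ := hf v hv
        simp [hi]) (h0) (fun i hi => by have := hcon i hi; omega)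
    rw [Finset.card_image_of_injective _ (Option.some_injective _), Finset.card_univ, Fintype.card_fin] at h3
    nlinarith
  obtain ⟨i, hi, hic⟩ := hpig
  simp only [Finset.mem_image, Finset.mem_univ, true_and] at hi
  obtain ⟨i, rfl⟩ := hi
  obtain ⟨X', hX1, hX2⟩ := Finset.exists_subset_card_eq (show h0 + 1 ≤ (X.filter (fun v => f v = some i)).card by omega)
  have hBi : (Finset.univ.image (fun j => (e (i, j)).1)).card = 2 * (h0 + 1) := by
    rw [Finset.card_image_of_injective, Finset.card_univ, Fintype.card_fin]
    intro j j' h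
    have := e.injective (Subtype.ext h)
    simpa using this
  refine no_hole G hb X' (Finset.univ.image (fun j => (e (i, j)).1) \ X') Finset.disjoint_sdiff (by omega) ?_ ?_
  · have := Finset.le_card_sdiff X' (Finset.univ.image (fun j => (e (i, j)).1))
    omega
  · intro v hv u hu
    simp only [Finset.mem_sdiff, Finset.mem_image, Finset.mem_univ, true_and] at hu
    obtain ⟨⟨j, rfl⟩, _⟩ := hu
    have := hX1 hv
    rw [Finset.mem_filter] at this
    obtain ⟨i', h1, h2⟩ := hf v this.1
    rw [this.2] at h1
    simp only [Option.some.injEq] at h1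
    subst h1
    exact h2 j

end PartB3c

section PartB4

open scoped Classical

theorem reg_parts_raw {V : Type} [Fintype V] (G : SimpleGraph V) {ε : ℝ} (hε : 0 < ε) {l : ℕ}
    (hl : l ≤ Fintype.card V) (hl0 : 0 < l) :
    ∃ M : ℕ, l ≤ M ∧ M ≤ SzemerediRegularity.bound ε l ∧ ∃ A : Fin M → Finset V,
      (∀ c c', c ≠ c' → Disjoint (A c) (A c')) ∧ (∀ c, Fintype.card V / M ≤ (A c).card) ∧
      (∀ c, (A c).card ≤ Fintype.card V / M + 1) ∧ (∀ v, ∃ c, v ∈ A c) ∧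
      ((Finset.univ.filter (fun p : Fin M × Fin M => p.1 ≠ p.2 ∧ ¬ G.IsUniform ε (A p.1) (A p.2))).card : ℝ) ≤ M ^ 2 * ε := by
  obtain ⟨P, h1, h2, h3, h4⟩ := szemeredi_regularity G hε hl
  refine ⟨P.parts.card, h2, h3, fun i => (P.parts.equivFin.symm i).1, ?_, ?_, ?_, ?_, ?_⟩
  · intro c c' hc
    refine P.disjoint (P.parts.equivFin.symm c).2 (P.parts.equivFin.symm c').2 ?_
    intro h
    exact hc (P.parts.equivFin.symm.injective (Subtype.ext h))
  · intro c
    have := h1.average_le_card_part (P.parts.equivFin.symm c).2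
    simpa using this
  · intro c
    have := h1.card_part_le_average_add_one (P.parts.equivFin.symm c).2
    simpa using this
  · intro v
    obtain ⟨s, hs, hv⟩ := P.exists_mem (Finset.mem_univ v)
    exact ⟨P.parts.equivFin ⟨s, hs⟩, by simpa using hv⟩
  · have h5 : ((P.nonUniforms G ε).card : ℝ) ≤ (P.parts.card * (P.parts.card - 1) : ℕ) * ε := h4
    have h6 : ((P.parts.card * (P.parts.card - 1) : ℕ) : ℝ) ≤ (P.parts.card : ℝ) ^ 2 := by
      rw [sq]; exact_mod_cast Nat.mul_le_mul_left _ (Nat.sub_le _ _)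
    have h7 : ((P.parts.card * (P.parts.card - 1) : ℕ) : ℝ) * ε ≤ (P.parts.card : ℝ) ^ 2 * ε := by gcongr
    refine le_trans ?_ (h5.trans h7)
    norm_cast
    refine Finset.card_le_card_of_injOn (fun p => ((P.parts.equivFin.symm p.1).1, (P.parts.equivFin.symm p.2).1)) ?_ ?_
    · intro p hp
      have hp' : p.1 ≠ p.2 ∧ ¬ G.IsUniform ε (P.parts.equivFin.symm p.1).1 (P.parts.equivFin.symm p.2).1 := by
        simpa using hp
      have : ((P.parts.equivFin.symm p.1).1, (P.parts.equivFin.symm p.2).1) ∈ P.nonUniforms G ε := by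
        rw [Finpartition.mk_mem_nonUniforms]
        refine ⟨(P.parts.equivFin.symm p.1).2, (P.parts.equivFin.symm p.2).2, ?_, ?_⟩
        · intro h
          exact hp'.1 (P.parts.equivFin.symm.injective (Subtype.ext h))
        · exact hp'.2
      exact this
    · intro p _ p' _ h
      simp only [Prod.mk.injEq] at h
      have e1 := P.parts.equivFin.symm.injective (Subtype.ext h.1)
      have e2 := P.parts.equivFin.symm.injective (Subtype.ext h.2)
      exact Prod.ext e1 e2

theorem deg_eq_sum {V : Type} [Fintype V] (G : SimpleGraph V) {M : ℕ} (A : Fin M → Finset V)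
    (hd : ∀ c c', c ≠ c' → Disjoint (A c) (A c')) (hc : ∀ v, ∃ c, v ∈ A c) (v : V) :
    deg G v = ∑ c, ((A c).filter (fun u => G.Adj v u)).card := by
  rw [← Finset.card_biUnion]
  · unfold deg
    rw [← Set.ncard_coe_finset]
    congr 1
    ext u
    simp only [SimpleGraph.mem_neighborSet, Finset.coe_biUnion, Set.mem_iUnion, Finset.mem_coe, Finset.mem_filter]
    constructor
    · intro h
      obtain ⟨c, hc⟩ := hc u
      exact ⟨c, by simp, hc, h⟩
    · rintro ⟨c, _, _, h⟩; exact h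
  · intro c _ c' _ hcc
    exact Finset.disjoint_filter_filter (hd c c' hcc)

theorem sum_deg_part {V : Type} [Fintype V] (G : SimpleGraph V) {M : ℕ} (A : Fin M → Finset V)
    (hd : ∀ c c', c ≠ c' → Disjoint (A c) (A c')) (hc : ∀ v, ∃ c, v ∈ A c) (c : Fin M) :
    ∑ c', (G.edgeDensity (A c) (A c') : ℝ) * ((A c).card * (A c').card) = ∑ v ∈ A c, (deg G v : ℝ) := by
  simp only [dens_mul]
  rw [Finset.sum_comm]
  refine Finset.sum_congr rfl (fun v _ => ?_)
  rw [deg_eq_sum G A hd hc v]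
  push_cast; rfl

theorem sum_all_parts {V : Type} [Fintype V] {M : ℕ} (A : Fin M → Finset V)
    (hd : ∀ c c', c ≠ c' → Disjoint (A c) (A c')) (hc : ∀ v, ∃ c, v ∈ A c) (f : V → ℝ) :
    ∑ c, ∑ v ∈ A c, f v = ∑ v, f v := by
  rw [← Finset.sum_biUnion]
  · congr 1
    ext v; simp [hc v]
  · intro c _ c' _ hcc
    exact hd c c' hcc

set_option maxHeartbeats 2000000 in
theorem reg_parts {n l : ℕ} {α ν1 d0 ε ξ : ℝ} (hα : 0 < α) (hε : 0 < ε) (hξ : 0 < ξ) (hξ1 : ξ ≤ 1) (hd0 : 0 < d0) (hξα : ξ ≤ α)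
    (G : SimpleGraph (Fin (2 * n + 1))) (hl : l ≤ 2 * n + 1) (hl0 : 0 < l)
    (hdeg : (({v : Fin (2 * n + 1) |
            ¬ ((α - ξ) * n ≤ (deg G v : ℝ) ∧ (deg G v : ℝ) ≤ (α + ξ) * n)}.ncard : ℝ) ≤ ξ * n))
    (hξ2 : ξ * (α + 2 + 4 * (SzemerediRegularity.bound ε l : ℝ)) ≤ ν1 * α)
    (hlow : ξ + 4 * ξ * α + 2 / l + 2 * ε + 2 * d0 ≤ ν1 * α)
    (hn : (SzemerediRegularity.bound ε l : ℝ) * (1 / ξ + 1) ≤ n) :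
    ∃ M : ℕ, l ≤ M ∧ M ≤ SzemerediRegularity.bound ε l ∧ ∃ A : Fin M → Finset (Fin (2 * n + 1)),
      (∀ c c', c ≠ c' → Disjoint (A c) (A c')) ∧ (∀ c, (2 * n + 1) / M ≤ (A c).card) ∧
      (∀ c, (A c).card ≤ (2 * n + 1) / M + 1) ∧
      (∀ c, ∑ c', (if (c ≠ c' ∧ G.IsUniform ε (A c) (A c') ∧ d0 ≤ (G.edgeDensity (A c) (A c') : ℝ))
        then (G.edgeDensity (A c) (A c') : ℝ) else 0) ≤ (1 + ν1) * α * M / 2) ∧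
      (1 - ν1) * α * M ^ 2 / 2 ≤ ∑ c, ∑ c', (if (c ≠ c' ∧ G.IsUniform ε (A c) (A c') ∧ d0 ≤ (G.edgeDensity (A c) (A c') : ℝ))
        then (G.edgeDensity (A c) (A c') : ℝ) else 0) := by
  obtain ⟨M, hM1, hM2, A, hdj, hAl, hAu, hcov, hnu⟩ := reg_parts_raw G hε (l := l) (by simpa using hl) hl0
  rw [Fintype.card_fin] at hAl hAu
  refine ⟨M, hM1, hM2, A, hdj, hAl, hAu, ?_⟩
  set m := (2 * n + 1) / M with hm
  have hM0 : 0 < M := lt_of_lt_of_le hl0 hM1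
  have hMr : (0 : ℝ) < M := by exact_mod_cast hM0
  have hM2r : (M : ℝ) ≤ SzemerediRegularity.bound ε l := by exact_mod_cast hM2
  have hlr : (0 : ℝ) < l := by exact_mod_cast hl0
  have hlM : (l : ℝ) ≤ M := by exact_mod_cast hM1
  have hmM : (m : ℝ) * M ≤ 2 * n + 1 := by exact_mod_cast Nat.div_mul_le_self (2 * n + 1) M
  have hmM2 : (2 * n + 1 : ℝ) < (m + 1) * M := by
    have := Nat.lt_div_mul_add (a := 2 * n + 1) hM0
    have h2 : 2 * n + 1 < (m + 1) * M := by rw [hm]; linarith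
    exact_mod_cast h2
  have hnM : (M : ℝ) * (1 / ξ + 1) ≤ n := le_trans (by gcongr) hn
  have hmξ : 1 / ξ < m := by
    have h1 : (M : ℝ) * (1 / ξ + 1) < (m + 1) * M := by
      have : (0 : ℝ) ≤ n := Nat.cast_nonneg _
      linarith
    have h2 : 1 / ξ + 1 < m + 1 := by
      by_contra hcon
      push Not at hcon
      have := mul_le_mul_of_nonneg_left hcon hMr.le
      linarith
    linarith
  have hξm : 1 < ξ * m := by
    rw [div_lt_iff₀ hξ] at hmξ; linarith
  have hmr : (0 : ℝ) < m := lt_trans (by positivity) hmξ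
  have hξn : 1 ≤ ξ * n := by
    have h1 : (1 : ℝ) ≤ M := by exact_mod_cast hM0
    have h2 : 1 / ξ ≤ n := by
      have h0 : 0 < 1 / ξ := by positivity
      have h3 := mul_le_mul_of_nonneg_right h1 (show (0 : ℝ) ≤ 1 / ξ + 1 by linarith)
      linarith
    rw [div_le_iff₀ hξ] at h2; linarith
  have hξmM := mul_le_mul_of_nonneg_right hξm.le hMr.le
  have hξM : 0 ≤ ξ * M := by positivity
  have hξξ : ξ * ξ ≤ ξ * 1 := mul_le_mul_of_nonneg_left hξ1 hξ.le
  have hξξ0 : 0 ≤ ξ * ξ := by positivity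
  have hAlr : ∀ c, (m : ℝ) ≤ (A c).card := fun c => by exact_mod_cast hAl c
  have hAur : ∀ c, ((A c).card : ℝ) ≤ m + 1 := fun c => by exact_mod_cast hAu c
  have hd0' : ∀ c c', (0 : ℝ) ≤ (G.edgeDensity (A c) (A c') : ℝ) := fun c c' => by
    exact_mod_cast G.edgeDensity_nonneg _ _
  have hd1' : ∀ c c', (G.edgeDensity (A c) (A c') : ℝ) ≤ 1 := fun c c' => by
    exact_mod_cast G.edgeDensity_le_one _ _
  obtain ⟨bad, hbad⟩ : ∃ bad : Finset (Fin (2 * n + 1)), ∀ v, v ∈ bad ↔ ¬ ((α - ξ) * n ≤ (deg G v : ℝ) ∧ (deg G v : ℝ) ≤ (α + ξ) * n) :=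
    ⟨Finset.univ.filter (fun v => ¬ ((α - ξ) * n ≤ (deg G v : ℝ) ∧ (deg G v : ℝ) ≤ (α + ξ) * n)),
      fun v => by rw [Finset.mem_filter]; simp only [Finset.mem_univ, true_and]⟩
  have hbadc : (bad.card : ℝ) ≤ ξ * n := by
    refine le_trans (le_of_eq ?_) hdeg
    rw [← Set.ncard_coe_finset]
    congr 2
    ext v
    simp only [Finset.mem_coe]; exact hbad v
  have hdegub : ∀ v, (deg G v : ℝ) ≤ 2 * n + 1 := by
    intro v
    have : deg G v ≤ 2 * n + 1 := by
      unfold deg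
      refine (Set.ncard_le_card _).trans (by simp)
    exact_mod_cast this
  have hn0 : (0 : ℝ) ≤ n := Nat.cast_nonneg _
  obtain ⟨ed, hed⟩ : ∃ ed : Fin M → Fin M → Prop, ∀ c c', ed c c' ↔
    (c ≠ c' ∧ G.IsUniform ε (A c) (A c') ∧ d0 ≤ (G.edgeDensity (A c) (A c') : ℝ)) := ⟨_, fun _ _ => Iff.rfl⟩
  simp only [← hed]
  constructor
  · intro c
    have h1 := sum_deg_part G A hdj hcov c
    have h2 : ∑ v ∈ A c, (deg G v : ℝ) ≤ (A c).card * ((α + ξ) * n) + ξ * n * (2 * n + 1) := by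
      have h3 : ∀ v ∈ A c, (deg G v : ℝ) ≤ (α + ξ) * n + (if v ∈ bad then (2 * n + 1 : ℝ) else 0) := by
        intro v _
        split_ifs with hv
        · have := hdegub v
          have : 0 ≤ (α + ξ) * n := by positivity
          linarith
        · rw [hbad] at hv; push Not at hv
          linarith [hv.2]
      refine (Finset.sum_le_sum h3).trans ?_
      rw [Finset.sum_add_distrib, Finset.sum_const, nsmul_eq_mul, ← Finset.sum_filter, Finset.sum_const, nsmul_eq_mul]
      have h4 : (((A c).filter (fun v => v ∈ bad)).card : ℝ) ≤ ξ * n := by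
        refine le_trans ?_ hbadc
        norm_cast
        exact Finset.card_le_card (fun v hv => (Finset.mem_filter.mp hv).2)
      have : (0 : ℝ) ≤ 2 * n + 1 := by positivity
      gcongr
    have h5 : ∑ c', (if ed c c' then (G.edgeDensity (A c) (A c') : ℝ) else 0) * ((A c).card * m) ≤
        ∑ c', (G.edgeDensity (A c) (A c') : ℝ) * ((A c).card * (A c').card) := by
      refine Finset.sum_le_sum (fun c' _ => ?_)
      have := hd0' c c'
      have := hAlr c'
      split_ifs
      · gcongr
      · rw [zero_mul]; positivity
    rw [← Finset.sum_mul, h1] at h5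
    set Sm := ∑ c', (if ed c c' then (G.edgeDensity (A c) (A c') : ℝ) else 0)
    have hac := hAlr c
    have hacpos : (0 : ℝ) < (A c).card := lt_of_lt_of_le hmr hac
    have h6 : Sm * m ≤ (α + ξ) * n + ξ * n * (2 * n + 1) / m := by
      have h7 : (Sm * m) * (A c).card ≤ ((α + ξ) * n + ξ * n * (2 * n + 1) / m) * (A c).card := by
        have : ξ * n * (2 * n + 1) ≤ ξ * n * (2 * n + 1) / m * (A c).card := by
          rw [div_mul_eq_mul_div, le_div_iff₀ hmr]
          gcongr
        linarith
      exact le_of_mul_le_mul_right h7 hacpos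
    have hnm : (n : ℝ) ≤ (1 + ξ) * m * M / 2 := by linarith
    have h2nm : (2 * n + 1 : ℝ) ≤ (1 + ξ) * m * M := by linarith
    have h8 : ξ * n * (2 * n + 1) / m ≤ ξ * ((1 + ξ) * M / 2) * ((1 + ξ) * M) * m := by
      rw [div_le_iff₀ hmr]
      calc ξ * n * (2 * n + 1) ≤ ξ * ((1 + ξ) * m * M / 2) * ((1 + ξ) * m * M) := by gcongr
        _ = _ := by ring
    have h9 : Sm * m ≤ ((α + ξ) * ((1 + ξ) * M / 2) + ξ * ((1 + ξ) * M / 2) * ((1 + ξ) * M)) * m := by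
      have : (α + ξ) * n ≤ (α + ξ) * ((1 + ξ) * m * M / 2) := by gcongr
      linarith
    have h10 := le_of_mul_le_mul_right h9 hmr
    refine h10.trans ?_
    have h11 : (α + ξ) * (1 + ξ) + ξ * (1 + ξ) * ((1 + ξ) * M) ≤ (1 + ν1) * α := by
      have e1 : (1 + ξ) * (1 + ξ) ≤ 4 := by linarith
      have e2 : ξ * (1 + ξ) * ((1 + ξ) * M) ≤ ξ * (4 * M) := by
        have := mul_le_mul_of_nonneg_left e1 hξM
        linarith
      have e3 : ξ * (4 * M) ≤ ξ * (4 * (SzemerediRegularity.bound ε l : ℝ)) := by gcongr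
      linarith
    have h12 := mul_le_mul_of_nonneg_right h11 (show (0 : ℝ) ≤ M / 2 by positivity)
    linarith
  · have h1 : ∑ c, ∑ c', (G.edgeDensity (A c) (A c') : ℝ) * ((A c).card * (A c').card) = ∑ v, (deg G v : ℝ) := by
      simp only [sum_deg_part G A hdj hcov]
      exact sum_all_parts A hdj hcov _
    have h2 : ((2 * n + 1) - ξ * n) * ((α - ξ) * n) ≤ ∑ v, (deg G v : ℝ) := by
      have h3 : ∀ v ∈ (Finset.univ : Finset (Fin (2 * n + 1))), (α - ξ) * n - (if v ∈ bad then (α - ξ) * n else 0) ≤ (deg G v : ℝ) := by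
        intro v _
        split_ifs with hv
        · rw [sub_self]; positivity
        · rw [hbad] at hv; push Not at hv
          linarith [hv.1]
      refine le_trans ?_ (Finset.sum_le_sum h3)
      rw [Finset.sum_sub_distrib, Finset.sum_const, nsmul_eq_mul, ← Finset.sum_filter, Finset.sum_const, nsmul_eq_mul,
        Finset.card_univ, Fintype.card_fin]
      have h4 : ((Finset.univ.filter (fun v => v ∈ bad)).card : ℝ) ≤ ξ * n := by
        refine le_trans ?_ hbadc
        norm_cast
        exact Finset.card_le_card (fun v hv => (Finset.mem_filter.mp hv).2)
      have h5 : 0 ≤ (α - ξ) * n := mul_nonneg (by linarith) hn0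
      push_cast
      have h6 := mul_le_mul_of_nonneg_right h4 h5
      linarith
    obtain ⟨nu, hnuP⟩ : ∃ nu : Fin M → Fin M → Prop, ∀ c c', nu c c' ↔ c ≠ c' ∧ ¬ G.IsUniform ε (A c) (A c') := ⟨_, fun _ _ => Iff.rfl⟩
    have h3 : ∑ c, ∑ c', (G.edgeDensity (A c) (A c') : ℝ) * ((A c).card * (A c').card) ≤
        ∑ c : Fin M, ∑ c' : Fin M, ((if ed c c' then (G.edgeDensity (A c) (A c') : ℝ) else 0) + (if c = c' then 1 else 0) +
          (if nu c c' then 1 else 0) + d0) * (((m : ℝ) + 1) * (m + 1)) := by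
      refine Finset.sum_le_sum (fun c _ => Finset.sum_le_sum (fun c' _ => ?_))
      have e0 := hd0' c c'
      have e1 := hd1' c c'
      have e2 := hAur c
      have e3 := hAur c'
      have e4 : (G.edgeDensity (A c) (A c') : ℝ) ≤ (if ed c c' then (G.edgeDensity (A c) (A c') : ℝ) else 0) + (if c = c' then 1 else 0) +
          (if nu c c' then 1 else 0) + d0 := by
        by_cases k1 : ed c c'
        · rw [if_pos k1]; split_ifs <;> linarith
        · by_cases k2 : c = c'
          · rw [if_pos k2]; split_ifs <;> linarith
          · by_cases k3 : nu c c'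
            · rw [if_pos k3]; split_ifs <;> linarith
            · rw [hed] at k1
              rw [hnuP] at k3
              have : (G.edgeDensity (A c) (A c') : ℝ) < d0 := by
                by_contra hcon
                push Not at hcon
                push Not at k3
                exact k1 ⟨k2, k3 k2, hcon⟩
              split_ifs <;> linarith
      gcongr
    simp only [← Finset.sum_mul] at h3
    have h4 : ∑ c : Fin M, ∑ c' : Fin M, ((if ed c c' then (G.edgeDensity (A c) (A c') : ℝ) else 0) + (if c = c' then 1 else 0) +
          (if nu c c' then 1 else 0) + d0) ≤ (∑ c : Fin M, ∑ c' : Fin M, (if ed c c' then (G.edgeDensity (A c) (A c') : ℝ) else 0)) +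
          M + M ^ 2 * ε + M ^ 2 * d0 := by
      simp only [Finset.sum_add_distrib]
      have k1 : ∑ c : Fin M, ∑ c' : Fin M, (if c = c' then (1 : ℝ) else 0) = M := by simp
      have k2 : ∑ c : Fin M, ∑ c' : Fin M, (if nu c c' then (1 : ℝ) else 0) ≤ M ^ 2 * ε := by
        refine le_trans (le_of_eq ?_) hnu
        rw [← Finset.sum_product' (f := fun c c' => (if nu c c' then (1 : ℝ) else 0)), Finset.univ_product_univ, Finset.card_filter]
        push_cast
        refine Finset.sum_congr rfl (fun p _ => ?_)
        simp only [hnuP]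
      have k3 : ∑ c : Fin M, ∑ c' : Fin M, d0 = M ^ 2 * d0 := by simp; ring
      rw [k1, k3]
      linarith
    set Sm := ∑ c : Fin M, ∑ c' : Fin M, (if ed c c' then (G.edgeDensity (A c) (A c') : ℝ) else 0)
    have hmain : ((2 * n + 1) - ξ * n) * ((α - ξ) * n) ≤ (Sm + M + M ^ 2 * ε + M ^ 2 * d0) * ((m + 1) * (m + 1)) := by
      rw [h1] at h3
      refine h2.trans (h3.trans ?_)
      gcongr
    have k1 : (1 - ξ) * (m + 1) * M ≤ 2 * n + 1 := by linarith
    have k2 : (1 - ξ) * (2 * n + 1) ≤ 2 * n := by linarith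
    have k3 : (1 - ξ) * (2 * n + 1) ≤ (2 * n + 1) - ξ * n := by linarith
    have h1ξ : 0 ≤ 1 - ξ := by linarith
    have hαξ : 0 ≤ α - ξ := by linarith
    have k4 : ((1 - ξ) * ((1 - ξ) * (m + 1) * M)) * ((α - ξ) * ((1 - ξ) * ((1 - ξ) * (m + 1) * M) / 2)) ≤
        ((2 * n + 1) - ξ * n) * ((α - ξ) * n) := by
      have a1 : (1 - ξ) * ((1 - ξ) * (m + 1) * M) ≤ (2 * n + 1) - ξ * n := le_trans (by gcongr) k3
      have a2 : (1 - ξ) * ((1 - ξ) * (m + 1) * M) / 2 ≤ n := by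
        have : (1 - ξ) * ((1 - ξ) * (m + 1) * M) ≤ 2 * n := le_trans (by gcongr) k2
        linarith
      have a3 : 0 ≤ (1 - ξ) * ((1 - ξ) * (m + 1) * M) := by positivity
      have a4 : 0 ≤ (1 - ξ) * ((1 - ξ) * (m + 1) * M) / 2 := by positivity
      exact mul_le_mul a1 (mul_le_mul_of_nonneg_left a2 hαξ) (mul_nonneg hαξ a4) (a3.trans a1)
    have k5 : ((1 - ξ) ^ 4 * (α - ξ) * M ^ 2 / 2) * ((m + 1) * (m + 1)) ≤ (Sm + M + M ^ 2 * ε + M ^ 2 * d0) * (((m : ℝ) + 1) * (m + 1)) := by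
      refine le_trans (le_of_eq ?_) (k4.trans hmain)
      ring
    have k6 := le_of_mul_le_mul_right k5 (by positivity)
    have k7 : 1 - 4 * ξ ≤ (1 - ξ) ^ 4 := by
      have := one_add_mul_le_pow (a := -ξ) (by linarith) 4
      norm_num at this
      calc 1 - 4 * ξ = 1 + -(4 * ξ) := by ring
        _ ≤ (1 + -ξ) ^ 4 := by linarith [this]
        _ = (1 - ξ) ^ 4 := by ring
    have k8 : (M : ℝ) ≤ M ^ 2 / l := by
      have := mul_le_mul_of_nonneg_left hlM hMr.le
      rw [le_div_iff₀ hlr]; linarith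
    have k9 : (1 - ν1) * α + 2 / l + 2 * ε + 2 * d0 ≤ (1 - ξ) ^ 4 * (α - ξ) := by
      have : (1 - 4 * ξ) * (α - ξ) ≤ (1 - ξ) ^ 4 * (α - ξ) := by gcongr
      linarith
    have hM2p : (0 : ℝ) ≤ M ^ 2 / 2 := by positivity
    have k10 := mul_le_mul_of_nonneg_right k9 hM2p
    have k11 : (M : ℝ) ^ 2 / l = (2 / l) * (M ^ 2 / 2) := by ring
    linarith

end PartB4

section PartD1

open scoped Classical

theorem num_load {n L Λ D1 gd s M m load μ : ℝ} (hμ : 0 < μ) (hμ1 : μ ≤ 1 / 200) (hn0 : 0 ≤ n) (hL : 0 ≤ L)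
    (hm : 0 ≤ m) (hgd0 : 0 ≤ gd) (hn : n ≤ m * (1 + μ) * M / 2) (hgd : (1 - 2 * μ) * M ≤ gd) (hΛ : Λ * D1 ≤ μ * L)
    (hs : (1 + Λ) * (D1 * s) ≤ μ * m) (hload : (1 + 7 * μ) * m / 2 ≤ load) :
    n * L + Λ * (n * D1) + gd * L * ((1 + Λ) * (D1 * s)) ≤ gd * L * load := by
  have h1 : Λ * (n * D1) ≤ n * (μ * L) := by
    have := mul_le_mul_of_nonneg_left hΛ hn0; linarith
  have hgL : 0 ≤ gd * L := by positivity
  have h2 := mul_le_mul_of_nonneg_left hs hgL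
  have h3 := mul_le_mul_of_nonneg_left hload hgL
  have h4 : n * (1 + μ) ≤ gd * m * (1 + 5 * μ) / 2 := by
    have e1 : n * (1 + μ) ≤ m * (1 + μ) * M / 2 * (1 + μ) := by gcongr
    have e2 : (1 + μ) * (1 + μ) ≤ (1 + 5 * μ) * (1 - 2 * μ) := by nlinarith
    rcases le_or_gt 0 M with hM | hM
    · have e3 : m * M * ((1 + μ) * (1 + μ)) ≤ m * M * ((1 + 5 * μ) * (1 - 2 * μ)) := by gcongr
      have e4 : m * (1 + 5 * μ) * ((1 - 2 * μ) * M) ≤ m * (1 + 5 * μ) * gd := by gcongr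
      linarith
    · have e5 : m * (1 + μ) * M / 2 * (1 + μ) ≤ 0 := by
        have : m * (1 + μ) * (1 + μ) * M ≤ 0 := mul_nonpos_of_nonneg_of_nonpos (by positivity) hM.le
        linarith
      have : 0 ≤ gd * m * (1 + 5 * μ) / 2 := by positivity
      linarith
  have h5 := mul_le_mul_of_nonneg_right h4 hL
  linarith

theorem num_S {τ W Z μ α n M m d d0 S : ℝ} (hμ : 0 < μ) (hμ1 : μ ≤ 1 / 200) (hα : 0 < α) (hM : 0 < M) (hd0 : d0 ≤ d) (hd0' : 0 < d0)
    (hm : 0 < m) (hτ0 : 0 ≤ τ) (hn0 : 0 ≤ n)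
    (hS : S ≤ τ * (2 * W) / (1 - μ) + 2 * Z) (hW : W ≤ 2 * d / (α * M)) (hτ : τ ≤ (1 - 100 * μ) * α * n)
    (hn : n ≤ m * (1 + μ) * M / 2) (hZ : 2 * Z ≤ μ * d0 * m) : S ≤ d * m * (2 - 100 * μ) := by
  have hd : 0 < d := by linarith
  have h1 : 0 < 1 - μ := by linarith
  have h2 : τ * (2 * W) ≤ (1 - 100 * μ) * α * n * (2 * (2 * d / (α * M))) := by
    have e1 : τ * (2 * W) ≤ τ * (2 * (2 * d / (α * M))) := by gcongr
    have e2 : 0 ≤ 2 * (2 * d / (α * M)) := by positivity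
    exact e1.trans (mul_le_mul_of_nonneg_right hτ e2)
  have h3 : (1 - 100 * μ) * α * n * (2 * (2 * d / (α * M))) = (1 - 100 * μ) * (4 * d * (n / M)) := by
    field_simp; ring
  have h4 : n / M ≤ m * (1 + μ) / 2 := by
    rw [div_le_iff₀ hM]; linarith
  have h100 : 0 ≤ 1 - 100 * μ := by linarith
  have h5 : τ * (2 * W) ≤ (1 - 100 * μ) * (4 * d * (m * (1 + μ) / 2)) := by
    rw [h3] at h2
    refine h2.trans ?_
    gcongr
  have h6 : τ * (2 * W) / (1 - μ) ≤ d * m * (2 - 194 * μ) := by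
    rw [div_le_iff₀ h1]
    refine h5.trans ?_
    have e1 : (1 - 100 * μ) * (2 * (1 + μ)) ≤ (2 - 194 * μ) * (1 - μ) := by nlinarith
    have e2 : 0 ≤ d * m := by positivity
    have := mul_le_mul_of_nonneg_left e1 e2
    linarith
  have h7 : μ * d0 * m ≤ μ * d * m := by gcongr
  have h8 : 0 ≤ μ * d * m := by positivity
  linarith

theorem num_R {capA S q R d d0 m a μ δ load : ℝ} (hμ : 0 < μ) (hμ1 : μ ≤ 1 / 200) (hq : 0 < q) (hm : 0 < m) (hd0 : d0 ≤ d)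
    (hd0' : 0 < d0) (hS0 : 0 ≤ S) (hA : capA * a ≤ load) (hload : load ≤ (1 + 8 * μ) * m / 2) (ha : (1 - 3 * μ) * m ≤ a * q)
    (hS : S ≤ d * m * (2 - 100 * μ)) (hδ : δ ≤ μ * d0) (hR : (d - δ) * a ≤ R) : capA * S ≤ q ^ 2 * R := by
  have hd : 0 < d := by linarith
  have h13 : 0 < 1 - 3 * μ := by linarith
  have haq : 0 < a * q := lt_of_lt_of_le (by positivity) ha
  have ha0 : 0 < a := by
    by_contra hcon
    push Not at hcon
    have := mul_nonpos_of_nonpos_of_nonneg hcon hq.le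
    linarith
  have h1 : capA ≤ q / 2 * (1 + 12 * μ) := by
    have e1 : capA * a ≤ q / 2 * (1 + 12 * μ) * a := by
      refine (hA.trans hload).trans ?_
      have e2 : (1 + 12 * μ) * ((1 - 3 * μ) * m) ≤ (1 + 12 * μ) * (a * q) := by gcongr
      have e3 : (1 + 8 * μ) ≤ (1 + 12 * μ) * (1 - 3 * μ) := by nlinarith
      have e4 := mul_le_mul_of_nonneg_right e3 hm.le
      linarith
    exact le_of_mul_le_mul_right e1 ha0
  have h2 : capA * S ≤ q / 2 * (1 + 12 * μ) * (d * m * (2 - 100 * μ)) := by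
    have : capA * S ≤ q / 2 * (1 + 12 * μ) * S := by gcongr
    refine this.trans ?_
    gcongr
  have h3 : d * (1 - μ) ≤ d - δ := by
    have : μ * d0 ≤ μ * d := by gcongr
    linarith
  have h4 : d * (1 - μ) * a ≤ R := le_trans (by gcongr) hR
  have h1μ : 0 ≤ 1 - μ := by linarith
  have h5 : q * (d * (1 - μ) * ((1 - 3 * μ) * m)) ≤ q ^ 2 * R := by
    calc q * (d * (1 - μ) * ((1 - 3 * μ) * m)) ≤ q * (d * (1 - μ) * (a * q)) := by gcongr
      _ = q ^ 2 * (d * (1 - μ) * a) := by ring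
      _ ≤ q ^ 2 * R := by gcongr
  have h6 : (1 + 12 * μ) * (1 - 50 * μ) ≤ (1 - μ) * (1 - 3 * μ) := by nlinarith
  have h7 := mul_le_mul_of_nonneg_left h6 (show 0 ≤ q * d * m by positivity)
  linarith

/-- lower bound for the floor of a number at least two -/
theorem half_le_floor {x : ℝ} (hx : 2 ≤ x) : x / 2 ≤ (Nat.floor x : ℝ) := by
  have := Nat.lt_floor_add_one x
  linarith

end PartD1

section PartD2

open scoped Classical

/-- the hierarchy of constants -/
structure Cst where
  (α μ d0 κ1 θ1 c ρ δ ε η : ℝ)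
  (Δ Λ L B q Mx Cj Ci Wc Z : ℕ)
  hα : 0 < α
  hμ : 0 < μ
  hμ1 : μ ≤ 1 / 200
  hd0 : 0 < d0
  hd01 : d0 ≤ 1
  hκ1 : κ1 = d0 * μ / 20
  hθ1 : θ1 = d0 * κ1 / 8
  hc : c = κ1 * θ1 / 24
  hΔ : 1 ≤ Δ
  hΛ0 : 0 < Λ
  hΛ1 : 14 * ((Δ : ℝ) + 1) ^ 2 ≤ κ1 * Λ
  hΛ2 : 5 ≤ c * Λ
  hL : 3 ≤ L
  hL2 : (Λ : ℝ) * (Δ + 1) ≤ μ * L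
  hB : B = (Δ + 1) ^ L
  hq0 : 0 < q
  hq : 5 * 2 ^ (4 * B) * (B : ℝ) ≤ c * q
  hρ : 0 < ρ
  hρ1 : (1 + (Λ : ℝ)) * ((Δ + 1) * ρ) ≤ μ
  hδ : 0 < δ
  hδ1 : δ ≤ μ * d0
  hδ2 : 5 * (δ * B) ≤ c
  hε : 0 < ε
  hε1 : ε ≤ d0 / 2
  hε2 : 60 * (ε * B) ≤ c
  hε3 : 6 * (Δ * ε) ≤ κ1
  hε4 : 4 * ε ≤ κ1
  hε5 : 4 * (q * ε) ≤ 1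
  hε6 : 14 * (q * ε) ≤ δ ^ 2
  hCj : 4 * (Mx : ℝ) ≤ ρ * Cj
  hCi : 2 * α * Mx + 1 ≤ Ci
  hWc : 2 * ((Ci : ℝ) * Cj) ≤ κ1 * (Wc + 1)
  hη : 0 < η
  hη1 : 4 * ((Wc + Cj : ℕ) * (η * Mx)) ≤ ε

/-- largeness conditions -/
structure Big (C : Cst) (m : ℕ) : Prop where
  b1 : (C.q : ℝ) ≤ C.μ * m
  b2 : 2 ≤ C.μ * m
  b3 : 2 ≤ C.ρ * m
  b4 : 2 ≤ C.κ1 * m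
  b5 : 2 ≤ C.θ1 * m
  b6 : 1 ≤ C.ε * m
  b7 : (C.Λ : ℝ) ≤ m
  b8 : 2 * (C.Z : ℝ) ≤ C.μ * C.d0 * m
  b9 : (C.Z : ℝ) ≤ m
  b10 : 5 * ((C.Cj : ℝ) * C.B) ≤ C.c * m
  b11 : 2 * ((C.Ci : ℝ) * C.Cj) ≤ C.κ1 * C.θ1 * m
  b12 : 2 * (C.Cj : ℝ) ≤ C.θ1 * m

/-- the integer parameters -/
structure Par (C : Cst) (m n : ℕ) where
  (a b s load u θ t FL : ℕ)
  a_pos : 0 < a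
  h_ab : C.q * a + 2 * b ≤ m
  h_a : ((m : ℝ) + 1) * C.ε ≤ a
  h_main : 2 * C.ε * a + 1 + 2 * (((m : ℝ) + 1) * C.ε) ≤ C.δ ^ 2 * a
  h_ub : 5 * u ≤ b
  h_ub2 : ((5 * u : ℕ) : ℝ) ≤ (C.d0 - C.ε) * b
  h_b : ((m : ℝ) + 1) * C.ε ≤ b
  h_t : ((m : ℝ) + 1) * C.ε ≤ t
  h_u : ((m : ℝ) + 1) * C.ε ≤ u
  h_g : ((2 * θ : ℕ) : ℝ) ≤ (C.d0 - C.ε) * u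
  h_s : 1 ≤ s
  h_s2 : (1 + (C.Λ : ℝ)) * ((C.Δ + 1) * s) ≤ C.μ * m
  h_load1 : (1 + 7 * C.μ) * m / 2 ≤ load
  h_load2 : load ≤ (1 + 8 * C.μ) * m / 2
  h_aq : (1 - 3 * C.μ) * m ≤ a * C.q
  h_hq : load + (C.Δ + 1) * s ≤ C.q * a
  h_J : 2 * (n / s) ≤ C.Cj
  h_F : (C.Δ + 1) * (load / C.Λ) / a * (3 * m) ≤ C.q * FL
  h_F2 : FL * (C.Δ + 1) ≤ u
  h_D : 2 * ((load / C.Λ + 2 * (n / s) * (C.Δ + 1) ^ C.L + 2 ^ (4 * (C.Δ + 1) ^ C.L) * a * (C.Δ + 1) ^ C.L) +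
    (load / a * Nat.floor (C.δ * a) + 4 * t) * C.B) ≤ θ
  h_T : ((load / C.Λ + 2 * (n / s) * (C.Δ + 1) ^ C.L + 2 ^ (4 * (C.Δ + 1) ^ C.L) * a * (C.Δ + 1) ^ C.L) +
    (load / a * Nat.floor (C.δ * a) + 4 * t) * C.B) * (3 * m) + (C.Ci * m) * (2 * (n / s)) < (u + 1) * (θ + 1)
  h_OV2 : 2 * ((C.Ci * m) * (2 * (n / s))) < (u + 1) * (C.Wc + 1)
  h_Jθ : C.Cj ≤ θ
  h_θu : θ ≤ u
  h_tu : C.Δ * t ≤ u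
  h_εt : C.ε * m ≤ t
  h_εu : C.ε * m ≤ u

set_option maxHeartbeats 4000000 in
theorem exists_par (C : Cst) {m n M : ℕ} (hb : Big C m) (hM : M ≤ C.Mx) (hn : (n : ℝ) ≤ m * M) (hn0 : 0 < n) :
    Nonempty (Par C m n) := by
  obtain ⟨b1, b2, b3, b4, b5, b6, b7, b8, b9, b10, b11, b12⟩ := hb
  obtain ⟨α, μ, d0, κ1, θ1, c, ρ, δ, ε, η, Δ, Λ, L, B, q, Mx, Cj, Ci, Wc, Z, hα, hμ, hμ1, hd0, hd01, hκ1, hθ1, hc, hΔ, hΛ0,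
    hΛ1, hΛ2, hL, hL2, hB, hq0, hq, hρ, hρ1, hδ, hδ1, hδ2, hε, hε1, hε2, hε3, hε4, hε5, hε6, hCj, hCi, hWc, hη, hη1⟩ := C
  simp only at *
  have hκ0 : 0 < κ1 := by rw [hκ1]; positivity
  have hκle : κ1 ≤ 1 := by rw [hκ1]; nlinarith
  have hθ0 : 0 < θ1 := by rw [hθ1]; positivity
  have hc0 : 0 < c := by rw [hc]; positivity
  have hmr : (0 : ℝ) < m := by
    by_contra hcon
    push Not at hcon
    have := mul_nonpos_of_nonneg_of_nonpos hμ.le hcon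
    linarith
  have hqr : (0 : ℝ) < q := by exact_mod_cast hq0
  have hΛr : (0 : ℝ) < Λ := by exact_mod_cast hΛ0
  have hBr : (0 : ℝ) ≤ B := Nat.cast_nonneg _
  have hΔr : (1 : ℝ) ≤ Δ := by exact_mod_cast hΔ
  have hμm : 0 < μ * m := by positivity
  have hm1 : (1 : ℝ) ≤ μ * m := by linarith
  have hmge : (400 : ℝ) ≤ m := by nlinarith only [hμ1, b2, hmr]
  -- the parameters
  obtain ⟨a, hadef⟩ : ∃ a, a = Nat.floor ((1 - 2 * μ) * m / q) := ⟨_, rfl⟩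
  obtain ⟨b, hbdef⟩ : ∃ b, b = Nat.floor (μ * m) := ⟨_, rfl⟩
  obtain ⟨s, hsdef⟩ : ∃ s, s = Nat.floor (ρ * m) := ⟨_, rfl⟩
  obtain ⟨load, hldef⟩ : ∃ load, load = Nat.ceil ((1 + 7 * μ) * m / 2) := ⟨_, rfl⟩
  obtain ⟨u, hudef⟩ : ∃ u, u = Nat.floor (κ1 * m) := ⟨_, rfl⟩
  obtain ⟨θ, hθdef⟩ : ∃ θ, θ = Nat.floor (θ1 * m) := ⟨_, rfl⟩
  obtain ⟨t, htdef⟩ : ∃ t, t = Nat.ceil (2 * ε * m) := ⟨_, rfl⟩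
  obtain ⟨FL, hFdef⟩ : ∃ FL, FL = Nat.ceil (6 * ((Δ : ℝ) + 1) * m / Λ) := ⟨_, rfl⟩
  have h12 : 0 < 1 - 2 * μ := by linarith
  have a_le : (a : ℝ) ≤ (1 - 2 * μ) * m / q := by rw [hadef]; exact Nat.floor_le (by positivity)
  have a_le' : (a : ℝ) * q ≤ (1 - 2 * μ) * m := by rwa [le_div_iff₀ hqr] at a_le
  have a_ge : (1 - 3 * μ) * m ≤ a * q := by
    have h1 : (1 - 2 * μ) * m / q < a + 1 := by rw [hadef]; exact Nat.lt_floor_add_one _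
    rw [div_lt_iff₀ hqr] at h1
    linarith
  have a_ge2 : (m : ℝ) / 2 ≤ a * q := by
    refine le_trans ?_ a_ge
    have := mul_le_mul_of_nonneg_right (show (1 / 2 : ℝ) ≤ 1 - 3 * μ by linarith) hmr.le
    linarith
  have a_pos : (0 : ℝ) < a := by
    by_contra hcon
    push Not at hcon
    have := mul_nonpos_of_nonpos_of_nonneg hcon hqr.le
    linarith
  have b_le : (b : ℝ) ≤ μ * m := by rw [hbdef]; exact Nat.floor_le (by positivity)
  have b_ge : μ * m / 2 ≤ b := by rw [hbdef]; exact half_le_floor b2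
  have s_le : (s : ℝ) ≤ ρ * m := by rw [hsdef]; exact Nat.floor_le (by positivity)
  have s_ge : ρ * m / 2 ≤ s := by rw [hsdef]; exact half_le_floor b3
  have load_ge : (1 + 7 * μ) * m / 2 ≤ load := by rw [hldef]; exact Nat.le_ceil _
  have load_le : (load : ℝ) ≤ (1 + 8 * μ) * m / 2 := by
    have : (load : ℝ) < (1 + 7 * μ) * m / 2 + 1 := by rw [hldef]; exact Nat.ceil_lt_add_one (by positivity)
    linarith
  have hμm200 : μ * m ≤ 1 / 200 * m := mul_le_mul_of_nonneg_right hμ1 hmr.le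
  have load_le_m : (load : ℝ) ≤ m := by linarith
  have u_le : (u : ℝ) ≤ κ1 * m := by rw [hudef]; exact Nat.floor_le (by positivity)
  have u_ge : κ1 * m / 2 ≤ u := by rw [hudef]; exact half_le_floor b4
  have u_gt : κ1 * m < u + 1 := by rw [hudef]; exact Nat.lt_floor_add_one _
  have θ_le : (θ : ℝ) ≤ θ1 * m := by rw [hθdef]; exact Nat.floor_le (by positivity)
  have θ_ge : θ1 * m / 2 ≤ θ := by rw [hθdef]; exact half_le_floor b5
  have θ_gt : θ1 * m < θ + 1 := by rw [hθdef]; exact Nat.lt_floor_add_one _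
  have t_ge : 2 * ε * m ≤ t := by rw [htdef]; exact Nat.le_ceil _
  have t_le : (t : ℝ) ≤ 3 * (ε * m) := by
    have : (t : ℝ) < 2 * ε * m + 1 := by rw [htdef]; exact Nat.ceil_lt_add_one (by positivity)
    linarith
  have F_ge : 6 * ((Δ : ℝ) + 1) * m / Λ ≤ FL := by rw [hFdef]; exact Nat.le_ceil _
  have F_le : (FL : ℝ) ≤ 7 * ((Δ : ℝ) + 1) * m / Λ := by
    have h1 : (FL : ℝ) < 6 * ((Δ : ℝ) + 1) * m / Λ + 1 := by rw [hFdef]; exact Nat.ceil_lt_add_one (by positivity)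
    have h2 : 1 ≤ ((Δ : ℝ) + 1) * m / Λ := by
      rw [le_div_iff₀ hΛr]; nlinarith only [b7, hΔr, hmr]
    have h3 : 7 * ((Δ : ℝ) + 1) * m / Λ = 6 * ((Δ : ℝ) + 1) * m / Λ + ((Δ : ℝ) + 1) * m / Λ := by ring
    linarith
  clear hadef hbdef hsdef hldef hudef hθdef htdef hFdef
  have hm2 : ((m : ℝ) + 1) * ε ≤ 2 * (ε * m) := by
    have : ε * 1 ≤ ε * m := by gcongr; linarith
    linarith
  have hεκ : 2 * (ε * m) ≤ κ1 * m / 2 := by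
    have := mul_le_mul_of_nonneg_right hε4 hmr.le; linarith
  have hu5 : 5 * (κ1 * m) ≤ d0 / 2 * (μ * m / 2) := by rw [hκ1]; linarith
  have hu6 : d0 / 2 * (μ * m / 2) ≤ μ * m / 2 := by
    have : d0 * (μ * m) ≤ 1 * (μ * m) := by gcongr
    linarith
  have hu7 : d0 / 2 * (μ * m / 2) ≤ (d0 - ε) * b := by
    have : d0 / 2 ≤ d0 - ε := by linarith
    have : 0 ≤ d0 - ε := by linarith
    gcongr
  have hJr : ((2 * (n / s) : ℕ) : ℝ) ≤ Cj := by
    push_cast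
    have h1 : ((n / s : ℕ) : ℝ) ≤ n / s := Nat.cast_div_le
    have hρm : 0 < ρ * m := by positivity
    have hs0 : (0 : ℝ) < s := by linarith
    have h2 : (n : ℝ) / s ≤ Cj / 2 := by
      rw [div_le_iff₀ hs0]
      have hMr : (M : ℝ) ≤ Mx := by exact_mod_cast hM
      have e1 : (m : ℝ) * M ≤ m * Mx := by gcongr
      have e2 := mul_le_mul_of_nonneg_left hCj hmr.le
      have e3 : (Cj : ℝ) / 2 * (ρ * m / 2) ≤ Cj / 2 * s := by gcongr
      linarith
    linarith
  have hJn : 2 * (n / s) ≤ Cj := by exact_mod_cast hJr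
  have hA : ((load / a : ℕ) : ℝ) * a ≤ m := by
    have : load / a * a ≤ load := Nat.div_mul_le_self _ _
    have h2 : ((load / a : ℕ) : ℝ) * a ≤ load := by exact_mod_cast this
    linarith
  have hE : (((load / Λ + 2 * (n / s) * (Δ + 1) ^ L + 2 ^ (4 * (Δ + 1) ^ L) * a * (Δ + 1) ^ L) +
    (load / a * Nat.floor (δ * a) + 4 * t) * B : ℕ) : ℝ) ≤ c * m := by
    rw [← hB]
    have e1 : ((load / Λ : ℕ) : ℝ) ≤ c * m / 5 := by
      have k1 : ((load / Λ : ℕ) : ℝ) ≤ load / Λ := Nat.cast_div_le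
      refine k1.trans ?_
      rw [div_le_iff₀ hΛr]
      have := mul_le_mul_of_nonneg_right hΛ2 hmr.le
      linarith
    have e2 : ((2 * (n / s) : ℕ) : ℝ) * B ≤ c * m / 5 := by
      have : ((2 * (n / s) : ℕ) : ℝ) * B ≤ Cj * B := by gcongr
      linarith
    have e3 : (2 : ℝ) ^ (4 * B) * a * B ≤ c * m / 5 := by
      have k1 : 5 * 2 ^ (4 * B) * (B : ℝ) * a ≤ c * q * a := by gcongr
      have k2 : c * (a * q) ≤ c * m := by
        gcongr
        linarith
      linarith
    have e4 : ((load / a : ℕ) : ℝ) * (Nat.floor (δ * a) : ℝ) * B ≤ c * m / 5 := by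
      have k1 : (Nat.floor (δ * a) : ℝ) ≤ δ * a := Nat.floor_le (by positivity)
      have k2 : ((load / a : ℕ) : ℝ) * (Nat.floor (δ * a) : ℝ) * B ≤ ((load / a : ℕ) : ℝ) * (δ * a) * B := by gcongr
      have k3 : (δ * B) * (((load / a : ℕ) : ℝ) * a) ≤ (δ * B) * m := by gcongr
      have k4 := mul_le_mul_of_nonneg_right hδ2 hmr.le
      linarith
    have e5 : 4 * (t : ℝ) * B ≤ c * m / 5 := by
      have k1 : 4 * (t : ℝ) * B ≤ 4 * (3 * (ε * m)) * B := by gcongr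
      have k2 := mul_le_mul_of_nonneg_right hε2 hmr.le
      linarith
    push_cast at e2 ⊢
    linarith
  have hκθ : κ1 * θ1 ≤ 1 * θ1 := by gcongr
  have hcθ : 4 * c ≤ θ1 := by rw [hc]; linarith
  have hcθm := mul_le_mul_of_nonneg_right hcθ hmr.le
  have hκθ0 : 0 < κ1 * θ1 := by positivity
  refine ⟨{
    a := a
    b := b
    s := s
    load := load
    u := u
    θ := θ
    t := t
    FL := FL
    a_pos := by exact_mod_cast a_pos
    h_ab := ?_
    h_a := ?_
    h_main := ?_
    h_ub := ?_
    h_ub2 := ?_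
    h_b := ?_
    h_t := by linarith
    h_u := by linarith
    h_g := ?_
    h_s := ?_
    h_s2 := ?_
    h_load1 := load_ge
    h_load2 := load_le
    h_aq := a_ge
    h_hq := ?_
    h_J := hJn
    h_F := ?_
    h_F2 := ?_
    h_D := ?_
    h_T := ?_
    h_OV2 := ?_
    h_Jθ := ?_
    h_θu := ?_
    h_tu := ?_
    h_εt := ?_
    h_εu := ?_ }⟩
  · have : ((q * a + 2 * b : ℕ) : ℝ) ≤ m := by push_cast; linarith
    exact_mod_cast this
  · refine hm2.trans ?_
    have h1 : 4 * (q * ε) * m ≤ 1 * m := by gcongr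
    have h2 : (2 * (ε * m)) * q ≤ a * q := by linarith
    exact le_of_mul_le_mul_right h2 hqr
  · have h1 : (14 * (q * ε)) * a ≤ δ ^ 2 * a := by gcongr
    have h2 : 14 * ε * (m / 2) ≤ 14 * ε * (a * q) := by gcongr
    have hq1 : (1 : ℝ) ≤ q := by exact_mod_cast hq0
    have h3 : (a : ℝ) ≤ m := by
      have : (a : ℝ) * 1 ≤ a * q := by gcongr
      linarith
    have h4 : ε * a ≤ ε * m := by gcongr
    linarith
  · have : ((5 * u : ℕ) : ℝ) ≤ b := by push_cast; linarith
    exact_mod_cast this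
  · push_cast; linarith
  · linarith
  · push_cast
    have h1 : d0 / 2 * (κ1 * m / 2) ≤ (d0 - ε) * u := by
      have : d0 / 2 ≤ d0 - ε := by linarith
      have : 0 ≤ d0 - ε := by linarith
      gcongr
    have h2 : 2 * (θ1 * m) = d0 / 2 * (κ1 * m / 2) := by rw [hθ1]; ring
    linarith
  · have : (0 : ℝ) < s := by
      have : 0 < ρ * m := by positivity
      linarith
    exact_mod_cast this
  · have h1 : (1 + (Λ : ℝ)) * ((Δ + 1) * s) ≤ (1 + (Λ : ℝ)) * ((Δ + 1) * (ρ * m)) := by gcongr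
    have h2 := mul_le_mul_of_nonneg_right hρ1 hmr.le
    linarith
  · have h1 : ((Δ : ℝ) + 1) * s ≤ μ * m := by
      have k1 : (1 + (Λ : ℝ)) * ((Δ + 1) * s) ≤ (1 + (Λ : ℝ)) * ((Δ + 1) * (ρ * m)) := by gcongr
      have k2 := mul_le_mul_of_nonneg_right hρ1 hmr.le
      have k3 : 0 ≤ (Λ : ℝ) * ((Δ + 1) * s) := by positivity
      linarith
    have : ((load + (Δ + 1) * s : ℕ) : ℝ) ≤ ((q * a : ℕ) : ℝ) := by
      push_cast
      linarith
    exact_mod_cast this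
  · have h1 : (((Δ + 1) * (load / Λ) / a : ℕ) : ℝ) ≤ (((Δ + 1) * (load / Λ) : ℕ) : ℝ) / a := Nat.cast_div_le
    have h2 : (((Δ + 1) * (load / Λ) / a : ℕ) : ℝ) * a ≤ (Δ + 1) * (m / Λ) := by
      rw [le_div_iff₀ a_pos] at h1
      refine h1.trans ?_
      push_cast
      have k1 : ((load / Λ : ℕ) : ℝ) ≤ load / Λ := Nat.cast_div_le
      have k2 : (load : ℝ) / Λ ≤ m / Λ := by gcongr
      have k3 := k1.trans k2
      gcongr
    set cF : ℝ := (((Δ + 1) * (load / Λ) / a : ℕ) : ℝ) with hcF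
    have hcF0 : 0 ≤ cF := Nat.cast_nonneg _
    have h3 : cF * (3 * m) ≤ q * FL := by
      have k1 : cF * (m / 2) ≤ cF * (a * q) := by gcongr
      have k2 := mul_le_mul_of_nonneg_right h2 hqr.le
      have k3 : (q : ℝ) * (6 * ((Δ : ℝ) + 1) * m / Λ) ≤ q * FL := by gcongr
      have k4 : (q : ℝ) * (6 * ((Δ : ℝ) + 1) * m / Λ) = 6 * ((Δ + 1) * (m / Λ) * q) := by ring
      linarith
    rw [hcF] at h3
    exact_mod_cast h3
  · have h1 : (FL : ℝ) * (Δ + 1) ≤ u := by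
      have k1 : (FL : ℝ) * (Δ + 1) ≤ 7 * ((Δ : ℝ) + 1) * m / Λ * (Δ + 1) := by gcongr
      have k2 : 7 * ((Δ : ℝ) + 1) * m / Λ * (Δ + 1) ≤ κ1 * m / 2 := by
        rw [div_mul_eq_mul_div, div_le_iff₀ hΛr]
        have := mul_le_mul_of_nonneg_right hΛ1 hmr.le
        linarith
      linarith
    exact_mod_cast h1
  · have h1 : 2 * (((load / Λ + 2 * (n / s) * (Δ + 1) ^ L + 2 ^ (4 * (Δ + 1) ^ L) * a * (Δ + 1) ^ L) +
        (load / a * Nat.floor (δ * a) + 4 * t) * B : ℕ) : ℝ) ≤ θ := by linarith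
    exact_mod_cast h1
  · set E : ℕ := ((load / Λ + 2 * (n / s) * (Δ + 1) ^ L + 2 ^ (4 * (Δ + 1) ^ L) * a * (Δ + 1) ^ L) +
        (load / a * Nat.floor (δ * a) + 4 * t) * B)
    have h1 : ((E * (3 * m) + (Ci * m) * (2 * (n / s)) : ℕ) : ℝ) < (((u + 1) * (θ + 1) : ℕ) : ℝ) := by
      have k1 : (E : ℝ) * (3 * m) ≤ c * m * (3 * m) := by gcongr
      have k2 : (Ci * m : ℝ) * ((2 * (n / s) : ℕ) : ℝ) ≤ (Ci * m) * Cj := by gcongr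
      have k3 : κ1 * m * (θ1 * m) < ((u : ℝ) + 1) * (θ + 1) := by
        have : 0 < κ1 * m := by positivity
        have : 0 < θ1 * m := by positivity
        exact mul_lt_mul'' u_gt θ_gt (by positivity) (by positivity)
      have k4 := mul_le_mul_of_nonneg_right b11 hmr.le
      have k5 : c * m * (3 * m) = κ1 * m * (θ1 * m) / 8 := by rw [hc]; ring
      have k6 : 0 < κ1 * m * (θ1 * m) := by positivity
      rw [Nat.cast_add, Nat.cast_mul, Nat.cast_mul (Ci * m), Nat.cast_mul (u + 1)]
      push_cast at k2 ⊢
      linarith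
    exact_mod_cast h1
  · have h1 : ((2 * ((Ci * m) * (2 * (n / s))) : ℕ) : ℝ) < (((u + 1) * (Wc + 1) : ℕ) : ℝ) := by
      have k2 : (Ci * m : ℝ) * ((2 * (n / s) : ℕ) : ℝ) ≤ (Ci * m) * Cj := by gcongr
      have k3 : κ1 * m * ((Wc : ℝ) + 1) < ((u : ℝ) + 1) * (Wc + 1) := by
        have : (0 : ℝ) < (Wc : ℝ) + 1 := by positivity
        gcongr
      have k4 := mul_le_mul_of_nonneg_right hWc hmr.le
      push_cast at k2 ⊢
      linarith
    exact_mod_cast h1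
  · have : (Cj : ℝ) ≤ θ := by linarith
    exact_mod_cast this
  · have h1 : 2 * (θ1 * m) ≤ κ1 * m := by
      have : d0 * (κ1 * m) ≤ 1 * (κ1 * m) := by gcongr
      rw [hθ1]; linarith
    have : (θ : ℝ) ≤ u := by linarith
    exact_mod_cast this
  · have h1 : (Δ : ℝ) * t ≤ u := by
      have k1 : (Δ : ℝ) * t ≤ Δ * (3 * (ε * m)) := by gcongr
      have k2 := mul_le_mul_of_nonneg_right hε3 hmr.le
      linarith
    exact_mod_cast h1
  · linarith
  · linarith

end PartD2

section PartD3

open scoped Classical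

set_option maxHeartbeats 2000000 in
theorem pack_main (C : Cst) {n M m τ : ℕ} (G : SimpleGraph (Fin (2 * n + 1))) (hn0 : 0 < n) (hM2 : 2 ≤ M) (hMx : M ≤ C.Mx)
    (hm : m = (2 * n + 1) / M) (hbig : Big C m) (hZ : C.q ^ M * Nat.factorial M ≤ C.Z)
    (A : Fin M → Finset (Fin (2 * n + 1)))
    (hdisj : ∀ c c', c ≠ c' → Disjoint (A c) (A c')) (hAm : ∀ c, m ≤ (A c).card) (hAm' : ∀ c, (A c).card ≤ m + 1)
    (ed : Fin M → Fin M → Prop)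
    (hed : ∀ c c', ed c c' ↔ (c ≠ c' ∧ G.IsUniform C.ε (A c) (A c') ∧ C.d0 ≤ (G.edgeDensity (A c) (A c') : ℝ)))
    (hrow : ∀ c, ∑ c', (if ed c c' then (G.edgeDensity (A c) (A c') : ℝ) else 0) ≤ (1 + C.μ ^ 2) * C.α * M / 2)
    (htot : (1 - C.μ ^ 2) * C.α * M ^ 2 / 2 ≤ ∑ c, ∑ c', (if ed c c' then (G.edgeDensity (A c) (A c') : ℝ) else 0))
    (hbi : (biIndep G : ℝ) ≤ C.η * n) (hηn : 1 ≤ C.η * n) (hτ : (τ : ℝ) ≤ (1 - 100 * C.μ) * C.α * n)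
    {par : ℕ → ℕ} (hP : ParArr n C.Δ par) :
    ∃ φ : Fin τ → ℕ → Fin (2 * n + 1),
      (∀ i, Set.InjOn (φ i) {v | v < n}) ∧
      (∀ i, ∀ v, v < n → v ≠ 0 → G.Adj (φ i v) (φ i (par v))) ∧
      (∀ i j, i ≠ j → ∀ v w, v < n → v ≠ 0 → w < n → w ≠ 0 →
        s(φ i v, φ i (par v)) ≠ s(φ j w, φ j (par w))) := by
  have hμ := C.hμ
  have hμ1 := C.hμ1
  have hα := C.hα
  have hM0 : 0 < M := by omega
  have hMr : (0 : ℝ) < M := by exact_mod_cast hM0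
  have hMxr : (M : ℝ) ≤ C.Mx := by exact_mod_cast hMx
  have hnr : (0 : ℝ) < n := by exact_mod_cast hn0
  have hmr : (0 : ℝ) < m := by
    by_contra hcon
    push Not at hcon
    have := mul_nonpos_of_nonneg_of_nonpos hμ.le hcon
    have := hbig.b2
    linarith
  have hm0 : 0 < m := by exact_mod_cast hmr
  have hnM : (n : ℝ) ≤ m * (1 + C.μ) * M / 2 := by
    have h1 := Nat.lt_div_mul_add (a := 2 * n + 1) hM0
    have h2 : 2 * n + 1 < (m + 1) * M := by rw [hm]; linarith
    have h3 : (2 * n + 1 : ℝ) < (m + 1) * M := by exact_mod_cast h2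
    have h4 : 1 * (M : ℝ) ≤ (C.μ * m) * M := by
      have := hbig.b2
      gcongr; linarith
    linarith
  have hnM2 : (n : ℝ) ≤ m * M := by
    have : C.μ * (m * M) ≤ 1 * (m * M) := by gcongr; linarith
    linarith
  have hnMx : (n : ℝ) ≤ m * C.Mx := hnM2.trans (by gcongr)
  obtain ⟨P⟩ := exists_par C hbig hMx hnM2 hn0
  haveI : NeZero C.q := ⟨C.hq0.ne'⟩
  have hqr : (0 : ℝ) < C.q := by exact_mod_cast C.hq0
  have hQ : Fintype.card (ZMod C.q) = C.q := ZMod.card C.q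
  have hgm : (((C.Wc + C.Cj) * (2 * (Nat.floor (C.η * n) + 1)) : ℕ) : ℝ) ≤ C.ε * m := by
    have h1 : ((Nat.floor (C.η * n) : ℕ) : ℝ) ≤ C.η * n := Nat.floor_le (by linarith)
    have h2 : ((C.Wc + C.Cj : ℕ) : ℝ) * (2 * ((Nat.floor (C.η * n) : ℕ) + 1)) ≤
        ((C.Wc + C.Cj : ℕ) : ℝ) * (2 * (2 * (C.η * (m * C.Mx)))) := by
      have h3 : C.η * n ≤ C.η * (m * C.Mx) := mul_le_mul_of_nonneg_left hnMx C.hη.le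
      have h4 : (0 : ℝ) ≤ ((C.Wc + C.Cj : ℕ) : ℝ) := Nat.cast_nonneg _
      exact mul_le_mul_of_nonneg_left (by linarith) h4
    have h5 := mul_le_mul_of_nonneg_right C.hη1 hmr.le
    rw [Nat.cast_mul]
    refine le_trans (le_of_eq ?_) (h2.trans (le_trans (le_of_eq ?_) h5))
    · push_cast; ring
    · ring
  have hole : ∀ B : Finset (Fin (2 * n + 1)), P.u ≤ B.card → ∀ X : Finset (Fin (2 * n + 1)),
      (∀ v ∈ X, (B.filter (fun u => G.Adj v u)).card < C.Wc + C.Cj) → X.card ≤ P.t := by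
    intro B hB X hX
    refine hole_lemma G (h0 := Nat.floor (C.η * n)) (β := P.u) (Nat.le_floor hbi) ?_ ?_ B hB X hX
    · exact_mod_cast hgm.trans P.h_εu
    · have h1 : (C.Wc + C.Cj) * (2 * (Nat.floor (C.η * n) + 1)) ≤ P.t := by exact_mod_cast hgm.trans P.h_εt
      refine le_trans ?_ h1
      exact Nat.mul_le_mul_left _ (by omega)
  have hδd : C.δ ≤ C.d0 := by
    have := C.hδ1
    have : C.μ * C.d0 ≤ 1 * C.d0 := mul_le_mul_of_nonneg_right (by linarith) C.hd0.le
    linarith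
  obtain ⟨H, hH⟩ := host_of_parts G (Q := ZMod C.q) A hdisj hAm hAm' hm0 (by rw [hQ]; exact P.h_ab) C.hε C.hδ hδd
    (by have := C.hε1; have := C.hd0; linarith) P.h_a P.h_main P.h_ub P.h_ub2 P.h_b P.h_t P.h_u P.h_g hole
  obtain ⟨D, hD⟩ : ∃ D : Fin M → Fin M → ℝ, ∀ c c', D c c' = (G.edgeDensity (A c) (A c') : ℝ) := ⟨_, fun _ _ => rfl⟩
  have hDs : ∀ c c', D c c' = D c' c := by
    intro c c'; rw [hD, hD, G.edgeDensity_comm]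
  have hD0 : ∀ c c', 0 ≤ D c c' := by
    intro c c'; rw [hD]; exact_mod_cast G.edgeDensity_nonneg _ _
  have hD1 : ∀ c c', D c c' ≤ 1 := by
    intro c c'; rw [hD]; exact_mod_cast G.edgeDensity_le_one _ _
  have heds : ∀ c c', ed c c' → ed c' c := by
    intro c c' h
    rw [hed] at h ⊢
    refine ⟨h.1.symm, h.2.1.symm, ?_⟩
    rw [G.edgeDensity_comm]; exact h.2.2
  have hHe : ∀ c c', H.ed c c' ↔ ed c c' := fun c c' => (hH c c').trans (hed c c').symm
  have hedD : ∀ c c', ed c c' → C.d0 ≤ D c c' := by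
    intro c c' h; rw [hD]; exact ((hed c c').1 h).2.2
  simp only [← hD] at hrow htot
  obtain ⟨k, hk⟩ : ∃ k : ℝ, k = 2 / (C.α * M * (1 + C.μ ^ 2)) := ⟨_, rfl⟩
  have hk0 : 0 ≤ k := by rw [hk]; positivity
  have hsum : ∀ c, ∑ c', (if ed c c' then k * D c c' else 0) = k * ∑ c', (if ed c c' then D c c' else 0) := by
    intro c
    rw [Finset.mul_sum]
    refine Finset.sum_congr rfl (fun c' _ => ?_)
    split_ifs <;> simp
  have hmul := exists_multiplicities ed (fun c c' h => ((hed c c').1 h).1) (fun c c' => if ed c c' then k * D c c' else 0)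
    (by intro c c'; split_ifs; exacts [mul_nonneg hk0 (hD0 _ _), le_rfl])
    (by
      intro c c'
      by_cases h : ed c c'
      · rw [if_pos h, if_pos (heds _ _ h), hDs]
      · rw [if_neg h, if_neg (fun h' => h (heds _ _ h'))])
    (by intro c c' h; rw [if_neg h])
    (by
      intro c
      rw [hsum]
      refine (mul_le_mul_of_nonneg_left (hrow c) hk0).trans (le_of_eq ?_)
      rw [hk]; field_simp)
    C.μ hμ (by linarith) (by rw [Fintype.card_fin]; exact hM0)
    (by
      rw [Fintype.card_fin]
      simp only [hsum]
      rw [← Finset.mul_sum]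
      refine le_trans ?_ (mul_le_mul_of_nonneg_left htot hk0)
      have e1 : k * ((1 - C.μ ^ 2) * C.α * M ^ 2 / 2) = (1 - C.μ ^ 2) / (1 + C.μ ^ 2) * M := by
        rw [hk]; field_simp
      rw [e1]
      refine mul_le_mul_of_nonneg_right ?_ hMr.le
      rw [le_div_iff₀ (by positivity)]
      have : 0 ≤ C.μ ^ 2 * C.μ ^ 2 := by positivity
      linarith)
    τ (C.q ^ M) (pow_pos C.hq0 M)
  obtain ⟨Sg, instSg, sg, N, hN1, hN2, hN3, hN4⟩ := hmul
  rw [Fintype.card_fin] at hN2 hN3 hN4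
  have hZr : ((C.q ^ M : ℕ) : ℝ) * (Nat.factorial M : ℕ) ≤ C.Z := by exact_mod_cast hZ
  have hS : ∀ c c', ed c c' → ((C.q ^ M * ∑ j, N j * cnt (sg j) c c' : ℕ) : ℝ) ≤ D c c' * m * (2 - 100 * C.μ) := by
    intro c c' h
    have h1 := hN3 c c' h
    simp only [if_pos h] at h1
    refine num_S (W := k * D c c') (Z := C.Z) (τ := τ) (n := n) (M := M) (d0 := C.d0) hμ hμ1 hα hMr (hedD _ _ h) C.hd0 hmr (Nat.cast_nonneg _) hnr.le ?_ ?_ hτ hnM hbig.b8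
    · push_cast at h1 hZr ⊢
      linarith
    · have e1 : 2 * D c c' / (C.α * M) = (1 + C.μ ^ 2) * (k * D c c') := by
        rw [hk]; field_simp
      rw [e1]
      have : 0 ≤ C.μ ^ 2 * (k * D c c') := mul_nonneg (by positivity) (mul_nonneg hk0 (hD0 _ _))
      linarith
  have hA0 : ((P.load / P.a : ℕ) : ℝ) * P.a ≤ P.load := by exact_mod_cast Nat.div_mul_le_self _ _
  obtain ⟨gd, hgd⟩ : ∃ gd, gd = Nat.ceil ((1 - 2 * C.μ) * M) := ⟨_, rfl⟩
  have hgdr : (1 - 2 * C.μ) * M ≤ gd := by rw [hgd]; exact Nat.le_ceil _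
  have hgdpos : 0 < gd := by
    rw [hgd, Nat.ceil_pos]
    exact mul_pos (by linarith) hMr
  refine combine (s := P.s) (a := P.a) (load := P.load) (gd := gd) (θ := P.θ) (W := C.Wc) (OV1 := P.u) (OV2 := P.u) (FL := P.FL)
    (X := 3 * m) (Itot := C.Ci * m) (Λ := C.Λ) hP hn0 C.hΔ C.hL P.h_s P.a_pos C.hΛ0 H (by rw [Fintype.card_fin]; exact hM2) sg N ?_ hgdpos ?_ ?_ ?_
    C.hB rfl rfl rfl rfl ?_ ?_ ?_ ?_ le_rfl ?_ P.h_T P.h_OV2 ?_ ?_ ?_ P.h_tu ?_ ?_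
  · rw [hQ, Fintype.card_fin]; exact hN1
  · intro j
    rw [hgd]
    refine Nat.ceil_le.2 ((hN2 j).trans ?_)
    simp only [hHe]
    exact le_rfl
  · have h := num_load (n := n) (L := C.L) (Λ := C.Λ) (D1 := C.Δ + 1) (gd := gd) (s := P.s) (M := M) (m := m) (load := P.load) hμ hμ1 hnr.le
      (Nat.cast_nonneg _) hmr.le (Nat.cast_nonneg _) hnM hgdr C.hL2 P.h_s2 P.h_load1
    exact_mod_cast h
  · rw [hQ]; exact P.h_hq
  · intro c c' h
    rw [hHe] at h
    rw [hQ, Fintype.card_fin]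
    have h1 := num_R (capA := ((P.load / P.a : ℕ) : ℝ)) (S := ((C.q ^ M * ∑ j, N j * cnt (sg j) c c' : ℕ) : ℝ)) (q := C.q)
      (R := ((Nat.ceil (((G.edgeDensity (A c) (A c') : ℝ) + C.ε) * P.a) - Nat.floor (C.δ * P.a) : ℕ) : ℝ))
      (d := D c c') (d0 := C.d0) (m := m) (a := P.a) (δ := C.δ) hμ hμ1 hqr hmr (hedD _ _ h) C.hd0 (Nat.cast_nonneg _) hA0 P.h_load2 P.h_aq
      (hS c c' h) C.hδ1 ?_
    · exact_mod_cast h1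
    · rw [← hD]
      have e1 : (D c c' + C.ε) * P.a ≤ (Nat.ceil ((D c c' + C.ε) * P.a) : ℕ) := Nat.le_ceil _
      have e2 : ((Nat.floor (C.δ * P.a) : ℕ) : ℝ) ≤ C.δ * P.a := Nat.floor_le (mul_nonneg C.hδ.le (Nat.cast_nonneg _))
      have e3 : ((Nat.ceil ((D c c' + C.ε) * P.a) : ℕ) : ℝ) ≤
        ((Nat.ceil ((D c c' + C.ε) * P.a) - Nat.floor (C.δ * P.a) : ℕ) : ℝ) + (Nat.floor (C.δ * P.a) : ℕ) := by
        exact_mod_cast le_tsub_add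
      have e4 : 0 ≤ C.ε * P.a := mul_nonneg C.hε.le (Nat.cast_nonneg _)
      linarith
  · intro c c' h
    rw [hHe] at h
    rw [hQ, Fintype.card_fin]
    have h1 := hS c c' h
    have h2 : D c c' * m * (2 - 100 * C.μ) ≤ 1 * m * 3 := by
      have := hD1 c c'
      have := hD0 c c'
      gcongr <;> linarith
    have h3 : ((C.q ^ M * ∑ j, N j * cnt (sg j) c c' : ℕ) : ℝ) ≤ ((3 * m : ℕ) : ℝ) := by
      push_cast at h1 ⊢
      linarith
    exact_mod_cast h3
  · rw [hQ, Fintype.card_fin]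
    have h1 : (τ : ℝ) / (1 - C.μ) ≤ 2 * C.α * (m * C.Mx) := by
      rw [div_le_iff₀ (by linarith)]
      have e1 : (1 - 100 * C.μ) * C.α * n ≤ 1 * C.α * n := by gcongr; linarith
      have e2 : C.α * n ≤ C.α * (m * C.Mx) := by gcongr
      have e3 : C.α * (m * C.Mx) * 1 ≤ C.α * (m * C.Mx) * (2 * (1 - C.μ)) := by gcongr; linarith
      linarith
    have h2 : (2 * C.α * C.Mx + 1) * m ≤ C.Ci * m := mul_le_mul_of_nonneg_right C.hCi hmr.le
    have h3 := hbig.b9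
    have h4 : ((C.q ^ M * ∑ j, N j : ℕ) : ℝ) ≤ ((C.Ci * m : ℕ) : ℝ) := by
      push_cast at hN4 hZr ⊢
      linarith
    exact_mod_cast h4
  · rw [hQ]; exact P.h_F
  · have := P.h_F2
    omega
  · have := P.h_D
    omega
  · have := P.h_J
    have := P.h_Jθ
    omega
  · have := P.h_J
    omega
  · have := P.h_J
    have := P.h_Jθ
    have := P.h_θu
    omega
  · exact P.h_D.trans P.h_θu

end PartD3

section PartD4

open scoped Classical

theorem ev_small (k : ℝ) {r : ℝ} (hr : 0 < r) : ∀ᶠ x : ℝ in nhdsWithin 0 (Set.Ioi 0), k * x ≤ r := by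
  have h : Filter.Tendsto (fun x : ℝ => k * x) (nhds 0) (nhds (k * 0)) := (continuous_const.mul continuous_id).tendsto 0
  rw [mul_zero] at h
  exact (h.mono_left nhdsWithin_le_nhds).eventually_le_const hr

theorem ev_big {k : ℝ} (hk : 0 < k) (r : ℝ) : ∀ᶠ m : ℕ in Filter.atTop, r ≤ k * m :=
  (tendsto_natCast_atTop_atTop.const_mul_atTop hk).eventually_ge_atTop r

theorem exists_cst {α μ : ℝ} (hα : 0 < α) (hμ : 0 < μ) (hμ1 : μ ≤ 1 / 200) {Δ : ℕ} (hΔ : 1 ≤ Δ) :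
    ∃ (C : Cst) (l : ℕ), C.α = α ∧ C.μ = μ ∧ C.Δ = Δ ∧ 2 ≤ l ∧ C.Mx = SzemerediRegularity.bound C.ε l ∧
      C.Z = C.q ^ C.Mx * Nat.factorial C.Mx ∧ 2 / (l : ℝ) + 2 * C.ε + 2 * C.d0 ≤ μ ^ 2 * α * (1 / 2) := by
  have hμα : 0 < μ ^ 2 * α := by positivity
  obtain ⟨d0, hd0, hd01, hd02⟩ : ∃ d0 : ℝ, 0 < d0 ∧ d0 ≤ 1 ∧ d0 ≤ μ ^ 2 * α / 16 :=
    ⟨min 1 (μ ^ 2 * α / 16), lt_min one_pos (by positivity), min_le_left _ _, min_le_right _ _⟩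
  obtain ⟨κ1, hκ1⟩ : ∃ κ1, κ1 = d0 * μ / 20 := ⟨_, rfl⟩
  obtain ⟨θ1, hθ1⟩ : ∃ θ1, θ1 = d0 * κ1 / 8 := ⟨_, rfl⟩
  obtain ⟨c, hc⟩ : ∃ c, c = κ1 * θ1 / 24 := ⟨_, rfl⟩
  have hκ0 : 0 < κ1 := by rw [hκ1]; positivity
  have hθ0 : 0 < θ1 := by rw [hθ1]; positivity
  have hc0 : 0 < c := by rw [hc]; positivity
  obtain ⟨Λ, hΛ1, hΛ2, hΛ0⟩ := ((ev_big hκ0 (14 * ((Δ : ℝ) + 1) ^ 2)).and ((ev_big hc0 5).and (Filter.eventually_gt_atTop 0))).exists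
  obtain ⟨L, hL2, hL⟩ := ((ev_big hμ ((Λ : ℝ) * (Δ + 1))).and (Filter.eventually_ge_atTop 3)).exists
  obtain ⟨B, hB⟩ : ∃ B, B = (Δ + 1) ^ L := ⟨_, rfl⟩
  obtain ⟨q, hq, hq0⟩ := ((ev_big hc0 (5 * 2 ^ (4 * B) * (B : ℝ))).and (Filter.eventually_gt_atTop 0)).exists
  obtain ⟨ρ, hρ1, hρ⟩ := ((ev_small ((1 + (Λ : ℝ)) * (Δ + 1)) hμ).and self_mem_nhdsWithin).exists
  obtain ⟨δ, hδ1, hδ2, hδ⟩ := ((ev_small 1 (mul_pos hμ hd0)).and ((ev_small (5 * (B : ℝ)) hc0).and self_mem_nhdsWithin)).exists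
  have hδ0 : (0 : ℝ) < δ := hδ
  obtain ⟨ε, hε1, hε2, hε3, hε4, hε5, hε6, hε7, hε⟩ := ((ev_small 2 hd0).and ((ev_small (60 * (B : ℝ)) hc0).and
    ((ev_small (6 * (Δ : ℝ)) hκ0).and ((ev_small 4 hκ0).and ((ev_small (4 * (q : ℝ)) one_pos).and
    ((ev_small (14 * (q : ℝ)) (pow_pos hδ0 2)).and ((ev_small 16 hμα).and self_mem_nhdsWithin))))))).exists
  have hε0 : (0 : ℝ) < ε := hε
  have hρ0 : (0 : ℝ) < ρ := hρ
  obtain ⟨l, hl, hl2⟩ := ((ev_big hμα 16).and (Filter.eventually_ge_atTop 2)).exists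
  obtain ⟨Mx, hMx⟩ : ∃ Mx, Mx = SzemerediRegularity.bound ε l := ⟨_, rfl⟩
  obtain ⟨Cj, hCj⟩ := (ev_big hρ0 (4 * (Mx : ℝ))).exists
  obtain ⟨Ci, hCi⟩ := (ev_big one_pos (2 * α * Mx + 1)).exists
  obtain ⟨Wc, hWc⟩ := (ev_big hκ0 (2 * ((Ci : ℝ) * Cj))).exists
  obtain ⟨η, hη1, hη⟩ := ((ev_small (4 * (((Wc + Cj : ℕ) : ℝ) * Mx)) hε0).and self_mem_nhdsWithin).exists
  refine ⟨⟨α, μ, d0, κ1, θ1, c, ρ, δ, ε, η, Δ, Λ, L, B, q, Mx, Cj, Ci, Wc, q ^ Mx * Nat.factorial Mx, hα, hμ, hμ1, hd0, hd01, hκ1, hθ1, hc, hΔ, hΛ0,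
    hΛ1, hΛ2, hL, hL2, hB, hq0, hq, hρ, ?_, hδ, ?_, ?_, hε, ?_, ?_, ?_, hε4, ?_, ?_, hCj, ?_, ?_, hη, ?_⟩, l, rfl, rfl, rfl, hl2, hMx, rfl, ?_⟩
  · linarith
  · linarith
  · linarith
  · linarith
  · linarith
  · linarith
  · linarith
  · linarith
  · linarith
  · linarith
  · linarith
  · have hl0 : (0 : ℝ) < l := by exact_mod_cast (by omega : 0 < l)
    have : 2 / (l : ℝ) ≤ μ ^ 2 * α / 8 := by
      rw [div_le_iff₀ hl0]; linarith
    simp only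
    linarith

theorem ev_Big (C : Cst) : ∀ᶠ m : ℕ in Filter.atTop, Big C m := by
  have hμ := C.hμ
  have hd0 := C.hd0
  have hκ0 : 0 < C.κ1 := by rw [C.hκ1]; positivity
  have hθ0 : 0 < C.θ1 := by rw [C.hθ1]; positivity
  have hc0 : 0 < C.c := by rw [C.hc]; positivity
  filter_upwards [ev_big hμ C.q, ev_big hμ 2, ev_big C.hρ 2, ev_big hκ0 2, ev_big hθ0 2, ev_big C.hε 1, ev_big one_pos C.Λ,
    ev_big (mul_pos hμ hd0) (2 * (C.Z : ℝ)), ev_big one_pos C.Z, ev_big hc0 (5 * ((C.Cj : ℝ) * C.B)),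
    ev_big (mul_pos hκ0 hθ0) (2 * ((C.Ci : ℝ) * C.Cj)), ev_big hθ0 (2 * (C.Cj : ℝ))] with m h1 h2 h3 h4 h5 h6 h7 h8 h9 h10 h11 h12
  exact ⟨h1, h2, h3, h4, h5, h6, by linarith, h8, by linarith, h10, h11, h12⟩

theorem main_aux (α ν : ℝ) (Δ : ℕ) (hα : 0 < α) (hν : 0 < ν) :
    ∃ (ξ η : ℝ) (n₀ : ℕ), 0 < ξ ∧ 0 < η ∧
      ∀ n : ℕ, n₀ ≤ n →
      ∀ G : SimpleGraph (Fin (2 * n + 1)),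
        (({v : Fin (2 * n + 1) |
            ¬ ((α - ξ) * n ≤ (deg G v : ℝ) ∧ (deg G v : ℝ) ≤ (α + ξ) * n)}.ncard : ℝ)
          ≤ ξ * n) →
        (biIndep G : ℝ) ≤ η * n →
        ∀ T : SimpleGraph (Fin n), T.IsTree → (∀ v, deg T v ≤ Δ) →
          PacksInto (fun _ : Fin (⌊(1 - ν) * α * n⌋₊) => T) G := by
  obtain ⟨μ, hμ, hμ1, hμν⟩ : ∃ μ : ℝ, 0 < μ ∧ μ ≤ 1 / 200 ∧ 100 * μ ≤ ν :=
    ⟨min (1 / 200) (ν / 100), lt_min (by norm_num) (by positivity), min_le_left _ _, by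
      have := min_le_right (1 / 200) (ν / 100); linarith⟩
  obtain ⟨C, l, hCα, hCμ, hCΔ, hl2, hMx, hZ, hlow⟩ := exists_cst hα hμ hμ1 (le_max_right Δ 1)
  have hμα : 0 < μ ^ 2 * α := by positivity
  obtain ⟨ξ, hξ1, hξ2, hξ3, hξ4, hξ⟩ := ((ev_small 1 one_pos).and ((ev_small 1 hα).and
    ((ev_small (α + 2 + 4 * (C.Mx : ℝ)) hμα).and ((ev_small (2 * (1 + 4 * α)) hμα).and self_mem_nhdsWithin)))).exists
  have hξ0 : (0 : ℝ) < ξ := hξ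
  obtain ⟨m0, hm0⟩ := Filter.eventually_atTop.1 (ev_Big C)
  obtain ⟨n₀, hn₀⟩ := Filter.eventually_atTop.1 ((ev_big C.hη 1).and ((ev_big one_pos ((C.Mx : ℝ) * (1 / ξ + 1))).and
    ((Filter.eventually_ge_atTop (m0 * C.Mx)).and ((Filter.eventually_ge_atTop l).and (Filter.eventually_gt_atTop 0)))))
  refine ⟨ξ, C.η, n₀, hξ0, C.hη, ?_⟩
  intro n hn G hdeg hbi T hT hd
  obtain ⟨h1, h2, h3, h4, h5⟩ := hn₀ n hn
  refine packs_of_arr (Δ := C.Δ) G T hT (fun v => (hd v).trans (by rw [hCΔ]; exact le_max_left _ _)) ?_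
  intro par hP
  obtain ⟨M, hM1, hM2, A, hdj, hA1, hA2, hrow, htot⟩ := reg_parts (l := l) (ν1 := μ ^ 2) (d0 := C.d0) hα C.hε hξ0 (by linarith) C.hd0 (by linarith)
    G (by omega) (by omega) hdeg (by rw [← hMx]; linarith) (by linarith) (by rw [← hMx]; linarith)
  rw [← hMx] at hM2
  have hM0 : 0 < M := by omega
  have hbig : Big C ((2 * n + 1) / M) := by
    refine hm0 _ ?_
    rw [Nat.le_div_iff_mul_le hM0]
    have := Nat.mul_le_mul_left m0 hM2
    omega
  obtain ⟨ed, hed⟩ : ∃ ed : Fin M → Fin M → Prop, ∀ c c', ed c c' ↔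
    (c ≠ c' ∧ G.IsUniform C.ε (A c) (A c') ∧ C.d0 ≤ (G.edgeDensity (A c) (A c') : ℝ)) := ⟨_, fun _ _ => Iff.rfl⟩
  have hif : ∀ c c', (if (c ≠ c' ∧ G.IsUniform C.ε (A c) (A c') ∧ C.d0 ≤ (G.edgeDensity (A c) (A c') : ℝ))
        then (G.edgeDensity (A c) (A c') : ℝ) else 0) = if ed c c' then (G.edgeDensity (A c) (A c') : ℝ) else 0 := by
    intro c c'
    by_cases h : ed c c'
    · rw [if_pos h, if_pos ((hed _ _).1 h)]
    · rw [if_neg h, if_neg (fun h' => h ((hed _ _).2 h'))]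
  simp only [hif] at hrow htot
  refine pack_main C G h5 (by omega) hM2 rfl hbig ?_ A hdj hA1 hA2 ed hed (by rw [hCμ, hCα]; exact hrow) (by rw [hCμ, hCα]; exact htot)
    hbi h1 ?_ hP
  · rw [hZ]
    exact Nat.mul_le_mul (Nat.pow_le_pow_right C.hq0 hM2) (Nat.factorial_le hM2)
  · rw [hCμ, hCα]
    have hnr : (0 : ℝ) ≤ n := Nat.cast_nonneg _
    have e : 0 ≤ (1 - 100 * μ) * α * n := mul_nonneg (mul_nonneg (by linarith) hα.le) hnr
    refine (Nat.cast_le.2 (Nat.floor_le_floor (?_ : (1 - ν) * α * n ≤ (1 - 100 * μ) * α * n))).trans (Nat.floor_le e)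
    gcongr

end PartD4

/-- Ringel-type application: an almost `αn`-regular `(2n+1)`-vertex graph with
small bi-independence number has an approximate decomposition into
`⌊(1-ν)αn⌋` copies of any fixed `n`-vertex bounded-degree tree. -/
theorem ringel_for_almost_regular
    (α ν : ℝ) (Δ : ℕ) (hα : 0 < α) (hν : 0 < ν) :
    ∃ (ξ η : ℝ) (n₀ : ℕ), 0 < ξ ∧ 0 < η ∧
      ∀ n : ℕ, n₀ ≤ n →
      ∀ G : SimpleGraph (Fin (2 * n + 1)),
        (({v : Fin (2 * n + 1) |
            ¬ ((α - ξ) * n ≤ (deg G v : ℝ) ∧ (deg G v : ℝ) ≤ (α + ξ) * n)}.ncard : ℝ)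
          ≤ ξ * n) →
        (biIndep G : ℝ) ≤ η * n →
        ∀ T : SimpleGraph (Fin n), T.IsTree → (∀ v, deg T v ≤ Δ) →
          PacksInto (fun _ : Fin (⌊(1 - ν) * α * n⌋₊) => T) G := by
  exact main_aux α ν Δ hα hν

end ApproxDecomp
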